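/- Let Ω' = {(ξ,η) : ξ > ψ(η), 0 < η < η₀} be a semi-infinite strip behind a curve S = {ξ = ψ(η)}, and let u be a bounded continuous weak solution of a uniformly elliptic divergence-form equation ∂ξ(a¹¹∂ξu + a¹²∂ηu) + ∂η(a²¹∂ξu + a²²∂ηu) = 0 with bounded C¹_loc coefficients, satisfying homogeneous Neumann conditions on the lateral boundaries {η = 0, ξ > ψ(0)} and {η = η₀, ξ > ψ(η₀)}. Then at least one of inf_{Ω'} u, sup_{Ω'} u is attained on S. -/

import Mathlib

open MeasureTheory

namespace StripExtreme

open Set Metric Filter Topology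

/-- Translations act continuously on `L²`, tested against a fixed `L²` function. -/
lemma continuous_integral_mul_translate {Y D : ℝ × ℝ → ℝ} (hY : MemLp Y 2 volume)
    (hD : MemLp D 2 volume) :
    Continuous (fun t => ∫ z, Y z * D (z - t)) := by
  have hmp : ∀ t : ℝ × ℝ, MeasurePreserving
      ((⟨fun z => z - t, by fun_prop⟩ : C(ℝ × ℝ, ℝ × ℝ))) volume volume :=
    fun t => measurePreserving_sub_right volume t
  have hg : Continuous (fun t : ℝ × ℝ => (⟨fun z => z - t, by fun_prop⟩ : C(ℝ × ℝ, ℝ × ℝ))) := by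
    apply ContinuousMap.continuous_of_continuous_uncurry
    simp only [Function.uncurry_def, ContinuousMap.coe_mk]
    fun_prop
  have hc : Continuous (fun t : ℝ × ℝ => Lp.compMeasurePreserving _ (hmp t) (hD.toLp D)) :=
    Continuous.compMeasurePreservingLp continuous_const hg hmp (by norm_num)
  have h2 : Continuous (fun t : ℝ × ℝ =>
      inner ℝ (hY.toLp Y) (Lp.compMeasurePreserving _ (hmp t) (hD.toLp D))) :=
    continuous_const.inner hc
  have h3 : ∀ t : ℝ × ℝ, inner ℝ (hY.toLp Y) (Lp.compMeasurePreserving _ (hmp t) (hD.toLp D))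
      = ∫ z, Y z * D (z - t) := by
    intro t
    rw [L2.inner_def]
    apply integral_congr_ae
    have e1 := hY.coeFn_toLp
    have e2 := Lp.coeFn_compMeasurePreserving (hD.toLp D) (hmp t)
    have e3 := (hmp t).quasiMeasurePreserving.ae_eq_comp hD.coeFn_toLp
    filter_upwards [e1, e2, e3] with z h1 h2 h3
    rw [h1, h2, h3]
    simp [mul_comm]
  simpa only [h3] using h2

/-- Testing against translates of `D` averaged by a kernel `k`. -/
lemma integral_mul_average {Y D k : ℝ × ℝ → ℝ} (hY : Integrable Y) (hD : Integrable D)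
    (hk : Continuous k) (hkc : HasCompactSupport k) :
    ∫ z, Y z * ∫ t, D t * k (z - t) = ∫ s, k s * ∫ z, Y z * D (z - s) := by
  have h1 : ∀ z, ∫ t, D t * k (z - t) = ∫ s, D (z - s) * k s := by
    intro z
    rw [← integral_sub_left_eq_self (fun t => D t * k (z - t)) volume z]
    simp
  have hD' : Integrable (fun x => D (-x)) := hD.comp_neg
  have h2 : Integrable (fun p : (ℝ × ℝ) × (ℝ × ℝ) => Y p.2 * D (p.2 - p.1))
      (volume.prod volume) := by
    have := Integrable.convolution_integrand (ContinuousLinearMap.mul ℝ ℝ) hY hD'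
    simpa using this
  obtain ⟨C, hC⟩ := hkc.exists_bound_of_continuous hk
  have h3 : Integrable (fun p : (ℝ × ℝ) × (ℝ × ℝ) => k p.1 * (Y p.2 * D (p.2 - p.1)))
      (volume.prod volume) := by
    apply h2.bdd_mul (c := C)
    · exact (hk.comp continuous_fst).aestronglyMeasurable
    · exact Eventually.of_forall fun p => hC p.1
  calc ∫ z, Y z * ∫ t, D t * k (z - t) = ∫ z, ∫ s, k s * (Y z * D (z - s)) := by
        congr 1; ext z
        rw [h1 z, ← integral_const_mul]
        congr 1; ext s; ring
    _ = ∫ s, ∫ z, k s * (Y z * D (z - s)) := by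
        rw [integral_integral_swap]
        exact h3.swap
    _ = _ := by
        congr 1; ext s; rw [integral_const_mul]

/-- The partial derivative in the first variable. -/
noncomputable def dx (f : ℝ × ℝ → ℝ) (z : ℝ × ℝ) : ℝ := fderiv ℝ f z (1, 0)

/-- The partial derivative in the second variable. -/
noncomputable def dy (f : ℝ × ℝ → ℝ) (z : ℝ × ℝ) : ℝ := fderiv ℝ f z (0, 1)

lemma measurable_dx (f : ℝ × ℝ → ℝ) : Measurable (dx f) := measurable_fderiv_apply_const ℝ f _
lemma measurable_dy (f : ℝ × ℝ → ℝ) : Measurable (dy f) := measurable_fderiv_apply_const ℝ f _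

/-- Vanishing of the weak form `∫_D Y·∇φ` for all smooth `φ` compactly supported in `U`. -/
def WeakZero (D : Set (ℝ × ℝ)) (Y₁ Y₂ : ℝ × ℝ → ℝ) (U : Set (ℝ × ℝ)) : Prop :=
  ∀ φ : ℝ × ℝ → ℝ, ContDiff ℝ (⊤ : ℕ∞) φ → HasCompactSupport φ → tsupport φ ⊆ U →
    ∫ z in D, (Y₁ z * dx φ z + Y₂ z * dy φ z) = 0

/-- The half-plane `{σ (y - b) > 0}`. -/
def halfPlane (σ b : ℝ) : Set (ℝ × ℝ) := {z | 0 < σ * (z.2 - b)}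

lemma isOpen_halfPlane (σ b : ℝ) : IsOpen (halfPlane σ b) := by
  unfold halfPlane
  exact isOpen_lt (by fun_prop) (by fun_prop)

lemma measurableSet_halfPlane (σ b : ℝ) : MeasurableSet (halfPlane σ b) :=
  (isOpen_halfPlane σ b).measurableSet

/-- Derivative of a mollification of a function that is differentiable in an open set `H`, at
points `z` where the mollifying kernel only sees `H`. -/
lemma fderiv_mollify {H : Set (ℝ × ℝ)} (hH : IsOpen H) {f : ℝ × ℝ → ℝ}
    (hf : ∀ z ∈ H, DifferentiableAt ℝ f z) (hfi : Integrable (H.indicator f))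
    {v : ℝ × ℝ} (hfv : Integrable (H.indicator (fun z => fderiv ℝ f z v)))
    {k : ℝ × ℝ → ℝ} (hk : ContDiff ℝ (⊤ : ℕ∞) k) (hkc : HasCompactSupport k)
    {z : ℝ × ℝ} (hz : ∀ t, z - t ∈ tsupport k → t ∈ H) :
    fderiv ℝ (fun z => ∫ t, H.indicator f t * k (z - t)) z v =
      ∫ t, H.indicator (fun z => fderiv ℝ f z v) t * k (z - t) := by
  have hd := hkc.hasFDerivAt_convolution_right (ContinuousLinearMap.mul ℝ ℝ)
    hfi.locallyIntegrable (hk.of_le (by exact_mod_cast le_top)) z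
  have e : (fun z => ∫ t, H.indicator f t * k (z - t)) =
      convolution (H.indicator f) k (ContinuousLinearMap.mul ℝ ℝ) volume := by
    ext z; simp [convolution]
  rw [e, hd.fderiv, convolution_precompR_apply _ hfi.locallyIntegrable (hkc.fderiv ℝ)
    (hk.continuous_fderiv (by simp))]
  simp only [convolution, ContinuousLinearMap.mul_apply']
  have hkd : Differentiable ℝ k := hk.differentiable (by simp)
  obtain ⟨C, hC⟩ := hkc.exists_bound_of_continuous hk.continuous
  have hdk : Continuous (fun x => fderiv ℝ k x v) :=
    (hk.continuous_fderiv (by simp)).clm_apply continuous_const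
  have hdkc : HasCompactSupport (fun x => fderiv ℝ k x v) := by
    refine (hkc.fderiv ℝ).comp_left (g := fun (L : ℝ × ℝ →L[ℝ] ℝ) => L v) (by simp)
  obtain ⟨C', hC'⟩ := hdkc.exists_bound_of_continuous hdk
  have hts : tsupport (fun t => k (z - t)) ⊆ H := by
    have : tsupport (fun t => k (z - t)) ⊆ (fun t => z - t) ⁻¹' tsupport k := by
      apply closure_minimal
      · intro t ht
        exact subset_tsupport _ ht
      · exact (isClosed_tsupport k).preimage (by fun_prop)
    exact fun t ht => hz t (this ht)
  have key := integral_bilinear_hasFDerivAt_right_eq_neg_left_of_integrable (μ := volume)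
    (f := H.indicator f) (f' := fun t => fderiv ℝ f t) (g := fun t => k (z - t))
    (g' := fun t => -(fderiv ℝ k (z - t))) (v := v) (B := ContinuousLinearMap.mul ℝ ℝ) ?_ ?_ ?_ ?_ ?_
  · simp only [ContinuousLinearMap.mul_apply', neg_apply, mul_neg,
      integral_neg, neg_inj] at key
    rw [key]
    congr 1; ext t
    by_cases ht : t ∈ H
    · simp [ht]
    · have : k (z - t) = 0 := by
        by_contra h
        exact ht (hz t (subset_tsupport _ h))
      simp [this]
  · have : Integrable (fun t => H.indicator (fun z => fderiv ℝ f z v) t * k (z - t)) := by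
      apply hfv.mul_bdd (c := C)
      · exact (hk.continuous.comp (by fun_prop)).aestronglyMeasurable
      · exact Eventually.of_forall fun p => hC _
    refine this.congr (Eventually.of_forall fun t => ?_)
    by_cases ht : t ∈ H
    · simp [ht]
    · have : k (z - t) = 0 := by
        by_contra h
        exact ht (hz t (subset_tsupport _ h))
      simp [this]
  · have : Integrable (fun t => H.indicator f t * fderiv ℝ k (z - t) v) := by
      apply hfi.mul_bdd (c := C')
      · exact (hdk.comp (by fun_prop)).aestronglyMeasurable
      · exact Eventually.of_forall fun p => hC' _
    simpa using this.neg
  · apply hfi.mul_bdd (c := C)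
    · exact (hk.continuous.comp (by fun_prop)).aestronglyMeasurable
    · exact Eventually.of_forall fun p => hC _
  · intro t ht
    have hn : f =ᶠ[𝓝 t] H.indicator f := by
      filter_upwards [hH.mem_nhds (hts ht)] with x hx
      simp [hx]
    exact ((hf t (hts ht)).hasFDerivAt).congr_of_eventuallyEq hn.symm
  · intro t _
    have := (hkd (z - t)).hasFDerivAt.comp t ((hasFDerivAt_id t).const_sub z)
    simpa [Function.comp_def] using! this

lemma fderiv_eq_zero_of_vanish_off {f : ℝ × ℝ → ℝ} {K : Set (ℝ × ℝ)} (hK : IsClosed K)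
    (hf : ∀ z ∉ K, f z = 0) {z : ℝ × ℝ} (hz : z ∉ K) : fderiv ℝ f z = 0 := by
  have : f =ᶠ[𝓝 z] fun _ => 0 := by
    filter_upwards [hK.isOpen_compl.mem_nhds hz] with x hx using hf x hx
  rw [this.fderiv_eq]; simp

lemma integrable_indicator_of_memLp {H K : Set (ℝ × ℝ)} (hH : MeasurableSet H) (hK : IsCompact K)
    {g : ℝ × ℝ → ℝ} (hg : MemLp g 2 (volume.restrict H)) (h0 : ∀ z ∉ K, g z = 0) :
    Integrable (H.indicator g) := by
  have h1 : MemLp (H.indicator g) 2 volume := (memLp_indicator_iff_restrict hH).2 hg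
  have h2 : IntegrableOn (H.indicator g) K := by
    have : IsFiniteMeasure (volume.restrict K) := ⟨by simpa using hK.measure_lt_top⟩
    exact (h1.restrict K).integrable (by norm_num)
  refine (integrableOn_iff_integrable_of_support_subset ?_).1 h2
  intro z hz
  by_contra h
  apply hz
  by_cases hzH : z ∈ H <;> simp [hzH, h0 z h]

/-- The weak equation extends from smooth test functions to everywhere differentiable ones with
square-integrable gradient, up to the boundary of a half-plane. -/
theorem integral_eq_zero_of_weakZero {σ b : ℝ} (hσ : σ = 1 ∨ σ = -1) {U : Set (ℝ × ℝ)}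
    (hU : IsOpen U) (hUb : volume U < ⊤) {Y₁ Y₂ : ℝ × ℝ → ℝ}
    (hY₁ : MemLp Y₁ 2 (volume.restrict (halfPlane σ b ∩ U)))
    (hY₂ : MemLp Y₂ 2 (volume.restrict (halfPlane σ b ∩ U)))
    (hT : WeakZero (halfPlane σ b) Y₁ Y₂ U) {f : ℝ × ℝ → ℝ} {K : Set (ℝ × ℝ)}
    (hK : IsCompact K) (hKU : K ⊆ U) (hfK : ∀ z ∉ K, f z = 0)
    (hfd : ∀ z ∈ halfPlane σ b, DifferentiableAt ℝ f z)
    (hfb : ∃ C, ∀ z ∈ halfPlane σ b, |f z| ≤ C)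
    (hfx : MemLp (dx f) 2 (volume.restrict (halfPlane σ b)))
    (hfy : MemLp (dy f) 2 (volume.restrict (halfPlane σ b))) :
    ∫ z in halfPlane σ b, (Y₁ z * dx f z + Y₂ z * dy f z) = 0 := by
  set H := halfPlane σ b with hHdef
  have hHo : IsOpen H := isOpen_halfPlane σ b
  have hHm : MeasurableSet H := hHo.measurableSet
  have hσ2 : σ * σ = 1 := by rcases hσ with rfl | rfl <;> norm_num
  have hσa : |σ| = 1 := by rcases hσ with rfl | rfl <;> norm_num
  have hHU : MeasurableSet (H ∩ U) := hHm.inter hU.measurableSet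
  have : IsFiniteMeasure (volume.restrict (H ∩ U)) :=
    ⟨by simpa using (measure_mono inter_subset_right).trans_lt hUb⟩
  set Z₁ := (H ∩ U).indicator Y₁
  set Z₂ := (H ∩ U).indicator Y₂
  have hZ₁ : MemLp Z₁ 2 volume := (memLp_indicator_iff_restrict hHU).2 hY₁
  have hZ₂ : MemLp Z₂ 2 volume := (memLp_indicator_iff_restrict hHU).2 hY₂
  have hZ₁i : Integrable Z₁ := (integrable_indicator_iff hHU).2 (hY₁.integrable (by norm_num))
  have hZ₂i : Integrable Z₂ := (integrable_indicator_iff hHU).2 (hY₂.integrable (by norm_num))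
  set D₁ := H.indicator (dx f)
  set D₂ := H.indicator (dy f)
  have hD₁ : MemLp D₁ 2 volume := (memLp_indicator_iff_restrict hHm).2 hfx
  have hD₂ : MemLp D₂ 2 volume := (memLp_indicator_iff_restrict hHm).2 hfy
  have hD₁i : Integrable D₁ := integrable_indicator_of_memLp hHm hK hfx fun z hz => by
    simp [dx, fderiv_eq_zero_of_vanish_off hK.isClosed hfK hz]
  have hD₂i : Integrable D₂ := integrable_indicator_of_memLp hHm hK hfy fun z hz => by
    simp [dy, fderiv_eq_zero_of_vanish_off hK.isClosed hfK hz]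
  have hfi : Integrable (H.indicator f) := by
    obtain ⟨C, hC⟩ := hfb
    have h1 : AEStronglyMeasurable f (volume.restrict H) :=
      ContinuousOn.aestronglyMeasurable
        (fun z hz => (hfd z hz).continuousAt.continuousWithinAt) hHm
    have h2 : AEStronglyMeasurable (H.indicator f) volume :=
      (aestronglyMeasurable_indicator_iff hHm).2 h1
    have h3 : IntegrableOn (H.indicator f) K := by
      refine Measure.integrableOn_of_bounded (M := |C|) hK.measure_lt_top.ne h2 ?_
      refine Eventually.of_forall fun z => ?_
      by_cases hz : z ∈ H
      · simpa [hz] using (hC z hz).trans (le_abs_self C)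
      · simp [hz]
    refine (integrableOn_iff_integrable_of_support_subset ?_).1 h3
    intro z hz
    by_contra h
    apply hz
    by_cases hzH : z ∈ H <;> simp [hzH, hfK z h]
  set q : ℝ × ℝ → ℝ := fun s => (∫ z, Z₁ z * D₁ (z - s)) + ∫ z, Z₂ z * D₂ (z - s)
  have hq : Continuous q := (continuous_integral_mul_translate hZ₁ hD₁).add
    (continuous_integral_mul_translate hZ₂ hD₂)
  have hq0 : ∫ z in H, (Y₁ z * dx f z + Y₂ z * dy f z) = q 0 := by
    have e : ∫ z in H, (Y₁ z * dx f z + Y₂ z * dy f z) = ∫ z, (Z₁ z * D₁ z + Z₂ z * D₂ z) := by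
      rw [← integral_indicator hHm]
      congr 1; ext z
      by_cases hz : z ∈ H
      · by_cases hzU : z ∈ U
        · simp [Z₁, Z₂, D₁, D₂, hz, hzU]
        · have : fderiv ℝ f z = 0 :=
            fderiv_eq_zero_of_vanish_off hK.isClosed hfK (fun h => hzU (hKU h))
          simp [Z₁, Z₂, hz, hzU, dx, dy, this]
      · simp [Z₁, Z₂, hz]
    rw [e, integral_add]
    · simp [q]
    · exact hZ₁.integrable_mul hD₁
    · exact hZ₂.integrable_mul hD₂
  rw [hq0]
  obtain ⟨δ, hδ, hδU⟩ := hK.exists_cthickening_subset_open hU hKU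
  by_contra hne
  have hqn : ∀ᶠ s in 𝓝 (0 : ℝ × ℝ), |q s - q 0| < |q 0| := by
    have := Metric.tendsto_nhds.1 (hq.tendsto 0) (|q 0|) (abs_pos.2 hne)
    simpa [Real.dist_eq] using this
  obtain ⟨ε', hε', hε'q⟩ := Metric.eventually_nhds_iff.1 hqn
  obtain ⟨ε, hε, hε1, hε2⟩ : ∃ ε > 0, 3 * ε < ε' ∧ 3 * ε ≤ δ :=
    ⟨min ε' δ / 6, by positivity, by linarith [min_le_left ε' δ, lt_min hε' hδ],
      by linarith [min_le_right ε' δ, lt_min hε' hδ]⟩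
  let B : ContDiffBump ((0, -(2 * σ * ε)) : ℝ × ℝ) := ⟨ε / 2, ε, by positivity, by linarith⟩
  set k : ℝ × ℝ → ℝ := B.normed volume with hkdef
  have hk : ContDiff ℝ (⊤ : ℕ∞) k := B.contDiff_normed
  have hkc : HasCompactSupport k := B.hasCompactSupport_normed
  have hkt : ∀ s ∈ tsupport k, σ * s.2 < 0 ∧ ‖s‖ ≤ 3 * ε := by
    intro s hs
    rw [hkdef, B.tsupport_normed_eq, mem_closedBall, Prod.dist_eq, max_le_iff, Real.dist_eq,
      Real.dist_eq] at hs
    have h1 : |s.1| ≤ ε := by simpa using! hs.1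
    have h2 : |s.2 + 2 * σ * ε| ≤ ε := by simpa using! hs.2
    have h3 : |σ * s.2 + 2 * ε| ≤ ε := by
      have : σ * s.2 + 2 * ε = σ * (s.2 + 2 * σ * ε) := by linear_combination (-2 * ε) * hσ2
      rw [this, abs_mul, hσa, one_mul]; exact h2
    have h4 : |s.2| = |σ * s.2| := by rw [abs_mul, hσa, one_mul]
    obtain ⟨h5, h6⟩ := abs_le.1 h3
    refine ⟨by linarith, ?_⟩
    rw [Prod.norm_def, max_le_iff, Real.norm_eq_abs, Real.norm_eq_abs, h4]
    exact ⟨by linarith, abs_le.2 ⟨by linarith, by linarith⟩⟩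
  have hk1 : ∫ s, k s = 1 := B.integral_normed
  have hk0 : ∀ s, 0 ≤ k s := B.nonneg_normed
  have hHk : ∀ z ∈ H, ∀ t, z - t ∈ tsupport k → t ∈ H := by
    intro z hz t ht
    have h1 := (hkt _ ht).1
    simp only [hHdef, halfPlane, mem_ofPred_eq, Prod.snd_sub] at hz h1 ⊢
    nlinarith
  set φ : ℝ × ℝ → ℝ := fun z => ∫ t, H.indicator f t * k (z - t) with hφdef
  have hφs : ContDiff ℝ (⊤ : ℕ∞) φ :=
    hkc.contDiff_convolution_right (ContinuousLinearMap.mul ℝ ℝ) hfi.locallyIntegrable hk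
  have hφK : ∀ z ∉ cthickening (3 * ε) K, φ z = 0 := by
    intro z hz
    have : ∀ t, H.indicator f t * k (z - t) = 0 := by
      intro t
      by_cases htK : t ∈ K
      · have : k (z - t) = 0 := by
          by_contra h
          apply hz
          apply mem_cthickening_of_dist_le z t _ _ htK
          rw [dist_eq_norm]
          exact (hkt _ (subset_tsupport _ h)).2
        simp [this]
      · by_cases htH : t ∈ H <;> simp [htH, hfK t htK]
    simp [hφdef, this]
  have hφt : tsupport φ ⊆ cthickening (3 * ε) K := by
    apply closure_minimal _ isClosed_cthickening
    intro z hz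
    by_contra h
    exact hz (hφK z h)
  have hφU : tsupport φ ⊆ U := hφt.trans ((cthickening_mono hε2 K).trans hδU)
  have hφc : HasCompactSupport φ := HasCompactSupport.intro hK.cthickening hφK
  have hT0 := hT φ hφs hφc hφU
  have hT1 : ∫ z in H, (Y₁ z * dx φ z + Y₂ z * dy φ z) =
      ∫ z, (Z₁ z * (∫ t, D₁ t * k (z - t)) + Z₂ z * ∫ t, D₂ t * k (z - t)) := by
    rw [← integral_indicator hHm]
    congr 1; ext z
    by_cases hz : z ∈ H
    · by_cases hzU : z ∈ U
      · have e1 : dx φ z = ∫ t, D₁ t * k (z - t) :=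
          fderiv_mollify hHo hfd hfi hD₁i hk hkc (hHk z hz)
        have e2 : dy φ z = ∫ t, D₂ t * k (z - t) :=
          fderiv_mollify hHo hfd hfi hD₂i hk hkc (hHk z hz)
        simp [Z₁, Z₂, hz, hzU, e1, e2]
      · have : fderiv ℝ φ z = 0 :=
            fderiv_eq_zero_of_vanish_off (isClosed_tsupport φ)
              (fun z hz => image_eq_zero_of_notMem_tsupport hz) (fun h => hzU (hφU h))
        simp [Z₁, Z₂, hz, hzU, dx, dy, this]
    · simp [Z₁, Z₂, hz]
  have hbd : ∀ D : ℝ × ℝ → ℝ, Integrable D → Continuous (fun z => ∫ t, D t * k (z - t)) ∧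
      ∃ C, ∀ z, ‖∫ t, D t * k (z - t)‖ ≤ C := by
    intro D hD
    obtain ⟨C, hC⟩ := hkc.exists_bound_of_continuous hk.continuous
    refine ⟨hkc.continuous_convolution_right (ContinuousLinearMap.mul ℝ ℝ)
      hD.locallyIntegrable hk.continuous, (∫ t, ‖D t‖ * C), fun z => ?_⟩
    refine norm_integral_le_of_norm_le (hD.norm.mul_const C) (Eventually.of_forall fun t => ?_)
    rw [norm_mul]
    exact mul_le_mul_of_nonneg_left (hC _) (norm_nonneg _)
  have hi : ∀ Z D : ℝ × ℝ → ℝ, Integrable Z → Integrable D →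
      Integrable (fun z => Z z * ∫ t, D t * k (z - t)) := by
    intro Z D hZ hD
    obtain ⟨h1, C, hC⟩ := hbd D hD
    exact hZ.mul_bdd (c := C) h1.aestronglyMeasurable (Eventually.of_forall hC)
  rw [hT1, integral_add (hi _ _ hZ₁i hD₁i) (hi _ _ hZ₂i hD₂i),
    integral_mul_average hZ₁i hD₁i hk.continuous hkc,
    integral_mul_average hZ₂i hD₂i hk.continuous hkc, ← integral_add] at hT0
  rotate_left
  · exact (hk.continuous.mul (continuous_integral_mul_translate hZ₁ hD₁)).integrable_of_hasCompactSupport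
      hkc.mul_right
  · exact (hk.continuous.mul (continuous_integral_mul_translate hZ₂ hD₂)).integrable_of_hasCompactSupport
      hkc.mul_right
  have hT2 : ∫ s, k s * q s = 0 := by
    rw [← hT0]; congr 1; ext s; simp only [q]; ring
  have hki : Integrable k := hk.continuous.integrable_of_hasCompactSupport hkc
  have hkq : Integrable (fun s => k s * q s) :=
    (hk.continuous.mul hq).integrable_of_hasCompactSupport hkc.mul_right
  obtain ⟨m, hm, hmq⟩ : ∃ m < |q 0|, ∀ s ∈ tsupport k, |q s - q 0| ≤ m := by
    have hne' : (tsupport k).Nonempty := by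
      by_contra h
      rw [not_nonempty_iff_eq_empty, tsupport_eq_empty_iff] at h
      rw [h] at hk1
      simp at hk1
    obtain ⟨s₀, hs₀, hmax⟩ := hkc.isCompact.exists_isMaxOn hne'
      ((hq.sub continuous_const).abs.continuousOn (s := tsupport k) (f := fun s => |q s - q 0|))
    refine ⟨|q s₀ - q 0|, ?_, fun s hs => hmax hs⟩
    apply hε'q
    rw [dist_zero_right]
    exact (hkt s₀ hs₀).2.trans_lt hε1
  have h1 : ∫ s, k s * (q s - q 0) = - q 0 := by
    have : ∫ s, k s * (q s - q 0) = ∫ s, (k s * q s - k s * q 0) := by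
      congr 1; ext s; ring
    rw [this, integral_sub hkq (hki.mul_const _), hT2, integral_mul_const, hk1]
    ring
  have h2 : ‖∫ s, k s * (q s - q 0)‖ ≤ ∫ s, k s * m := by
    refine norm_integral_le_of_norm_le (hki.mul_const m) (Eventually.of_forall fun s => ?_)
    rw [norm_mul, Real.norm_of_nonneg (hk0 s)]
    by_cases hs : s ∈ tsupport k
    · exact mul_le_mul_of_nonneg_left (hmq s hs) (hk0 s)
    · simp [image_eq_zero_of_notMem_tsupport hs]
  rw [h1, integral_mul_const, hk1, norm_neg, Real.norm_eq_abs, one_mul] at h2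
  linarith

/-- `(Y₁, Y₂)` is measurable and controlled by the gradient of `u`. -/
def IsFlux (u Y₁ Y₂ : ℝ × ℝ → ℝ) : Prop :=
  Measurable Y₁ ∧ Measurable Y₂ ∧ ∃ C, 0 ≤ C ∧ ∀ z,
    |Y₁ z| ≤ C * (|dx u z| + |dy u z|) ∧ |Y₂ z| ≤ C * (|dx u z| + |dy u z|)

/-- The squared length of the gradient. -/
noncomputable def energy (u : ℝ × ℝ → ℝ) (z : ℝ × ℝ) : ℝ := dx u z ^ 2 + dy u z ^ 2

lemma measurable_energy (u : ℝ × ℝ → ℝ) : Measurable (energy u) :=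
  ((measurable_dx u).pow_const 2).add ((measurable_dy u).pow_const 2)

lemma energy_nonneg (u : ℝ × ℝ → ℝ) (z : ℝ × ℝ) : 0 ≤ energy u z := by
  unfold energy; positivity

/-- Near `z`, the gradient is square integrable and the weak equation holds (in `D`, without
boundary conditions on the test functions). -/
def GoodAt (D : Set (ℝ × ℝ)) (u Y₁ Y₂ : ℝ × ℝ → ℝ) (z : ℝ × ℝ) : Prop :=
  ∃ r > 0, IntegrableOn (energy u) (ball z r ∩ D) ∧ WeakZero D Y₁ Y₂ (ball z r)

lemma WeakZero.mono {D : Set (ℝ × ℝ)} {Y₁ Y₂ : ℝ × ℝ → ℝ} {U V : Set (ℝ × ℝ)}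
    (h : WeakZero D Y₁ Y₂ U) (hVU : V ⊆ U) : WeakZero D Y₁ Y₂ V :=
  fun φ h1 h2 h3 => h φ h1 h2 (h3.trans hVU)

lemma memLp_two_of_le_energy {u g : ℝ × ℝ → ℝ} (hg : Measurable g) {C : ℝ}
    (hC : ∀ z, g z ^ 2 ≤ C * energy u z) {S : Set (ℝ × ℝ)} (hS : IntegrableOn (energy u) S) :
    MemLp g 2 (volume.restrict S) := by
  rw [memLp_two_iff_integrable_sq hg.aestronglyMeasurable]
  refine (hS.const_mul C).mono' (hg.pow_const 2).aestronglyMeasurable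
    (Eventually.of_forall fun z => ?_)
  rw [Real.norm_of_nonneg (sq_nonneg _)]
  exact hC z

lemma memLp_dx {u : ℝ × ℝ → ℝ} {S : Set (ℝ × ℝ)} (hS : IntegrableOn (energy u) S) :
    MemLp (dx u) 2 (volume.restrict S) :=
  memLp_two_of_le_energy (measurable_dx u) (C := 1)
    (fun z => by unfold energy; nlinarith [sq_nonneg (dy u z)]) hS

lemma memLp_dy {u : ℝ × ℝ → ℝ} {S : Set (ℝ × ℝ)} (hS : IntegrableOn (energy u) S) :
    MemLp (dy u) 2 (volume.restrict S) :=
  memLp_two_of_le_energy (measurable_dy u) (C := 1)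
    (fun z => by unfold energy; nlinarith [sq_nonneg (dx u z)]) hS

lemma sq_le_energy {u : ℝ × ℝ → ℝ} {C y : ℝ} {z : ℝ × ℝ}
    (h : |y| ≤ C * (|dx u z| + |dy u z|)) : y ^ 2 ≤ 2 * C ^ 2 * energy u z := by
  have h1 : y ^ 2 ≤ (C * (|dx u z| + |dy u z|)) ^ 2 := by
    rw [← sq_abs y]; exact pow_le_pow_left₀ (abs_nonneg _) h 2
  have h2 : (|dx u z| + |dy u z|) ^ 2 ≤ 2 * energy u z := by
    unfold energy
    nlinarith [sq_nonneg (|dx u z| - |dy u z|), sq_abs (dx u z), sq_abs (dy u z)]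
  calc y ^ 2 ≤ C ^ 2 * (|dx u z| + |dy u z|) ^ 2 := by rw [← mul_pow]; exact h1
    _ ≤ C ^ 2 * (2 * energy u z) := mul_le_mul_of_nonneg_left h2 (sq_nonneg _)
    _ = _ := by ring

lemma IsFlux.memLp {u Y₁ Y₂ : ℝ × ℝ → ℝ} (hF : IsFlux u Y₁ Y₂) {S : Set (ℝ × ℝ)}
    (hS : IntegrableOn (energy u) S) :
    MemLp Y₁ 2 (volume.restrict S) ∧ MemLp Y₂ 2 (volume.restrict S) := by
  obtain ⟨h1, h2, C, -, hC⟩ := hF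
  exact ⟨memLp_two_of_le_energy h1 (fun z => sq_le_energy (hC z).1) hS,
    memLp_two_of_le_energy h2 (fun z => sq_le_energy (hC z).2) hS⟩

lemma isOpen_goodAt (D : Set (ℝ × ℝ)) (u Y₁ Y₂ : ℝ × ℝ → ℝ) :
    IsOpen {z | GoodAt D u Y₁ Y₂ z} := by
  rw [Metric.isOpen_iff]
  rintro z ⟨r, hr, h1, h2⟩
  refine ⟨r / 2, by positivity, fun w hw => ⟨r / 2, by positivity, ?_, ?_⟩⟩
  all_goals
    have hsub : ball w (r / 2) ⊆ ball z r :=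
      ball_subset_ball' (by rw [mem_ball] at hw; linarith)
  · exact h1.mono_set (inter_subset_inter_left _ hsub)
  · exact h2.mono hsub

lemma integrableOn_energy_of_good {D : Set (ℝ × ℝ)} {u Y₁ Y₂ : ℝ × ℝ → ℝ} {K : Set (ℝ × ℝ)}
    (hK : IsCompact K) (hg : ∀ z ∈ K, GoodAt D u Y₁ Y₂ z) :
    IntegrableOn (energy u) (K ∩ D) := by
  refine hK.induction_on (p := fun S => IntegrableOn (energy u) (S ∩ D)) (by simp) ?_ ?_ ?_
  · exact fun s t hst ht => ht.mono_set (inter_subset_inter_left _ hst)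
  · intro s t hs ht
    rw [union_inter_distrib_right]
    exact hs.union ht
  · intro z hz
    obtain ⟨r, hr, h1, -⟩ := hg z hz
    exact ⟨ball z r, mem_nhdsWithin_of_mem_nhds (ball_mem_nhds z hr), h1⟩

lemma integrableOn_mul_of_vanish {Y g : ℝ × ℝ → ℝ} {S D : Set (ℝ × ℝ)} (hS : MeasurableSet S)
    (hY : IntegrableOn Y (S ∩ D)) (hg : Continuous g) {C : ℝ} (hC : ∀ z, ‖g z‖ ≤ C)
    (h0 : ∀ z ∉ S, g z = 0) : IntegrableOn (fun z => Y z * g z) D := by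
  have h1 : IntegrableOn (fun z => Y z * g z) (S ∩ D) :=
    hY.mul_bdd (c := C) hg.aestronglyMeasurable (Eventually.of_forall hC)
  have h2 : IntegrableOn (fun z => Y z * g z) S (volume.restrict D) := by
    rw [IntegrableOn, Measure.restrict_restrict hS]; exact h1
  refine (integrableOn_iff_integrable_of_support_subset ?_).1 h2
  intro z hz
  by_contra h
  exact hz (by simp [h0 z h])

lemma continuous_dx {φ : ℝ × ℝ → ℝ} (hφ : ContDiff ℝ (⊤ : ℕ∞) φ) : Continuous (dx φ) :=
  (hφ.continuous_fderiv (by simp)).clm_apply continuous_const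

lemma continuous_dy {φ : ℝ × ℝ → ℝ} (hφ : ContDiff ℝ (⊤ : ℕ∞) φ) : Continuous (dy φ) :=
  (hφ.continuous_fderiv (by simp)).clm_apply continuous_const

lemma fderiv_eq_zero_of_notMem_tsupport {φ : ℝ × ℝ → ℝ} {z : ℝ × ℝ} (h : z ∉ tsupport φ) :
    fderiv ℝ φ z = 0 :=
  fderiv_eq_zero_of_vanish_off (isClosed_tsupport φ)
    (fun _ hz => image_eq_zero_of_notMem_tsupport hz) h

lemma exists_bound_of_smooth {φ : ℝ × ℝ → ℝ} (hφ : ContDiff ℝ (⊤ : ℕ∞) φ)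
    (hc : HasCompactSupport φ) : ∃ C, ∀ z, ‖dx φ z‖ ≤ C ∧ ‖dy φ z‖ ≤ C := by
  obtain ⟨C, hC⟩ := (hc.fderiv ℝ).exists_bound_of_continuous (hφ.continuous_fderiv (by simp))
  have e1 : ‖((1, 0) : ℝ × ℝ)‖ = 1 := by simp [Prod.norm_def]
  have e2 : ‖((0, 1) : ℝ × ℝ)‖ = 1 := by simp [Prod.norm_def]
  refine ⟨C, fun z => ⟨?_, ?_⟩⟩
  · have := (fderiv ℝ φ z).le_opNorm (1, 0)
    rw [e1, mul_one] at this
    exact this.trans (hC z)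
  · have := (fderiv ℝ φ z).le_opNorm (0, 1)
    rw [e2, mul_one] at this
    exact this.trans (hC z)

lemma integrableOn_weak {D S : Set (ℝ × ℝ)} {Y₁ Y₂ φ : ℝ × ℝ → ℝ} (hS : MeasurableSet S)
    (hY₁ : IntegrableOn Y₁ (S ∩ D)) (hY₂ : IntegrableOn Y₂ (S ∩ D))
    (hφ : ContDiff ℝ (⊤ : ℕ∞) φ) (hc : HasCompactSupport φ) (hS' : tsupport φ ⊆ S) :
    IntegrableOn (fun z => Y₁ z * dx φ z + Y₂ z * dy φ z) D := by
  obtain ⟨C, hC⟩ := exists_bound_of_smooth hφ hc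
  refine Integrable.add ?_ ?_
  · exact integrableOn_mul_of_vanish hS hY₁ (continuous_dx hφ) (fun z => (hC z).1)
      fun z hz => by simp [dx, fderiv_eq_zero_of_notMem_tsupport fun h => hz (hS' h)]
  · exact integrableOn_mul_of_vanish hS hY₂ (continuous_dy hφ) (fun z => (hC z).2)
      fun z hz => by simp [dy, fderiv_eq_zero_of_notMem_tsupport fun h => hz (hS' h)]

lemma IsFlux.integrableOn {u Y₁ Y₂ : ℝ × ℝ → ℝ} (hF : IsFlux u Y₁ Y₂) {S D : Set (ℝ × ℝ)}
    (hSf : volume S < ⊤) (hS : IntegrableOn (energy u) (S ∩ D)) :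
    IntegrableOn Y₁ (S ∩ D) ∧ IntegrableOn Y₂ (S ∩ D) := by
  have : IsFiniteMeasure (volume.restrict (S ∩ D)) :=
    ⟨by simpa using (measure_mono inter_subset_left).trans_lt hSf⟩
  exact ⟨(hF.memLp hS).1.integrable (by norm_num), (hF.memLp hS).2.integrable (by norm_num)⟩

open scoped Manifold ContDiff in
/-- The weak equation holds for test functions supported in the set of good points. -/
theorem weakZero_goodAt {D : Set (ℝ × ℝ)} {u Y₁ Y₂ : ℝ × ℝ → ℝ}
    (hF : IsFlux u Y₁ Y₂) : WeakZero D Y₁ Y₂ {z | GoodAt D u Y₁ Y₂ z} := by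
  intro φ hφ hc hsub
  have hsub' : ∀ z ∈ tsupport φ, ∃ r > 0, IntegrableOn (energy u) (ball z r ∩ D) ∧
      WeakZero D Y₁ Y₂ (ball z r) := fun z hz => hsub hz
  choose! r hr hr1 hr2 using hsub'
  obtain ⟨t, htK, htc⟩ := hc.isCompact.elim_nhds_subcover (fun z => ball z (r z))
    (fun z hz => ball_mem_nhds z (hr z hz))
  obtain ⟨f, hf⟩ := SmoothPartitionOfUnity.exists_isSubordinate 𝓘(ℝ, ℝ × ℝ)
    (isClosed_tsupport φ) (fun i : t => ball (i : ℝ × ℝ) (r i)) (fun i => isOpen_ball) (by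
      intro z hz
      obtain ⟨i, hi, hzi⟩ := mem_iUnion₂.1 (htc hz)
      exact mem_iUnion.2 ⟨⟨i, hi⟩, hzi⟩)
  have hfs : ∀ i, ContDiff ℝ (⊤ : ℕ∞) (f i) := fun i => (f i).contMDiff.contDiff
  have hs : ∀ i, ContDiff ℝ (⊤ : ℕ∞) (fun z => f i z * φ z) := fun i => (hfs i).mul hφ
  have hcs : ∀ i, HasCompactSupport (fun z => f i z * φ z) := fun i => hc.mul_left
  have hts : ∀ i : t, tsupport (fun z => f i z * φ z) ⊆ ball (i : ℝ × ℝ) (r i) :=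
    fun i => (tsupport_mul_subset_left).trans (hf i)
  have hsum : φ = fun z => ∑ i, f i z * φ z := by
    ext z
    rw [← Finset.sum_mul]
    by_cases hz : z ∈ tsupport φ
    · have := f.sum_eq_one hz
      rw [finsum_eq_sum_of_fintype] at this
      rw [this, one_mul]
    · rw [image_eq_zero_of_notMem_tsupport hz, mul_zero]
  have hd : ∀ z, fderiv ℝ φ z = ∑ i, fderiv ℝ (fun z => f i z * φ z) z := by
    intro z
    conv_lhs => rw [hsum]
    rw [fderiv_fun_sum]
    exact fun i _ => ((hs i).differentiable (by simp)) z
  have e : ∀ z, Y₁ z * dx φ z + Y₂ z * dy φ z =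
      ∑ i, (Y₁ z * dx (fun z => f i z * φ z) z + Y₂ z * dy (fun z => f i z * φ z) z) := by
    intro z
    simp only [dx, dy, hd z, sum_apply, Finset.mul_sum,
      Finset.sum_add_distrib]
  simp only [e]
  rw [integral_finsetSum]
  · exact Finset.sum_eq_zero fun i _ => hr2 i (htK i i.2) _ (hs i) (hcs i) (hts i)
  · intro i _
    have hi := hF.integrableOn (S := ball (i : ℝ × ℝ) (r i)) measure_ball_lt_top
      (hr1 i (htK i i.2))
    exact integrableOn_weak measurableSet_ball hi.1 hi.2 (hs i) (hcs i) (hts i)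

/-- The weak equation in a half-plane, tested with an everywhere differentiable function supported
in the set of good points. -/
theorem integral_eq_zero_of_good {σ b : ℝ} (hσ : σ = 1 ∨ σ = -1) {u Y₁ Y₂ : ℝ × ℝ → ℝ}
    (hF : IsFlux u Y₁ Y₂) {f : ℝ × ℝ → ℝ} {K : Set (ℝ × ℝ)} (hK : IsCompact K)
    (hg : ∀ z ∈ K, GoodAt (halfPlane σ b) u Y₁ Y₂ z) (hfK : ∀ z ∉ K, f z = 0)
    (hfd : ∀ z ∈ halfPlane σ b, DifferentiableAt ℝ f z)
    (hfb : ∃ C, ∀ z ∈ halfPlane σ b, |f z| ≤ C)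
    (hfx : MemLp (dx f) 2 (volume.restrict (halfPlane σ b)))
    (hfy : MemLp (dy f) 2 (volume.restrict (halfPlane σ b))) :
    ∫ z in halfPlane σ b, (Y₁ z * dx f z + Y₂ z * dy f z) = 0 := by
  obtain ⟨L, hL, hKL, hLg⟩ := exists_compact_between hK
    (isOpen_goodAt (halfPlane σ b) u Y₁ Y₂) hg
  have hi := (integrableOn_energy_of_good hL fun z hz => hLg hz).mono_set
    (s := halfPlane σ b ∩ interior L) (fun z hz => ⟨interior_subset hz.2, hz.1⟩)
  exact integral_eq_zero_of_weakZero hσ isOpen_interior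
    ((measure_mono interior_subset).trans_lt hL.measure_lt_top) (hF.memLp hi).1 (hF.memLp hi).2
    ((weakZero_goodAt hF).mono (interior_subset.trans hLg)) hK hKL hfK hfd hfb hfx hfy

lemma volume_closedBall_prod (w : ℝ × ℝ) {ρ : ℝ} (hρ : 0 ≤ ρ) :
    volume.real (closedBall w ρ) = 4 * ρ ^ 2 := by
  rw [← closedBall_prod_same, Measure.volume_eq_prod, measureReal_prod_prod,
    Real.volume_real_closedBall hρ, Real.volume_real_closedBall hρ]
  ring

/-- A family of cutoff functions adapted to balls, with scale-invariant gradient bounds. -/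
lemma exists_cutoff : ∃ B : ℝ, 0 ≤ B ∧ ∀ (w : ℝ × ℝ) (ρ : ℝ), 0 < ρ → ∃ ζ : ℝ × ℝ → ℝ,
    ContDiff ℝ (⊤ : ℕ∞) ζ ∧ (∀ z, 0 ≤ ζ z ∧ ζ z ≤ 1) ∧ (∀ z ∈ ball w (ρ / 2), ζ z = 1) ∧
    (∀ z ∉ closedBall w (3 * ρ / 4), ζ z = 0) ∧
    (∀ z, |dx ζ z| ≤ B / ρ ∧ |dy ζ z| ≤ B / ρ) := by
  let f : ContDiffBump (0 : ℝ × ℝ) := ⟨1 / 2, 3 / 4, by norm_num, by norm_num⟩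
  have hfs : ContDiff ℝ (⊤ : ℕ∞) f := f.contDiff
  obtain ⟨B, hB⟩ := exists_bound_of_smooth hfs f.hasCompactSupport
  have hB0 : 0 ≤ B := (norm_nonneg _).trans (hB 0).1
  refine ⟨B, hB0, fun w ρ hρ => ⟨fun z => f (ρ⁻¹ • (z - w)), ?_, ?_, ?_, ?_, ?_⟩⟩
  · exact hfs.comp (by fun_prop)
  · exact fun z => ⟨f.nonneg, f.le_one⟩
  · intro z hz
    refine f.one_of_mem_closedBall ?_
    rw [mem_closedBall, dist_zero_right, norm_smul, norm_inv, Real.norm_of_nonneg hρ.le,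
      ← dist_eq_norm, inv_mul_le_iff₀ hρ]
    rw [mem_ball] at hz
    show _ ≤ ρ * (1 / 2)
    linarith
  · intro z hz
    refine f.zero_of_le_dist ?_
    rw [dist_zero_right, norm_smul, norm_inv, Real.norm_of_nonneg hρ.le,
      ← dist_eq_norm, le_inv_mul_iff₀ hρ]
    rw [mem_closedBall, not_le] at hz
    show ρ * (3 / 4) ≤ _
    linarith
  · intro z
    have h1 : HasFDerivAt (fun z : ℝ × ℝ => ρ⁻¹ • (z - w))
        (ρ⁻¹ • ContinuousLinearMap.id ℝ (ℝ × ℝ)) z :=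
      ((hasFDerivAt_id z).sub_const w).const_smul ρ⁻¹
    have h2 := ((hfs.differentiable (by simp)) (ρ⁻¹ • (z - w))).hasFDerivAt.comp z h1
    have h3 : ∀ v, fderiv ℝ (fun z => f (ρ⁻¹ • (z - w))) z v =
        ρ⁻¹ * fderiv ℝ f (ρ⁻¹ • (z - w)) v := by
      intro v
      have := h2.fderiv
      simp only [Function.comp_def] at this
      rw [this]; simp
    have h4 := hB (ρ⁻¹ • (z - w))
    have hi : 0 < ρ⁻¹ := by positivity
    simp only [dx, dy, h3, abs_mul, abs_of_pos hi] at h4 ⊢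
    rw [div_eq_inv_mul]
    exact ⟨mul_le_mul_of_nonneg_left h4.1 hi.le, mul_le_mul_of_nonneg_left h4.2 hi.le⟩

lemma caccioppoli_pointwise {lam C ζ p q s t y₁ y₂ v m k : ℝ} (hlam : 0 < lam)
    (hC : 0 ≤ C) (hζ : 0 ≤ ζ) (hell : lam * (p ^ 2 + q ^ 2) ≤ y₁ * p + y₂ * q)
    (hy₁ : |y₁| ≤ C * (|p| + |q|)) (hy₂ : |y₂| ≤ C * (|p| + |q|)) (hv : |v| ≤ m)
    (hs : |s| ≤ k) (ht : |t| ≤ k) :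
    lam / 2 * (ζ ^ 2 * (p ^ 2 + q ^ 2)) ≤
      y₁ * (2 * ζ * s * v + ζ ^ 2 * p) + y₂ * (2 * ζ * t * v + ζ ^ 2 * q) +
        16 * C ^ 2 / lam * (m ^ 2 * k ^ 2) := by
  have hm : 0 ≤ m := (abs_nonneg _).trans hv
  have hk : 0 ≤ k := (abs_nonneg _).trans hs
  set P := |p| + |q| with hP
  have hP0 : 0 ≤ P := by positivity
  have hP2 : P ^ 2 ≤ 2 * (p ^ 2 + q ^ 2) := by
    nlinarith [sq_nonneg (|p| - |q|), sq_abs p, sq_abs q]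
  have h1 : |y₁ * s * v| ≤ C * P * k * m := by
    rw [abs_mul, abs_mul]; gcongr
  have h2 : |y₂ * t * v| ≤ C * P * k * m := by
    rw [abs_mul, abs_mul]; gcongr
  have h1' := neg_le_of_abs_le h1
  have h2' := neg_le_of_abs_le h2
  have h3 : 2 * ζ * (y₁ * s * v + y₂ * t * v) ≥ - (4 * C * k * m * (ζ * P)) := by
    nlinarith
  have h4 : ζ ^ 2 * (lam * (p ^ 2 + q ^ 2)) ≤ ζ ^ 2 * (y₁ * p + y₂ * q) :=
    mul_le_mul_of_nonneg_left hell (sq_nonneg _)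
  have h5 : 4 * C * k * m * (ζ * P) ≤ lam / 4 * (ζ * P) ^ 2 + 16 * C ^ 2 / lam * (m ^ 2 * k ^ 2) := by
    have : lam / 4 * (ζ * P) ^ 2 + 16 * C ^ 2 / lam * (m ^ 2 * k ^ 2) - 4 * C * k * m * (ζ * P)
        = 1 / (4 * lam) * (lam * (ζ * P) - 8 * C * k * m) ^ 2 := by
      field_simp; ring
    have h6 : 0 ≤ 1 / (4 * lam) * (lam * (ζ * P) - 8 * C * k * m) ^ 2 := by positivity
    linarith
  have h6 : lam / 4 * (ζ * P) ^ 2 ≤ lam / 2 * (ζ ^ 2 * (p ^ 2 + q ^ 2)) := by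
    have : ζ ^ 2 * P ^ 2 ≤ ζ ^ 2 * (2 * (p ^ 2 + q ^ 2)) :=
      mul_le_mul_of_nonneg_left hP2 (sq_nonneg _)
    rw [mul_pow]; nlinarith
  nlinarith

/-- Caccioppoli's inequality on balls all of whose points are good. -/
theorem caccioppoli {σ b : ℝ} (hσ : σ = 1 ∨ σ = -1) {u Y₁ Y₂ : ℝ × ℝ → ℝ}
    (hF : IsFlux u Y₁ Y₂) {lam : ℝ} (hlam : 0 < lam) :
    ∃ C, 0 ≤ C ∧ ∀ (w : ℝ × ℝ) (ρ m c : ℝ), 0 < ρ →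
      (∀ z ∈ closedBall w ρ, GoodAt (halfPlane σ b) u Y₁ Y₂ z) →
      (∀ z ∈ closedBall w ρ ∩ halfPlane σ b, DifferentiableAt ℝ u z ∧ |u z - c| ≤ m ∧
        lam * energy u z ≤ Y₁ z * dx u z + Y₂ z * dy u z) →
      ∫ z in ball w (ρ / 2) ∩ halfPlane σ b, energy u z ≤ C * m ^ 2 := by
  obtain ⟨B, hB0, hB⟩ := exists_cutoff
  obtain ⟨hY₁m, hY₂m, C, hC0, hC⟩ := id hF
  refine ⟨2 / lam * (16 * C ^ 2 / lam * B ^ 2 * 4), by positivity,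
    fun w ρ m c hρ hgood hu => ?_⟩
  obtain ⟨ζ, hζs, hζ01, hζ1, hζ0, hζd⟩ := hB w ρ hρ
  set H := halfPlane σ b with hH
  have hHm : MeasurableSet H := measurableSet_halfPlane σ b
  set S := closedBall w ρ ∩ H with hS
  have hSm : MeasurableSet S := measurableSet_closedBall.inter hHm
  have hSf : volume S < ⊤ := (measure_mono inter_subset_left).trans_lt
    (isCompact_closedBall w ρ).measure_lt_top
  have hES : IntegrableOn (energy u) S :=
    integrableOn_energy_of_good (isCompact_closedBall w ρ) hgood
  set f : ℝ × ℝ → ℝ := fun z => ζ z ^ 2 * (u z - c) with hf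
  have hf0 : ∀ z ∉ closedBall w (3 * ρ / 4), f z = 0 := fun z hz => by simp [hf, hζ0 z hz]
  have hKρ : closedBall w (3 * ρ / 4) ⊆ closedBall w ρ := closedBall_subset_closedBall (by linarith)
  have hfd0 : ∀ z ∉ closedBall w (3 * ρ / 4), fderiv ℝ f z = 0 :=
    fun z hz => fderiv_eq_zero_of_vanish_off isClosed_closedBall hf0 hz
  have hζd' : ∀ z, HasFDerivAt ζ (fderiv ℝ ζ z) z := fun z =>
    ((hζs.differentiable (by simp)) z).hasFDerivAt
  have hfd : ∀ z ∈ S, HasFDerivAt f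
      (ζ z ^ 2 • fderiv ℝ u z + (u z - c) • ((2 * ζ z) • fderiv ℝ ζ z)) z := by
    intro z hz
    have h1 := (hζd' z).pow 2
    have h2 := (hu z hz).1.hasFDerivAt.sub_const c
    simpa using! h1.mul h2
  have hfx : ∀ z ∈ S, dx f z = 2 * ζ z * dx ζ z * (u z - c) + ζ z ^ 2 * dx u z := by
    intro z hz
    simp only [dx, (hfd z hz).fderiv]
    simp; ring
  have hfy : ∀ z ∈ S, dy f z = 2 * ζ z * dy ζ z * (u z - c) + ζ z ^ 2 * dy u z := by
    intro z hz
    simp only [dy, (hfd z hz).fderiv]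
    simp; ring
  have hL2 : ∀ g : ℝ × ℝ → ℝ, Measurable g → (∀ z ∉ closedBall w (3 * ρ / 4), g z = 0) →
      (∀ z ∈ S, ∃ p q : ℝ, g z = 2 * ζ z * p * (u z - c) + ζ z ^ 2 * q ∧ |p| ≤ B / ρ ∧
        q ^ 2 ≤ energy u z) → MemLp g 2 (volume.restrict H) := by
    intro g hg hg0 hgS
    rw [memLp_two_iff_integrable_sq hg.aestronglyMeasurable]
    have h1 : IntegrableOn (fun z => g z ^ 2) S := by
      have hi : IntegrableOn (fun z => 8 * (B / ρ * m) ^ 2 + 2 * energy u z) S :=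
        (integrableOn_const hSf.ne).add (hES.const_mul 2)
      refine hi.mono' (hg.pow_const 2).aestronglyMeasurable ?_
      filter_upwards [ae_restrict_mem hSm] with z hz
      obtain ⟨p, q, e, hp, hq⟩ := hgS z hz
      rw [Real.norm_of_nonneg (sq_nonneg _), e]
      have h01 := hζ01 z
      have hm0 : 0 ≤ m := (abs_nonneg _).trans (hu z hz).2.1
      have h2 : |2 * ζ z * p * (u z - c)| ≤ 2 * 1 * (B / ρ) * m := by
        rw [abs_mul, abs_mul, abs_mul, abs_two, abs_of_nonneg h01.1]
        gcongr
        exacts [h01.2, (hu z hz).2.1]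
      have h3 : (2 * ζ z * p * (u z - c)) ^ 2 ≤ (2 * 1 * (B / ρ) * m) ^ 2 := by
        rw [← sq_abs]; exact pow_le_pow_left₀ (abs_nonneg _) h2 2
      have h4 : (ζ z ^ 2 * q) ^ 2 ≤ energy u z := by
        have : (ζ z ^ 2) ^ 2 ≤ 1 := pow_le_one₀ (by positivity) (pow_le_one₀ h01.1 h01.2)
        rw [mul_pow]
        calc _ ≤ 1 * q ^ 2 := by gcongr
          _ ≤ _ := by linarith
      nlinarith [sq_nonneg (2 * ζ z * p * (u z - c) - ζ z ^ 2 * q)]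
    have h2 : IntegrableOn (fun z => g z ^ 2) (closedBall w ρ) (volume.restrict H) := by
      rw [IntegrableOn, Measure.restrict_restrict measurableSet_closedBall]; exact h1
    refine (integrableOn_iff_integrable_of_support_subset ?_).1 h2
    intro z hz
    by_contra h
    exact hz (by simp [hg0 z fun h' => h (hKρ h')])
  have hLx : MemLp (dx f) 2 (volume.restrict H) := by
    refine hL2 _ (measurable_dx f) (fun z hz => by simp [dx, hfd0 z hz]) fun z hz =>
      ⟨dx ζ z, dx u z, hfx z hz, (hζd z).1, ?_⟩
    unfold energy; nlinarith [sq_nonneg (dy u z)]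
  have hLy : MemLp (dy f) 2 (volume.restrict H) := by
    refine hL2 _ (measurable_dy f) (fun z hz => by simp [dy, hfd0 z hz]) fun z hz =>
      ⟨dy ζ z, dy u z, hfy z hz, (hζd z).2, ?_⟩
    unfold energy; nlinarith [sq_nonneg (dx u z)]
  have hzero : ∫ z in H, (Y₁ z * dx f z + Y₂ z * dy f z) = 0 := by
    refine integral_eq_zero_of_good hσ hF (isCompact_closedBall w (3 * ρ / 4))
      (fun z hz => hgood z (hKρ hz)) hf0 (fun z hz => ?_) ⟨|m|, fun z hz => ?_⟩ hLx hLy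
    · by_cases h : z ∈ closedBall w ρ
      · exact (hfd z ⟨h, hz⟩).differentiableAt
      · have : f =ᶠ[𝓝 z] fun _ => 0 := by
          filter_upwards [isClosed_closedBall.isOpen_compl.mem_nhds h] with x hx
          exact hf0 x fun h' => hx (hKρ h')
        exact (differentiableAt_const (0 : ℝ)).congr_of_eventuallyEq this
    · by_cases h : z ∈ closedBall w ρ
      · rw [hf]
        simp only [abs_mul, abs_pow, abs_of_nonneg (hζ01 z).1]
        have : ζ z ^ 2 ≤ 1 := pow_le_one₀ (hζ01 z).1 (hζ01 z).2
        calc _ ≤ 1 * m := by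
              gcongr
              exact (hu z ⟨h, hz⟩).2.1
          _ ≤ _ := by rw [one_mul]; exact le_abs_self m
      · rw [hf0 z fun h' => h (hKρ h'), abs_zero]; positivity
  have hzeroS : ∫ z in S, (Y₁ z * dx f z + Y₂ z * dy f z) = 0 := by
    rw [← hzero]
    symm
    refine setIntegral_eq_of_subset_of_forall_sdiff_eq_zero hHm inter_subset_right ?_
    intro z hz
    have : z ∉ closedBall w (3 * ρ / 4) := fun h => hz.2 ⟨hKρ h, hz.1⟩
    simp [dx, dy, hfd0 z this]
  have hvan : IntegrableOn (fun z => Y₁ z * dx f z + Y₂ z * dy f z) S := by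
    have hle : volume.restrict S ≤ volume.restrict H := Measure.restrict_mono_set _ inter_subset_right
    exact ((hF.memLp hES).1.integrable_mul (hLx.mono_measure hle)).add
      ((hF.memLp hES).2.integrable_mul (hLy.mono_measure hle))
  have hζE : IntegrableOn (fun z => ζ z ^ 2 * energy u z) S := by
    refine hES.bdd_mul (c := 1) (hζs.continuous.pow 2).aestronglyMeasurable
      (Eventually.of_forall fun z => ?_)
    rw [Real.norm_of_nonneg (sq_nonneg _)]
    exact pow_le_one₀ (hζ01 z).1 (hζ01 z).2
  have hmain : ∫ z in S, lam / 2 * (ζ z ^ 2 * energy u z) ≤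
      ∫ z in S, ((Y₁ z * dx f z + Y₂ z * dy f z) + 16 * C ^ 2 / lam * (m ^ 2 * (B / ρ) ^ 2)) := by
    refine setIntegral_mono_on (hζE.const_mul _) (hvan.add (integrableOn_const hSf.ne)) hSm ?_
    intro z hz
    rw [hfx z hz, hfy z hz]
    exact caccioppoli_pointwise hlam hC0 (hζ01 z).1 (hu z hz).2.2 (hC z).1 (hC z).2
      (hu z hz).2.1 (hζd z).1 (hζd z).2
  rw [integral_const_mul, integral_add hvan (integrableOn_const hSf.ne), hzeroS, zero_add,
    setIntegral_const, smul_eq_mul] at hmain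
  have hvol : volume.real S ≤ 4 * ρ ^ 2 := by
    rw [← volume_closedBall_prod w hρ.le]
    exact measureReal_mono inter_subset_left (isCompact_closedBall w ρ).measure_lt_top.ne
  have hle : ∫ z in ball w (ρ / 2) ∩ H, energy u z ≤ ∫ z in S, ζ z ^ 2 * energy u z := by
    have hsub : ball w (ρ / 2) ∩ H ⊆ S :=
      inter_subset_inter_left _ (ball_subset_closedBall.trans
        (closedBall_subset_closedBall (by linarith)))
    calc _ = ∫ z in ball w (ρ / 2) ∩ H, ζ z ^ 2 * energy u z := by
          refine setIntegral_congr_fun (measurableSet_ball.inter hHm) fun z hz => ?_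
          simp [hζ1 z hz.1]
      _ ≤ _ := setIntegral_mono_set hζE
          (Eventually.of_forall fun z => mul_nonneg (sq_nonneg _) (energy_nonneg u z))
          hsub.eventuallyLE
  have h7 : volume.real S * (16 * C ^ 2 / lam * (m ^ 2 * (B / ρ) ^ 2)) ≤
      4 * ρ ^ 2 * (16 * C ^ 2 / lam * (m ^ 2 * (B / ρ) ^ 2)) := by gcongr
  have h8 : 4 * ρ ^ 2 * (16 * C ^ 2 / lam * (m ^ 2 * (B / ρ) ^ 2)) =
      16 * C ^ 2 / lam * B ^ 2 * 4 * m ^ 2 := by field_simp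
  calc _ ≤ ∫ z in S, ζ z ^ 2 * energy u z := hle
    _ = 2 / lam * (lam / 2 * ∫ z in S, ζ z ^ 2 * energy u z) := by field_simp
    _ ≤ 2 / lam * (16 * C ^ 2 / lam * B ^ 2 * 4 * m ^ 2) :=
        mul_le_mul_of_nonneg_left (by linarith) (by positivity)
    _ = _ := by ring

lemma isClosed_not_goodAt (D : Set (ℝ × ℝ)) (u Y₁ Y₂ : ℝ × ℝ → ℝ) :
    IsClosed {z | ¬ GoodAt D u Y₁ Y₂ z} := by
  rw [← isOpen_compl_iff]
  convert isOpen_goodAt D u Y₁ Y₂ using 1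
  ext z; simp

lemma energy_le_of_lip {u : ℝ × ℝ → ℝ} {z : ℝ × ℝ} {N : ℝ} (hN : 0 ≤ N)
    (hd : DifferentiableAt ℝ u z) (hl : ∀ᶠ w in 𝓝 z, |u w - u z| ≤ N * dist w z) :
    energy u z ≤ 2 * N ^ 2 := by
  have h1 : ‖fderiv ℝ u z‖ ≤ N := by
    refine hd.hasFDerivAt.le_of_lip' hN ?_
    filter_upwards [hl] with w hw
    simpa [dist_eq_norm] using hw
  have h2 : |dx u z| ≤ N := by
    have := (fderiv ℝ u z).le_opNorm (1, 0)
    simp only [Prod.norm_def, norm_one, norm_zero] at this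
    simp only [dx, ← Real.norm_eq_abs]
    refine this.trans ?_
    norm_num; exact h1
  have h3 : |dy u z| ≤ N := by
    have := (fderiv ℝ u z).le_opNorm (0, 1)
    simp only [Prod.norm_def, norm_one, norm_zero] at this
    simp only [dy, ← Real.norm_eq_abs]
    refine this.trans ?_
    norm_num; exact h1
  have h4 := pow_le_pow_left₀ (abs_nonneg _) h2 2
  have h5 := pow_le_pow_left₀ (abs_nonneg _) h3 2
  rw [sq_abs] at h4 h5
  unfold energy; linarith

/-- If `u` is uniformly Lipschitz at the bad points near a bad point `z₁`, then its gradient is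
square integrable near `z₁`. -/
theorem integrableOn_energy_of_lip {σ b : ℝ} (hσ : σ = 1 ∨ σ = -1) {u Y₁ Y₂ : ℝ × ℝ → ℝ}
    (hF : IsFlux u Y₁ Y₂) {lam : ℝ} (hlam : 0 < lam) {z₁ : ℝ × ℝ} {R N : ℝ} (hR : 0 < R)
    (hN : 0 ≤ N) (hz₁ : ¬ GoodAt (halfPlane σ b) u Y₁ Y₂ z₁)
    (hu : ∀ z ∈ ball z₁ (4 * R) ∩ halfPlane σ b, DifferentiableAt ℝ u z ∧
      lam * energy u z ≤ Y₁ z * dx u z + Y₂ z * dy u z)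
    (hlip : ∀ z ∈ ball z₁ (4 * R), ¬ GoodAt (halfPlane σ b) u Y₁ Y₂ z →
      ∀ w ∈ ball z₁ (4 * R), |u w - u z| ≤ N * dist w z) :
    IntegrableOn (energy u) (ball z₁ R ∩ halfPlane σ b) := by
  obtain ⟨C, hC0, hC⟩ := caccioppoli (b := b) hσ hF hlam
  set H := halfPlane σ b with hH
  have hHm : MeasurableSet H := measurableSet_halfPlane σ b
  set Bad : Set (ℝ × ℝ) := {z | ¬ GoodAt H u Y₁ Y₂ z} with hBad
  have hBc : IsClosed Bad := isClosed_not_goodAt H u Y₁ Y₂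
  have hz₁B : z₁ ∈ Bad := hz₁
  set d : ℝ × ℝ → ℝ := fun w => infDist w Bad with hd
  have hdc : Continuous d := continuous_infDist_pt Bad
  have hdz₁ : ∀ w, d w ≤ dist w z₁ := fun w => infDist_le_dist_of_mem hz₁B
  have hd1 : ∀ w z, d w ≤ d z + dist w z := fun w z => infDist_le_infDist_add_dist
  have hdpos : ∀ w, 0 < d w → w ∉ Bad := fun w hw h => by
    rw [hd] at hw; simp only [infDist_zero_of_mem h, lt_irrefl] at hw
  have hdpos' : ∀ w, w ∉ Bad → 0 < d w := fun w hw =>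
    (hBc.notMem_iff_infDist_pos ⟨z₁, hz₁B⟩).1 hw
  have hbad : IntegrableOn (energy u) (ball z₁ R ∩ H ∩ Bad) := by
    have hfin : volume (ball z₁ R ∩ H ∩ Bad) < ⊤ :=
      (measure_mono (inter_subset_left.trans inter_subset_left)).trans_lt measure_ball_lt_top
    refine (integrableOn_const (C := 2 * N ^ 2) hfin.ne).mono'
      (measurable_energy u).aestronglyMeasurable ?_
    filter_upwards [ae_restrict_mem ((measurableSet_ball.inter hHm).inter hBc.measurableSet)]
      with z hz
    rw [Real.norm_of_nonneg (energy_nonneg u z)]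
    have hz4 : z ∈ ball z₁ (4 * R) := ball_subset_ball (by linarith) hz.1.1
    refine energy_le_of_lip hN (hu z ⟨hz4, hz.1.2⟩).1 ?_
    filter_upwards [isOpen_ball.mem_nhds hz4] with w hw
    exact hlip z hz4 hz.2 w hw
  have hcac : ∀ w ∈ ball z₁ (2 * R), w ∉ Bad →
      ∫⁻ z in ball w (d w / 4) ∩ H, ENNReal.ofReal (energy u z) ≤
        ENNReal.ofReal (C * (N * (3 / 2)) ^ 2 * d w ^ 2) := by
    intro w hw hwB
    have hdw := hdpos' w hwB
    obtain ⟨z, hzB, hzw⟩ := hBc.exists_infDist_eq_dist ⟨z₁, hz₁B⟩ w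
    have hdR : d w < 2 * R := (hdz₁ w).trans_lt hw
    rw [mem_ball] at hw
    have hz4 : z ∈ ball z₁ (4 * R) := by
      rw [mem_ball]
      have := dist_triangle z w z₁
      rw [dist_comm z w, ← hzw] at this
      change _ ≤ d w + _ at this
      linarith
    have hgd : ∀ x ∈ closedBall w (d w / 2), GoodAt H u Y₁ Y₂ x := by
      intro x hx
      by_contra hxB
      have h1 : d w ≤ dist w x := infDist_le_dist_of_mem (show x ∈ Bad from hxB)
      rw [mem_closedBall, dist_comm] at hx
      linarith
    have key := hC w (d w / 2) (N * (3 / 2) * d w) (u z) (by positivity) hgd ?_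
    · have hi : IntegrableOn (energy u) (ball w (d w / 4) ∩ H) :=
        (integrableOn_energy_of_good (isCompact_closedBall w (d w / 2)) hgd).mono_set
          (inter_subset_inter_left _ (ball_subset_closedBall.trans
            (closedBall_subset_closedBall (by linarith))))
      rw [← ofReal_integral_eq_lintegral_ofReal hi
        (Eventually.of_forall fun z => energy_nonneg u z)]
      refine ENNReal.ofReal_le_ofReal ?_
      rw [show d w / 4 = d w / 2 / 2 by ring]
      refine key.trans (le_of_eq (by ring))
    · intro x hx
      have hxw := hx.1
      rw [mem_closedBall] at hxw
      have hx4 : x ∈ ball z₁ (4 * R) := by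
        rw [mem_ball]
        have := dist_triangle x w z₁
        linarith
      refine ⟨(hu x ⟨hx4, hx.2⟩).1, ?_, (hu x ⟨hx4, hx.2⟩).2⟩
      refine (hlip z hz4 hzB x hx4).trans ?_
      rw [mul_assoc]
      refine mul_le_mul_of_nonneg_left ?_ hN
      have := dist_triangle x w z
      rw [← hzw] at this
      change _ ≤ _ + d w at this
      linarith
  set V : Set (ℝ × ℝ) := ball z₁ (2 * R) ∩ Badᶜ with hV
  have hVo : IsOpen V := isOpen_ball.inter hBc.isOpen_compl
  set A : Set ((ℝ × ℝ) × (ℝ × ℝ)) :=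
    {p | p.1 ∈ H ∧ p.2 ∈ V ∧ dist p.1 p.2 < d p.2 / 4} with hA
  have hAm : MeasurableSet A := by
    refine (((isOpen_halfPlane σ b).preimage continuous_fst).inter
      ((hVo.preimage continuous_snd).inter (isOpen_lt (continuous_fst.dist continuous_snd)
        ((hdc.comp continuous_snd).div_const 4)))).measurableSet
  set k : (ℝ × ℝ) × (ℝ × ℝ) → ENNReal := A.indicator fun p =>
    ENNReal.ofReal (energy u p.1) * ENNReal.ofReal ((d p.2 ^ 2)⁻¹) with hk
  have hkm : Measurable k := by
    refine Measurable.indicator ?_ hAm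
    refine (((measurable_energy u).comp measurable_fst).ennreal_ofReal).mul ?_
    exact (((hdc.measurable.comp measurable_snd).pow_const 2).inv).ennreal_ofReal
  have hlow : ∀ z ∈ ball z₁ R ∩ H ∩ Badᶜ,
      ENNReal.ofReal (4 / 81) * ENNReal.ofReal (energy u z) ≤ ∫⁻ w, k (z, w) := by
    intro z hz
    have hdz := hdpos' z hz.2
    have hzR := hz.1.1
    rw [mem_ball] at hzR
    have hsub : ∀ w ∈ ball z (d z / 8), (z, w) ∈ A ∧ d w ≤ 9 / 8 * d z ∧ 0 < d w := by
      intro w hw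
      rw [mem_ball] at hw
      have h1 := hd1 w z
      have h2 := hd1 z w
      rw [dist_comm z w] at h2
      have h3 : 0 < d w := by linarith
      refine ⟨⟨hz.1.2, ⟨?_, hdpos w h3⟩, ?_⟩, by linarith, h3⟩
      · rw [mem_ball]
        have := dist_triangle w z z₁
        have := hdz₁ z
        linarith
      · show dist z w < d w / 4
        rw [dist_comm]; linarith
    calc ENNReal.ofReal (4 / 81) * ENNReal.ofReal (energy u z)
        = ∫⁻ _ in ball z (d z / 8),
            ENNReal.ofReal (energy u z) * ENNReal.ofReal (((9 / 8 * d z) ^ 2)⁻¹) := by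
          rw [setLIntegral_const, mul_assoc, mul_comm]
          congr 1
          have hv : volume (ball z (d z / 8)) = ENNReal.ofReal (4 * (d z / 8) ^ 2) := by
            rw [← ball_prod_same, Measure.volume_eq_prod, Measure.prod_prod, Real.volume_ball,
              Real.volume_ball, ← ENNReal.ofReal_mul (by positivity)]
            congr 1; ring
          rw [hv, ← ENNReal.ofReal_mul (by positivity)]
          congr 1; field_simp; norm_num
      _ ≤ ∫⁻ w in ball z (d z / 8), k (z, w) := by
          refine setLIntegral_mono (hkm.comp measurable_prodMk_left) fun w hw => ?_
          obtain ⟨h1, h2, h3⟩ := hsub w hw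
          rw [hk, indicator_of_mem h1]
          gcongr
      _ ≤ _ := setLIntegral_le_lintegral _ _
  have hup : ∀ w, ∫⁻ z, k (z, w) ≤
      (ball z₁ (2 * R)).indicator (fun _ => ENNReal.ofReal (C * (N * (3 / 2)) ^ 2)) w := by
    intro w
    by_cases hw : w ∈ V
    · rw [indicator_of_mem hw.1]
      have hdw := hdpos' w hw.2
      calc ∫⁻ z, k (z, w) = ∫⁻ z in ball w (d w / 4) ∩ H,
            ENNReal.ofReal (energy u z) * ENNReal.ofReal ((d w ^ 2)⁻¹) := by
            rw [← lintegral_indicator (measurableSet_ball.inter hHm)]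
            congr 1; ext z
            by_cases hz : z ∈ ball w (d w / 4) ∩ H
            · rw [indicator_of_mem hz, hk, indicator_of_mem (show (z, w) ∈ A from
                ⟨hz.2, hw, hz.1⟩)]
            · rw [indicator_of_notMem hz, hk, indicator_of_notMem]
              exact fun h => hz ⟨h.2.2, h.1⟩
        _ = (∫⁻ z in ball w (d w / 4) ∩ H, ENNReal.ofReal (energy u z)) *
              ENNReal.ofReal ((d w ^ 2)⁻¹) := by
            rw [lintegral_mul_const _ (measurable_energy u).ennreal_ofReal]
        _ ≤ ENNReal.ofReal (C * (N * (3 / 2)) ^ 2 * d w ^ 2) * ENNReal.ofReal ((d w ^ 2)⁻¹) := by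
            gcongr
            exact hcac w hw.1 hw.2
        _ = _ := by
            rw [← ENNReal.ofReal_mul (by positivity)]
            congr 1; field_simp
    · have : ∀ z, k (z, w) = 0 := fun z => by
        rw [hk, indicator_of_notMem]
        exact fun h => hw h.2.1
      simp [this]
  have hgm : MeasurableSet (ball z₁ R ∩ H ∩ Badᶜ) :=
    (measurableSet_ball.inter hHm).inter hBc.measurableSet.compl
  have hgood : IntegrableOn (energy u) (ball z₁ R ∩ H ∩ Badᶜ) := by
    refine ⟨(measurable_energy u).aestronglyMeasurable, ?_⟩
    rw [hasFiniteIntegral_iff_ofReal (Eventually.of_forall fun z => energy_nonneg u z)]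
    have h1 : ENNReal.ofReal (4 / 81) * ∫⁻ z in ball z₁ R ∩ H ∩ Badᶜ, ENNReal.ofReal (energy u z)
        < ⊤ := by
      calc _ = ∫⁻ z in ball z₁ R ∩ H ∩ Badᶜ,
            ENNReal.ofReal (4 / 81) * ENNReal.ofReal (energy u z) := by
            rw [lintegral_const_mul _ (measurable_energy u).ennreal_ofReal]
        _ ≤ ∫⁻ z in ball z₁ R ∩ H ∩ Badᶜ, ∫⁻ w, k (z, w) :=
            setLIntegral_mono hkm.lintegral_prod_right' hlow
        _ ≤ ∫⁻ z, ∫⁻ w, k (z, w) := setLIntegral_le_lintegral _ _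
        _ = ∫⁻ w, ∫⁻ z, k (z, w) := lintegral_lintegral_swap hkm.aemeasurable
        _ ≤ ∫⁻ w, (ball z₁ (2 * R)).indicator
              (fun _ => ENNReal.ofReal (C * (N * (3 / 2)) ^ 2)) w := lintegral_mono hup
        _ = ENNReal.ofReal (C * (N * (3 / 2)) ^ 2) * volume (ball z₁ (2 * R)) := by
            rw [lintegral_indicator measurableSet_ball, setLIntegral_const]
        _ < ⊤ := ENNReal.mul_lt_top ENNReal.ofReal_lt_top measure_ball_lt_top
    by_contra h
    rw [not_lt, top_le_iff] at h
    rw [h, ENNReal.mul_top (by simp)] at h1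
    exact lt_irrefl _ h1
  have := hbad.union hgood
  rwa [inter_union_compl] at this

/-- The closed half of the square with centre `p` and half-side `r` lying on the side `σ`. -/
def halfBox (σ : ℝ) (p : ℝ × ℝ) (r : ℝ) : Set (ℝ × ℝ) :=
  {z | |z.1 - p.1| ≤ r ∧ |z.2 - p.2| ≤ r ∧ 0 ≤ σ * (z.2 - p.2)}

lemma mem_closedBall_prod {z p : ℝ × ℝ} {r : ℝ} :
    z ∈ closedBall p r ↔ |z.1 - p.1| ≤ r ∧ |z.2 - p.2| ≤ r := by
  rw [mem_closedBall, Prod.dist_eq, max_le_iff, Real.dist_eq, Real.dist_eq]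

lemma halfBox_subset {σ : ℝ} {p : ℝ × ℝ} {r : ℝ} : halfBox σ p r ⊆ closedBall p r :=
  fun _ hz => mem_closedBall_prod.2 ⟨hz.1, hz.2.1⟩

lemma isClosed_halfBox (σ : ℝ) (p : ℝ × ℝ) (r : ℝ) : IsClosed (halfBox σ p r) := by
  have h1 : IsClosed {z : ℝ × ℝ | |z.1 - p.1| ≤ r} := isClosed_le (by fun_prop) (by fun_prop)
  have h2 : IsClosed {z : ℝ × ℝ | |z.2 - p.2| ≤ r} := isClosed_le (by fun_prop) (by fun_prop)
  have h3 : IsClosed {z : ℝ × ℝ | 0 ≤ σ * (z.2 - p.2)} :=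
    isClosed_le (by fun_prop) (by fun_prop)
  exact h1.inter (h2.inter h3)

lemma halfBox_one (p : ℝ × ℝ) (r : ℝ) :
    halfBox 1 p r = Icc (p.1 - r, p.2) (p.1 + r, p.2 + r) := by
  ext z
  simp only [halfBox, mem_ofPred_eq, mem_Icc, Prod.le_def, abs_le, one_mul]
  constructor
  · rintro ⟨⟨h1, h2⟩, ⟨h3, h4⟩, h5⟩
    exact ⟨⟨by linarith, by linarith⟩, ⟨by linarith, by linarith⟩⟩
  · rintro ⟨⟨h1, h2⟩, ⟨h3, h4⟩⟩
    exact ⟨⟨by linarith, by linarith⟩, ⟨by linarith, by linarith⟩, by linarith⟩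

lemma halfBox_neg_one (p : ℝ × ℝ) (r : ℝ) :
    halfBox (-1) p r = Icc (p.1 - r, p.2 - r) (p.1 + r, p.2) := by
  ext z
  simp only [halfBox, mem_ofPred_eq, mem_Icc, Prod.le_def, abs_le]
  constructor
  · rintro ⟨⟨h1, h2⟩, ⟨h3, h4⟩, h5⟩
    exact ⟨⟨by linarith, by linarith⟩, ⟨by linarith, by linarith⟩⟩
  · rintro ⟨⟨h1, h2⟩, ⟨h3, h4⟩⟩
    exact ⟨⟨by linarith, by linarith⟩, ⟨by linarith, by linarith⟩, by linarith⟩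

/-- The divergence theorem on a half-box for a field that vanishes away from its flat side. -/
lemma abs_integral_divergence_halfBox_le {σ : ℝ} (hσ : σ = 1 ∨ σ = -1) {p : ℝ × ℝ} {r k : ℝ}
    (hr : 0 < r) {f g : ℝ × ℝ → ℝ} {f' g' : ℝ × ℝ → ℝ × ℝ →L[ℝ] ℝ}
    (hf : ∀ z ∈ halfBox σ p r, HasFDerivAt f (f' z) z)
    (hg : ∀ z ∈ halfBox σ p r, HasFDerivAt g (g' z) z)
    (hf0 : ∀ z ∉ closedBall p (3 * r / 4), f z = 0)
    (hg0 : ∀ z ∉ closedBall p (3 * r / 4), g z = 0)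
    (hi : IntegrableOn (fun z => f' z (1, 0) + g' z (0, 1)) (halfBox σ p r))
    (hk : ∀ z ∈ halfBox σ p r, |g z| ≤ k) :
    |∫ z in halfBox σ p r, (f' z (1, 0) + g' z (0, 1))| ≤ k * (2 * r) := by
  have hfc : ContinuousOn f (halfBox σ p r) := fun z hz => (hf z hz).continuousAt.continuousWithinAt
  have hgc : ContinuousOn g (halfBox σ p r) := fun z hz => (hg z hz).continuousAt.continuousWithinAt
  have e1 : ∀ y, f (p.1 + r, y) = 0 := fun y => hf0 _ fun h => by
    have := (mem_closedBall_prod.1 h).1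
    rw [show (p.1 + r, y).1 - p.1 = r by simp, abs_of_pos hr] at this
    linarith
  have e2 : ∀ y, f (p.1 - r, y) = 0 := fun y => hf0 _ fun h => by
    have := (mem_closedBall_prod.1 h).1
    rw [show (p.1 - r, y).1 - p.1 = -r by simp, abs_neg, abs_of_pos hr] at this
    linarith
  have e3 : ∀ x, g (x, p.2 + r) = 0 := fun x => hg0 _ fun h => by
    have := (mem_closedBall_prod.1 h).2
    rw [show (x, p.2 + r).2 - p.2 = r by simp, abs_of_pos hr] at this
    linarith
  have e4 : ∀ x, g (x, p.2 - r) = 0 := fun x => hg0 _ fun h => by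
    have := (mem_closedBall_prod.1 h).2
    rw [show (x, p.2 - r).2 - p.2 = -r by simp, abs_neg, abs_of_pos hr] at this
    linarith
  have hbd : |∫ x in (p.1 - r)..(p.1 + r), g (x, p.2)| ≤ k * (2 * r) := by
    have := intervalIntegral.norm_integral_le_of_norm_le_const (a := p.1 - r) (b := p.1 + r)
      (f := fun x => g (x, p.2)) (C := k) (fun x hx => by
        rw [uIoc_of_le (by linarith)] at hx
        refine hk _ ⟨?_, ?_, ?_⟩
        · rw [abs_le]; exact ⟨by simp; linarith [hx.1], by simp; linarith [hx.2]⟩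
        · simp [hr.le]
        · simp)
    rw [show p.1 + r - (p.1 - r) = 2 * r by ring, abs_of_pos (by linarith : (0:ℝ) < 2 * r)] at this
    exact this
  rcases hσ with rfl | rfl
  · rw [halfBox_one] at *
    have key := integral_divergence_prod_Icc_of_hasFDerivAt_of_le f g f' g' (p.1 - r, p.2)
      (p.1 + r, p.2 + r) ⟨by simp; linarith, by simp; linarith⟩ hfc hgc
      (fun z hz => hf z ⟨⟨hz.1.1.le, hz.2.1.le⟩, ⟨hz.1.2.le, hz.2.2.le⟩⟩)
      (fun z hz => hg z ⟨⟨hz.1.1.le, hz.2.1.le⟩, ⟨hz.1.2.le, hz.2.2.le⟩⟩) hi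
    rw [key]
    simp only [e1, e2, e3, intervalIntegral.integral_zero, zero_sub, add_zero, sub_zero, abs_neg]
    exact hbd
  · rw [halfBox_neg_one] at *
    have key := integral_divergence_prod_Icc_of_hasFDerivAt_of_le f g f' g' (p.1 - r, p.2 - r)
      (p.1 + r, p.2) ⟨by simp; linarith, by simp; linarith⟩ hfc hgc
      (fun z hz => hf z ⟨⟨hz.1.1.le, hz.2.1.le⟩, ⟨hz.1.2.le, hz.2.2.le⟩⟩)
      (fun z hz => hg z ⟨⟨hz.1.1.le, hz.2.1.le⟩, ⟨hz.1.2.le, hz.2.2.le⟩⟩) hi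
    rw [key]
    simp only [e1, e2, e4, intervalIntegral.integral_zero, add_zero, sub_zero]
    exact hbd

/-- The weak form with constant coefficients, tested near the boundary against a bump `θ`, is
controlled by the distance of `u` to an affine function with vanishing conormal derivative. -/
lemma abs_integral_frozen_le {σ : ℝ} (hσ : σ = 1 ∨ σ = -1) {p : ℝ × ℝ} {r : ℝ} (hr : 0 < r)
    {u θ : ℝ × ℝ → ℝ} (hu : ∀ z ∈ halfBox σ p r, DifferentiableAt ℝ u z)
    (hux : IntegrableOn (dx u) (halfBox σ p r)) (huy : IntegrableOn (dy u) (halfBox σ p r))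
    (hθ : ContDiff ℝ (⊤ : ℕ∞) θ) (hθ0 : ∀ z ∉ closedBall p (3 * r / 4), θ z = 0)
    {k₁ k₂ : ℝ} (hk₁ : ∀ z, |dx θ z| ≤ k₁ ∧ |dy θ z| ≤ k₁)
    (hk₂ : ∀ z, (|dx (dx θ) z| ≤ k₂ ∧ |dy (dx θ) z| ≤ k₂) ∧
      |dx (dy θ) z| ≤ k₂ ∧ |dy (dy θ) z| ≤ k₂)
    {A B C D c : ℝ} (hA : |A| ≤ c) (hB : |B| ≤ c) (hC : |C| ≤ c) (hD : |D| ≤ c)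
    {u₀ l₁ l₂ m : ℝ} (hl : C * l₁ + D * l₂ = 0)
    (hm : ∀ z ∈ halfBox σ p r, |u z - u₀ - l₁ * (z.1 - p.1) - l₂ * (z.2 - p.2)| ≤ m) :
    |∫ z in halfBox σ p r, ((A * dx u z + B * dy u z) * dx θ z + (C * dx u z + D * dy u z) * dy θ z)|
      ≤ c * m * (16 * r ^ 2 * k₂ + 4 * r * k₁) := by
  have hp : p ∈ halfBox σ p r := by simp [halfBox, hr.le]
  have hm0 : 0 ≤ m := (abs_nonneg _).trans (hm p hp)
  have hc0 : 0 ≤ c := (abs_nonneg _).trans hA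
  have hk10 : 0 ≤ k₁ := (abs_nonneg _).trans (hk₁ p).1
  have hk20 : 0 ≤ k₂ := (abs_nonneg _).trans (hk₂ p).1.1
  set Q := halfBox σ p r with hQ
  have hQm : MeasurableSet Q := (isClosed_halfBox σ p r).measurableSet
  have hQv : volume Q < ⊤ := (measure_mono halfBox_subset).trans_lt
    (isCompact_closedBall p r).measure_lt_top
  have hQv' : volume.real Q ≤ 4 * r ^ 2 := by
    rw [← volume_closedBall_prod p hr.le]
    exact measureReal_mono halfBox_subset (isCompact_closedBall p r).measure_lt_top.ne
  set v : ℝ × ℝ → ℝ := fun z => u z - u₀ - l₁ * (z.1 - p.1) - l₂ * (z.2 - p.2) with hv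
  have hθd : ContDiff ℝ (⊤ : ℕ∞) (fderiv ℝ θ) := hθ.fderiv_right (by simp)
  have hθx : ContDiff ℝ (⊤ : ℕ∞) (dx θ) := hθd.clm_apply contDiff_const
  have hθy : ContDiff ℝ (⊤ : ℕ∞) (dy θ) := hθd.clm_apply contDiff_const
  have hd : ∀ {h : ℝ × ℝ → ℝ}, ContDiff ℝ (⊤ : ℕ∞) h → ∀ z, HasFDerivAt h (fderiv ℝ h z) z :=
    fun hh z => ((hh.differentiable (by simp)) z).hasFDerivAt
  have hθd0 : ∀ z ∉ closedBall p (3 * r / 4), fderiv ℝ θ z = 0 :=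
    fun z hz => fderiv_eq_zero_of_vanish_off isClosed_closedBall hθ0 hz
  let v' : ℝ × ℝ → ℝ × ℝ →L[ℝ] ℝ := fun z => fderiv ℝ u z -
    l₁ • ContinuousLinearMap.fst ℝ ℝ ℝ - l₂ • ContinuousLinearMap.snd ℝ ℝ ℝ
  have hvd : ∀ z ∈ Q, HasFDerivAt v (v' z) z := by
    intro z hz
    have h1 : HasFDerivAt (fun z : ℝ × ℝ => l₁ * (z.1 - p.1))
        (l₁ • ContinuousLinearMap.fst ℝ ℝ ℝ) z :=
      (hasFDerivAt_fst.sub_const p.1).const_mul l₁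
    have h2 : HasFDerivAt (fun z : ℝ × ℝ => l₂ * (z.2 - p.2))
        (l₂ • ContinuousLinearMap.snd ℝ ℝ ℝ) z :=
      (hasFDerivAt_snd.sub_const p.2).const_mul l₂
    exact (((hu z hz).hasFDerivAt.sub_const u₀).sub h1).sub h2
  set g₁ : ℝ × ℝ → ℝ := fun z => A * dx θ z + C * dy θ z with hg₁
  set g₂ : ℝ × ℝ → ℝ := fun z => B * dx θ z + D * dy θ z with hg₂
  let g₁' : ℝ × ℝ → ℝ × ℝ →L[ℝ] ℝ := fun z => A • fderiv ℝ (dx θ) z + C • fderiv ℝ (dy θ) z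
  let g₂' : ℝ × ℝ → ℝ × ℝ →L[ℝ] ℝ := fun z => B • fderiv ℝ (dx θ) z + D • fderiv ℝ (dy θ) z
  have hg₁d : ∀ z, HasFDerivAt g₁ (g₁' z) z := fun z =>
    ((hd hθx z).const_mul A).add ((hd hθy z).const_mul C)
  have hg₂d : ∀ z, HasFDerivAt g₂ (g₂' z) z := fun z =>
    ((hd hθx z).const_mul B).add ((hd hθy z).const_mul D)
  let L : ℝ := A * l₁ + B * l₂
  let f : ℝ × ℝ → ℝ := fun z => v z * g₁ z + L * θ z
  let g : ℝ × ℝ → ℝ := fun z => v z * g₂ z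
  let f' : ℝ × ℝ → ℝ × ℝ →L[ℝ] ℝ := fun z => v z • g₁' z + g₁ z • v' z + L • fderiv ℝ θ z
  let g' : ℝ × ℝ → ℝ × ℝ →L[ℝ] ℝ := fun z => v z • g₂' z + g₂ z • v' z
  set F : ℝ × ℝ → ℝ := fun z => (A * dx u z + B * dy u z) * dx θ z +
    (C * dx u z + D * dy u z) * dy θ z with hF
  set G : ℝ × ℝ → ℝ := fun z => v z * (A * dx (dx θ) z + C * dx (dy θ) z + B * dy (dx θ) z
    + D * dy (dy θ) z) with hG
  have hdiv : ∀ z, f' z (1, 0) + g' z (0, 1) = F z + G z := by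
    intro z
    simp only [f', g', g₁', g₂', v', hF, hG, hg₁, hg₂, L, dx, dy, add_apply, smul_apply,
      sub_apply, smul_eq_mul,
      ContinuousLinearMap.coe_fst', ContinuousLinearMap.coe_snd']
    linear_combination (-(fderiv ℝ θ z (0, 1))) * hl
  have hFi : IntegrableOn F Q := by
    have hb : ∀ (h : ℝ × ℝ → ℝ) (t : ℝ × ℝ → ℝ), Continuous t → (∀ z, |t z| ≤ k₁) →
        IntegrableOn h Q → IntegrableOn (fun z => h z * t z) Q := fun h t ht htb hh =>
      hh.mul_bdd (c := k₁) ht.aestronglyMeasurable (Eventually.of_forall htb)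
    exact (hb _ _ hθx.continuous (fun z => (hk₁ z).1)
      ((hux.const_mul A).add (huy.const_mul B))).add
      (hb _ _ hθy.continuous (fun z => (hk₁ z).2) ((hux.const_mul C).add (huy.const_mul D)))
  have hGb : ∀ z ∈ Q, ‖G z‖ ≤ m * (4 * (c * k₂)) := by
    intro z hz
    obtain ⟨⟨h1, h2⟩, h3, h4⟩ := hk₂ z
    rw [hG, norm_mul]
    refine mul_le_mul (hm z hz) ?_ (norm_nonneg _) hm0
    have a1 : |A * dx (dx θ) z| ≤ c * k₂ := by rw [abs_mul]; gcongr
    have a2 : |C * dx (dy θ) z| ≤ c * k₂ := by rw [abs_mul]; gcongr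
    have a3 : |B * dy (dx θ) z| ≤ c * k₂ := by rw [abs_mul]; gcongr
    have a4 : |D * dy (dy θ) z| ≤ c * k₂ := by rw [abs_mul]; gcongr
    rw [Real.norm_eq_abs]
    rw [abs_le] at *
    constructor <;> linarith [a1.1, a2.1, a3.1, a4.1, a1.2, a2.2, a3.2, a4.2]
  have hGc : ContinuousOn G Q := by
    refine ContinuousOn.mul (fun z hz => (hvd z hz).continuousAt.continuousWithinAt) ?_
    have h1 := continuous_dx hθx
    have h2 := continuous_dx hθy
    have h3 := continuous_dy hθx
    have h4 := continuous_dy hθy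
    exact (by fun_prop : Continuous fun z => A * dx (dx θ) z + C * dx (dy θ) z + B * dy (dx θ) z
      + D * dy (dy θ) z).continuousOn
  have hGi : IntegrableOn G Q := hGc.integrableOn_compact
    ((isCompact_closedBall p r).of_isClosed_subset (isClosed_halfBox σ p r) halfBox_subset)
  have key := abs_integral_divergence_halfBox_le (p := p) (r := r) (f := f) (g := g) (f' := f')
    (g' := g') (k := m * (2 * (c * k₁))) hσ hr ?_ ?_ ?_ ?_ ?_ ?_
  · simp only [hdiv] at key
    rw [integral_add hFi hGi] at key
    have h1 := norm_setIntegral_le_of_norm_le_const hQv hGb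
    have h2 : m * (4 * (c * k₂)) * volume.real Q ≤ m * (4 * (c * k₂)) * (4 * r ^ 2) := by gcongr
    rw [Real.norm_eq_abs] at h1
    have h4 : |∫ z in Q, F z| ≤ |(∫ z in Q, F z) + ∫ z in Q, G z| + |∫ z in Q, G z| := by
      have := abs_sub ((∫ z in Q, F z) + ∫ z in Q, G z) (∫ z in Q, G z)
      rwa [add_sub_cancel_right] at this
    calc _ ≤ _ := h4
      _ ≤ m * (2 * (c * k₁)) * (2 * r) + m * (4 * (c * k₂)) * (4 * r ^ 2) := by linarith
      _ = _ := by ring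
  · intro z hz
    exact ((hvd z hz).mul (hg₁d z)).add ((hd hθ z).const_mul L)
  · intro z hz
    exact (hvd z hz).mul (hg₂d z)
  · intro z hz
    simp [f, hg₁, dx, dy, hθd0 z hz, hθ0 z hz]
  · intro z hz
    simp [g, hg₂, dx, dy, hθd0 z hz]
  · simp only [hdiv]
    exact hFi.add hGi
  · intro z hz
    simp only [g, abs_mul]
    refine mul_le_mul (hm z hz) ?_ (abs_nonneg _) hm0
    have a1 : |B * dx θ z| ≤ c * k₁ := by rw [abs_mul]; gcongr; exact (hk₁ z).1
    have a2 : |D * dy θ z| ≤ c * k₁ := by rw [abs_mul]; gcongr; exact (hk₁ z).2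
    have := abs_add_le (B * dx θ z) (D * dy θ z)
    rw [hg₂]; linarith

lemma contDiff_dx {f : ℝ × ℝ → ℝ} (hf : ContDiff ℝ (⊤ : ℕ∞) f) : ContDiff ℝ (⊤ : ℕ∞) (dx f) :=
  (hf.fderiv_right (m := (⊤ : ℕ∞)) (by simp)).clm_apply contDiff_const

lemma contDiff_dy {f : ℝ × ℝ → ℝ} (hf : ContDiff ℝ (⊤ : ℕ∞) f) : ContDiff ℝ (⊤ : ℕ∞) (dy f) :=
  (hf.fderiv_right (m := (⊤ : ℕ∞)) (by simp)).clm_apply contDiff_const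

lemma hasCompactSupport_dx {f : ℝ × ℝ → ℝ} (hf : HasCompactSupport f) :
    HasCompactSupport (dx f) :=
  (hf.fderiv ℝ).comp_left (g := fun (L : ℝ × ℝ →L[ℝ] ℝ) => L (1, 0)) (by simp)

lemma hasCompactSupport_dy {f : ℝ × ℝ → ℝ} (hf : HasCompactSupport f) :
    HasCompactSupport (dy f) :=
  (hf.fderiv ℝ).comp_left (g := fun (L : ℝ × ℝ →L[ℝ] ℝ) => L (0, 1)) (by simp)

lemma fderiv_scale {f : ℝ × ℝ → ℝ} (hf : Differentiable ℝ f) (k ρ : ℝ) (w z v : ℝ × ℝ) :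
    fderiv ℝ (fun z => k * f (ρ • (z - w))) z v = k * ρ * fderiv ℝ f (ρ • (z - w)) v := by
  have h1 : HasFDerivAt (fun z : ℝ × ℝ => ρ • (z - w))
      (ρ • ContinuousLinearMap.id ℝ (ℝ × ℝ)) z :=
    ((hasFDerivAt_id z).sub_const w).const_smul ρ
  have h2 := ((hf (ρ • (z - w))).hasFDerivAt.comp z h1).const_mul k
  have := h2.fderiv
  simp only [Function.comp_def] at this
  rw [this]; simp; ring

lemma dx_scale {f : ℝ × ℝ → ℝ} (hf : Differentiable ℝ f) (k ρ : ℝ) (w : ℝ × ℝ) :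
    dx (fun z => k * f (ρ • (z - w))) = fun z => k * ρ * dx f (ρ • (z - w)) :=
  funext fun z => fderiv_scale hf k ρ w z _

lemma dy_scale {f : ℝ × ℝ → ℝ} (hf : Differentiable ℝ f) (k ρ : ℝ) (w : ℝ × ℝ) :
    dy (fun z => k * f (ρ • (z - w))) = fun z => k * ρ * dy f (ρ • (z - w)) :=
  funext fun z => fderiv_scale hf k ρ w z _

lemma contDiff_integral_translate {a : ℝ → ℝ} (ha : ContDiff ℝ (⊤ : ℕ∞) a)
    (hac : HasCompactSupport a) {S : Set ℝ} (hS : MeasurableSet S) (hSf : volume S < ⊤) :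
    ContDiff ℝ (⊤ : ℕ∞) (fun x => ∫ s in S, a (x - s)) ∧
      ∀ x, HasDerivAt (fun x => ∫ s in S, a (x - s)) (∫ s in S, deriv a (x - s)) x := by
  have hl : LocallyIntegrable (S.indicator fun _ => (1 : ℝ)) volume :=
    ((integrable_indicator_iff hS).2 (integrableOn_const hSf.ne)).locallyIntegrable
  have e : ∀ a : ℝ → ℝ, (fun x => ∫ s in S, a (x - s)) =
      convolution (S.indicator fun _ => (1 : ℝ)) a (ContinuousLinearMap.mul ℝ ℝ) volume := by
    intro a
    ext x
    rw [convolution, ← integral_indicator hS]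
    congr 1; ext s
    by_cases hs : s ∈ S <;> simp [hs]
  constructor
  · rw [e]
    exact hac.contDiff_convolution_right _ hl ha
  · intro x
    have h := hac.hasDerivAt_convolution_right (ContinuousLinearMap.mul ℝ ℝ) hl
      (ha.of_le (by exact_mod_cast le_top)) x
    rw [e]
    have := congrFun (e (deriv a)) x
    rw [this]; exact h

lemma hasFDerivAt_mul_prod {f g : ℝ → ℝ} {f' g' : ℝ} {z : ℝ × ℝ} (hf : HasDerivAt f f' z.1)
    (hg : HasDerivAt g g' z.2) :
    dx (fun z => f z.1 * g z.2) z = f' * g z.2 ∧ dy (fun z => f z.1 * g z.2) z = f z.1 * g' := by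
  have h1 : HasFDerivAt (fun z : ℝ × ℝ => f z.1) (f' • ContinuousLinearMap.fst ℝ ℝ ℝ) z :=
    hf.comp_hasFDerivAt z hasFDerivAt_fst
  have h2 : HasFDerivAt (fun z : ℝ × ℝ => g z.2) (g' • ContinuousLinearMap.snd ℝ ℝ ℝ) z :=
    hg.comp_hasFDerivAt z hasFDerivAt_snd
  have h3 := (h1.mul h2).fderiv
  have h4 : fderiv ℝ (fun z : ℝ × ℝ => f z.1 * g z.2) z = _ := h3
  simp only [dx, dy, h4]
  simp [mul_comm]

lemma exists_bump_profile : ∃ α β : ℝ → ℝ, ContDiff ℝ (⊤ : ℕ∞) α ∧ ContDiff ℝ (⊤ : ℕ∞) β ∧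
    (∀ t, 0 ≤ α t) ∧ (∀ t, 3 / 4 < |t| → α t = 0) ∧ ∫ t, α t = 1 ∧
    (∀ t, 0 ≤ β t ∧ β t ≤ 1) ∧ (∀ t, 3 / 4 < |t| → β t = 0) ∧ (∀ t, |t| ≤ 1 / 4 → β t = 1) := by
  let f : ContDiffBump (0 : ℝ) := ⟨1 / 4, 3 / 4, by norm_num, by norm_num⟩
  refine ⟨f.normed volume, f, f.contDiff_normed, f.contDiff, fun t => f.nonneg_normed t, ?_,
    f.integral_normed, fun t => ⟨f.nonneg, f.le_one⟩, ?_, ?_⟩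
  · intro t ht
    refine image_eq_zero_of_notMem_tsupport ?_
    rw [f.tsupport_normed_eq, mem_closedBall, dist_zero_right, Real.norm_eq_abs]
    exact not_le.2 ht
  · intro t ht
    refine f.zero_of_le_dist ?_
    rw [dist_zero_right, Real.norm_eq_abs]
    exact ht.le
  · intro t ht
    refine f.one_of_mem_closedBall ?_
    rw [mem_closedBall, dist_zero_right, Real.norm_eq_abs]
    exact ht

/-- Cutoff functions adapted to a set `S` of the line `{y = b}` at scale `r`, written as an average
of bumps of size `r` centred at the points of `S`. -/
theorem exists_boundary_cutoff : ∃ k, 0 ≤ k ∧ ∀ (b r : ℝ), 0 < r → ∀ S : Set ℝ,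
    MeasurableSet S → volume S < ⊤ → ∃ (η : ℝ × ℝ → ℝ) (θ : ℝ → ℝ × ℝ → ℝ),
      ContDiff ℝ (⊤ : ℕ∞) η ∧ (∀ z, |η z| ≤ 1) ∧ (∀ z, r < |z.2 - b| → η z = 0) ∧
      (∀ z, |z.2 - b| ≤ r / 4 → Icc (z.1 - r) (z.1 + r) ⊆ S → η z = 1) ∧
      (∀ z, dx η z = ∫ s in S, dx (θ s) z) ∧ (∀ z, dy η z = ∫ s in S, dy (θ s) z) ∧
      (∀ s, ContDiff ℝ (⊤ : ℕ∞) (θ s)) ∧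
      (∀ s, ∀ z ∉ closedBall (s, b) (3 * r / 4), θ s z = 0) ∧
      (∀ s z, |dx (θ s) z| ≤ k / r ^ 2 ∧ |dy (θ s) z| ≤ k / r ^ 2) ∧
      (∀ s z, (|dx (dx (θ s)) z| ≤ k / r ^ 3 ∧ |dy (dx (θ s)) z| ≤ k / r ^ 3) ∧
        |dx (dy (θ s)) z| ≤ k / r ^ 3 ∧ |dy (dy (θ s)) z| ≤ k / r ^ 3) ∧
      Continuous (fun q : (ℝ × ℝ) × ℝ => dx (θ q.2) q.1) ∧
      Continuous (fun q : (ℝ × ℝ) × ℝ => dy (θ q.2) q.1) := by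
  obtain ⟨α, β, hα, hβ, hα0, hαs, hα1, hβ01, hβs, hβ1⟩ := exists_bump_profile
  have hcα : HasCompactSupport α := HasCompactSupport.intro (isCompact_Icc (a := -(3 / 4 : ℝ))
    (b := 3 / 4)) fun t ht => hαs t (not_le.1 fun h => ht (abs_le.1 h))
  set Θ : ℝ × ℝ → ℝ := fun z => α z.1 * β z.2 with hΘ
  have hΘs : ContDiff ℝ (⊤ : ℕ∞) Θ := (hα.comp contDiff_fst).mul (hβ.comp contDiff_snd)
  have hΘ0 : ∀ z ∉ closedBall (0 : ℝ × ℝ) (3 / 4), Θ z = 0 := by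
    intro z hz
    rw [mem_closedBall_prod, not_and_or] at hz
    simp only [Prod.fst_zero, Prod.snd_zero, sub_zero, not_le] at hz
    rcases hz with h | h
    · simp [hΘ, hαs _ h]
    · simp [hΘ, hβs _ h]
  have hΘc : HasCompactSupport Θ := HasCompactSupport.intro (isCompact_closedBall 0 (3 / 4)) hΘ0
  have hΘd := hΘs.differentiable (by simp)
  have hxs := contDiff_dx hΘs
  have hys := contDiff_dy hΘs
  obtain ⟨k₁, hk₁⟩ := exists_bound_of_smooth hΘs hΘc
  obtain ⟨k₂, hk₂⟩ := exists_bound_of_smooth hxs (hasCompactSupport_dx hΘc)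
  obtain ⟨k₃, hk₃⟩ := exists_bound_of_smooth hys (hasCompactSupport_dy hΘc)
  have p1 : 0 ≤ k₁ := (norm_nonneg _).trans (hk₁ 0).1
  have p2 : 0 ≤ k₂ := (norm_nonneg _).trans (hk₂ 0).1
  have p3 : 0 ≤ k₃ := (norm_nonneg _).trans (hk₃ 0).1
  refine ⟨k₁ + k₂ + k₃, by positivity, fun b r hr S hS hSf => ?_⟩
  set a : ℝ → ℝ := fun x => r⁻¹ * α (r⁻¹ * x) with ha
  have has : ContDiff ℝ (⊤ : ℕ∞) a := contDiff_const.mul (hα.comp (contDiff_const.mul contDiff_id))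
  have ha0 : ∀ t, r < |t| → a t = 0 := fun t ht => by
    rw [ha]; simp only
    rw [hαs, mul_zero]
    rw [abs_mul, abs_inv, abs_of_pos hr, lt_inv_mul_iff₀ hr]
    linarith
  have hac : HasCompactSupport a := HasCompactSupport.intro (isCompact_Icc (a := -r)
    (b := r)) fun t ht => ha0 t (not_le.1 fun h => ht (abs_le.1 h))
  have hann : ∀ t, 0 ≤ a t := fun t => mul_nonneg (by positivity) (hα0 _)
  have ha1 : ∫ t, a t = 1 := by
    rw [ha, integral_const_mul, Measure.integral_comp_inv_mul_left, hα1, abs_of_pos hr]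
    simp [hr.ne']
  have hai : ∀ x, Integrable (fun s => a (x - s)) := fun x =>
    (has.continuous.integrable_of_hasCompactSupport hac).comp_sub_left x
  have ha1' : ∀ x, ∫ s, a (x - s) = 1 := fun x => by
    rw [integral_sub_left_eq_self a volume x, ha1]
  set B : ℝ → ℝ := fun y => β (r⁻¹ * (y - b)) with hB
  have hBs : ContDiff ℝ (⊤ : ℕ∞) B :=
    hβ.comp (contDiff_const.mul (contDiff_id.sub contDiff_const))
  obtain ⟨hA1, hA2⟩ := contDiff_integral_translate has hac hS hSf
  have hBd : ∀ y, HasDerivAt B (deriv B y) y := fun y =>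
    ((hBs.differentiable (by simp)) y).hasDerivAt
  have had : ∀ s z, HasDerivAt (fun x => a (x - s)) (deriv a (z - s)) z := fun s z =>
    (((has.differentiable (by simp)) (z - s)).hasDerivAt).comp_sub_const z s
  set θ : ℝ → ℝ × ℝ → ℝ := fun s z => a (z.1 - s) * B z.2 with hθ
  have eθ : ∀ s, θ s = fun z => r⁻¹ * Θ (r⁻¹ • (z - (s, b))) := by
    intro s; ext z; simp [hθ, hΘ, ha, hB, mul_assoc]
  have eθx : ∀ s, dx (θ s) = fun z => r⁻¹ * r⁻¹ * dx Θ (r⁻¹ • (z - (s, b))) := fun s => by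
    rw [eθ, dx_scale hΘd]
  have eθy : ∀ s, dy (θ s) = fun z => r⁻¹ * r⁻¹ * dy Θ (r⁻¹ • (z - (s, b))) := fun s => by
    rw [eθ, dy_scale hΘd]
  have hr1 : r⁻¹ * r⁻¹ = 1 / r ^ 2 := by field_simp
  have hr2 : r⁻¹ * r⁻¹ * r⁻¹ = 1 / r ^ 3 := by field_simp
  have bd1 : ∀ x, |x| ≤ k₁ → |r⁻¹ * r⁻¹ * x| ≤ (k₁ + k₂ + k₃) / r ^ 2 := fun x hx => by
    rw [hr1, abs_mul, abs_of_pos (by positivity), one_div_mul_eq_div]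
    gcongr; linarith
  have bd2 : ∀ x, |x| ≤ k₂ → |r⁻¹ * r⁻¹ * r⁻¹ * x| ≤ (k₁ + k₂ + k₃) / r ^ 3 := fun x hx => by
    rw [hr2, abs_mul, abs_of_pos (by positivity), one_div_mul_eq_div]
    gcongr; linarith
  have bd3 : ∀ x, |x| ≤ k₃ → |r⁻¹ * r⁻¹ * r⁻¹ * x| ≤ (k₁ + k₂ + k₃) / r ^ 3 := fun x hx => by
    rw [hr2, abs_mul, abs_of_pos (by positivity), one_div_mul_eq_div]
    gcongr; linarith
  have hvan : ∀ x, 0 ≤ ∫ s in S, a (x - s) := fun x => integral_nonneg fun s => hann _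
  refine ⟨fun z => (∫ s in S, a (z.1 - s)) * B z.2, θ,
    (hA1.comp contDiff_fst).mul (hBs.comp contDiff_snd), ?_, ?_, ?_, ?_, ?_, ?_, ?_, ?_, ?_, ?_, ?_⟩
  · intro z
    have h1 : ∫ s in S, a (z.1 - s) ≤ 1 := by
      rw [← ha1' z.1]
      exact setIntegral_le_integral (hai _) (Eventually.of_forall fun s => hann _)
    rw [abs_mul, abs_of_nonneg (hvan _), abs_of_nonneg (hβ01 _).1]
    exact mul_le_one₀ h1 (hβ01 _).1 (hβ01 _).2
  · intro z hz
    have : B z.2 = 0 := hβs _ (by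
      rw [abs_mul, abs_inv, abs_of_pos hr, lt_inv_mul_iff₀ hr]; linarith)
    simp [this]
  · intro z hz hzS
    have h1 : B z.2 = 1 := hβ1 _ (by
      rw [abs_mul, abs_inv, abs_of_pos hr, inv_mul_le_iff₀ hr]; linarith)
    have h2 : ∫ s in S, a (z.1 - s) = ∫ s, a (z.1 - s) := by
      refine setIntegral_eq_integral_of_forall_compl_eq_zero fun s hs => ha0 _ ?_
      by_contra h
      rw [not_lt, abs_le] at h
      exact hs (hzS ⟨by linarith, by linarith⟩)
    simp only [h1, h2, ha1', mul_one]
  · intro z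
    rw [(hasFDerivAt_mul_prod (hA2 z.1) (hBd z.2)).1, ← integral_mul_const]
    congr 1; ext s
    rw [hθ, (hasFDerivAt_mul_prod (had s z.1) (hBd z.2)).1]
  · intro z
    rw [(hasFDerivAt_mul_prod (hA2 z.1) (hBd z.2)).2, ← integral_mul_const]
    congr 1; ext s
    rw [hθ, (hasFDerivAt_mul_prod (had s z.1) (hBd z.2)).2]
  · intro s
    exact (has.comp (contDiff_fst.sub contDiff_const)).mul (hBs.comp contDiff_snd)
  · intro s z hz
    rw [eθ]
    simp only
    rw [hΘ0, mul_zero]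
    intro h
    apply hz
    rw [mem_closedBall, dist_zero_right, norm_smul, norm_inv, Real.norm_of_nonneg hr.le,
      ← dist_eq_norm, inv_mul_le_iff₀ hr] at h
    rw [mem_closedBall]; linarith
  · intro s z
    rw [eθx, eθy]
    exact ⟨bd1 _ (hk₁ _).1, bd1 _ (hk₁ _).2⟩
  · intro s z
    rw [eθx, eθy, dx_scale (hxs.differentiable (by simp)), dy_scale (hxs.differentiable (by simp)),
      dx_scale (hys.differentiable (by simp)), dy_scale (hys.differentiable (by simp))]
    exact ⟨⟨bd2 _ (hk₂ _).1, bd2 _ (hk₂ _).2⟩, bd3 _ (hk₃ _).1, bd3 _ (hk₃ _).2⟩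
  · simp only [eθx]
    have := hxs.continuous
    fun_prop
  · simp only [eθy]
    have := hys.continuous
    fun_prop

lemma volume_horizontal_line (b : ℝ) : volume {z : ℝ × ℝ | z.2 = b} = 0 := by
  have : {z : ℝ × ℝ | z.2 = b} = univ ×ˢ {b} := by ext z; simp
  rw [this, Measure.volume_eq_prod, Measure.prod_prod]; simp

lemma halfBox_ae_eq {σ : ℝ} (hσ : σ = 1 ∨ σ = -1) (s b r : ℝ) :
    (halfBox σ (s, b) r : Set (ℝ × ℝ)) =ᵐ[volume]
      (closedBall (s, b) r ∩ halfPlane σ b : Set (ℝ × ℝ)) := by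
  have h : ∀ᵐ z : ℝ × ℝ, z.2 ≠ b := by
    rw [ae_iff]; simpa using volume_horizontal_line b
  filter_upwards [h] with z hz
  refine propext ?_
  change z ∈ halfBox σ (s, b) r ↔ z ∈ closedBall (s, b) r ∩ halfPlane σ b
  rw [mem_inter_iff, mem_closedBall_prod]
  simp only [halfBox, halfPlane, mem_ofPred_eq]
  have h1 : σ * (z.2 - b) ≠ 0 :=
    mul_ne_zero (by rcases hσ with rfl | rfl <;> norm_num) (sub_ne_zero.2 hz)
  constructor
  · rintro ⟨h2, h3, h4⟩
    exact ⟨⟨h2, h3⟩, lt_of_le_of_ne h4 h1.symm⟩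
  · rintro ⟨⟨h2, h3⟩, h4⟩
    exact ⟨h2, h3, h4.le⟩

/-- The weak form with variable coefficients `e`, tested near the boundary against a bump `θ` of
size `r`. -/
lemma abs_integral_bump_le {σ : ℝ} (hσ : σ = 1 ∨ σ = -1) {s b r : ℝ} (hr : 0 < r)
    {u θ : ℝ × ℝ → ℝ} (hu : ∀ z ∈ halfBox σ (s, b) r, DifferentiableAt ℝ u z)
    (hux : IntegrableOn (dx u) (closedBall (s, b) r ∩ halfPlane σ b))
    (huy : IntegrableOn (dy u) (closedBall (s, b) r ∩ halfPlane σ b))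
    (hθ : ContDiff ℝ (⊤ : ℕ∞) θ) (hθ0 : ∀ z ∉ closedBall (s, b) (3 * r / 4), θ z = 0)
    {k : ℝ} (hk₁ : ∀ z, |dx θ z| ≤ k / r ^ 2 ∧ |dy θ z| ≤ k / r ^ 2)
    (hk₂ : ∀ z, (|dx (dx θ) z| ≤ k / r ^ 3 ∧ |dy (dx θ) z| ≤ k / r ^ 3) ∧
      |dx (dy θ) z| ≤ k / r ^ 3 ∧ |dy (dy θ) z| ≤ k / r ^ 3)
    {e : ℝ × ℝ → Fin 2 → Fin 2 → ℝ} {c M : ℝ} (he : ∀ i j, Measurable fun z => e z i j)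
    (hc : ∀ i j, |e (s, b) i j| ≤ c)
    (hM : ∀ z ∈ halfBox σ (s, b) r, ∀ i j, |e z i j - e (s, b) i j| ≤ M * r)
    {u₀ l₁ l₂ m : ℝ} (hl : e (s, b) 1 0 * l₁ + e (s, b) 1 1 * l₂ = 0)
    (hm : ∀ z ∈ halfBox σ (s, b) r, |u z - u₀ - l₁ * (z.1 - s) - l₂ * (z.2 - b)| ≤ m) :
    |∫ z in halfPlane σ b, ((e z 0 0 * dx u z + e z 0 1 * dy u z) * dx θ z +
      (e z 1 0 * dx u z + e z 1 1 * dy u z) * dy θ z)| ≤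
      20 * c * k * (m / r) +
        2 * M * k / r * ∫ z in closedBall (s, b) r ∩ halfPlane σ b, (|dx u z| + |dy u z|) := by
  set p : ℝ × ℝ := (s, b) with hp
  have hpm : p ∈ halfBox σ p r := by simp [halfBox, hr.le]
  have hk0 : 0 ≤ k := by
    have := (abs_nonneg _).trans (hk₁ p).1
    have h2 : 0 < r ^ 2 := by positivity
    by_contra h
    exact absurd (div_neg_of_neg_of_pos (not_le.1 h) h2) (not_lt.2 this)
  have hM0 : 0 ≤ M * r := (abs_nonneg _).trans (hM p hpm 0 0)
  set H := halfPlane σ b with hH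
  have hHm : MeasurableSet H := measurableSet_halfPlane σ b
  set Q := closedBall p r ∩ H with hQ
  have hae : (halfBox σ p r : Set (ℝ × ℝ)) =ᵐ[volume] Q := halfBox_ae_eq hσ s b r
  have hQm : MeasurableSet Q := measurableSet_closedBall.inter hHm
  have hQb : Q ⊆ halfBox σ p r := fun z hz =>
    ⟨(mem_closedBall_prod.1 hz.1).1, (mem_closedBall_prod.1 hz.1).2, hz.2.le⟩
  have hfr := abs_integral_frozen_le hσ hr hu (hux.congr_set_ae hae)
    (huy.congr_set_ae hae) hθ hθ0 hk₁ hk₂ (hc 0 0) (hc 0 1) (hc 1 0) (hc 1 1) hl hm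
  rw [setIntegral_congr_set hae] at hfr
  set F := fun z => (e z 0 0 * dx u z + e z 0 1 * dy u z) * dx θ z +
      (e z 1 0 * dx u z + e z 1 1 * dy u z) * dy θ z with hF
  set F₀ := fun z => (e p 0 0 * dx u z + e p 0 1 * dy u z) * dx θ z +
      (e p 1 0 * dx u z + e p 1 1 * dy u z) * dy θ z with hF₀
  have h1 : ∫ z in H, F z = ∫ z in Q, F z := by
    refine (setIntegral_eq_of_subset_of_forall_sdiff_eq_zero hHm inter_subset_right ?_)
    intro z hz
    have : z ∉ closedBall p (3 * r / 4) := fun h => hz.2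
      ⟨closedBall_subset_closedBall (by linarith) h, hz.1⟩
    have h0 := fderiv_eq_zero_of_vanish_off isClosed_closedBall hθ0 this
    simp [hF, dx, dy, h0]
  have hX : IntegrableOn (fun z => |dx u z| + |dy u z|) Q := hux.abs.add huy.abs
  have hdiff : ∀ z ∈ Q, |F z - F₀ z| ≤ 2 * M * k / r * (|dx u z| + |dy u z|) := by
    intro z hz
    have hz' := hQb hz
    have e1 : F z - F₀ z = ((e z 0 0 - e p 0 0) * dx u z + (e z 0 1 - e p 0 1) * dy u z) * dx θ z +
      ((e z 1 0 - e p 1 0) * dx u z + (e z 1 1 - e p 1 1) * dy u z) * dy θ z := by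
      simp only [hF, hF₀]; ring
    have e2 : ∀ i, |(e z i 0 - e p i 0) * dx u z + (e z i 1 - e p i 1) * dy u z| ≤
        M * r * (|dx u z| + |dy u z|) := by
      intro i
      refine (abs_add_le _ _).trans ?_
      rw [abs_mul, abs_mul, mul_add]
      gcongr
      exacts [hM z hz' i 0, hM z hz' i 1]
    rw [e1]
    refine (abs_add_le _ _).trans ?_
    rw [abs_mul, abs_mul]
    have e3 : M * r * (|dx u z| + |dy u z|) * (k / r ^ 2) + M * r * (|dx u z| + |dy u z|) *
        (k / r ^ 2) = 2 * M * k / r * (|dx u z| + |dy u z|) := by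
      field_simp; ring
    rw [← e3]
    gcongr
    exacts [e2 0, (hk₁ z).1, e2 1, (hk₁ z).2]
  have hθx := continuous_dx hθ
  have hθy := continuous_dy hθ
  have hF₀i : IntegrableOn F₀ Q := by
    have hb : ∀ (h : ℝ × ℝ → ℝ) (t : ℝ × ℝ → ℝ), Continuous t → (∀ z, |t z| ≤ k / r ^ 2) →
        IntegrableOn h Q → IntegrableOn (fun z => h z * t z) Q := fun h t ht htb hh =>
      hh.mul_bdd (c := k / r ^ 2) ht.aestronglyMeasurable (Eventually.of_forall htb)
    exact (hb _ _ hθx (fun z => (hk₁ z).1) ((hux.const_mul _).add (huy.const_mul _))).add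
      (hb _ _ hθy (fun z => (hk₁ z).2) ((hux.const_mul _).add (huy.const_mul _)))
  have hux' := measurable_dx u
  have huy' := measurable_dy u
  have hFm : Measurable F := by
    have := hθx.measurable
    have := hθy.measurable
    have h00 := he 0 0
    have h01 := he 0 1
    have h10 := he 1 0
    have h11 := he 1 1
    exact (((h00.mul hux').add (h01.mul huy')).mul hθx.measurable).add
      (((h10.mul hux').add (h11.mul huy')).mul hθy.measurable)
  have hdi : IntegrableOn (fun z => F z - F₀ z) Q := by
    refine (hX.const_mul (2 * M * k / r)).mono'
      (hFm.aestronglyMeasurable.sub hF₀i.aestronglyMeasurable) ?_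
    filter_upwards [ae_restrict_mem hQm] with z hz using hdiff z hz
  have h2 : ∫ z in Q, F z = (∫ z in Q, F₀ z) + ∫ z in Q, (F z - F₀ z) := by
    rw [← integral_add hF₀i hdi]
    simp
  have h3 : |∫ z in Q, (F z - F₀ z)| ≤ 2 * M * k / r * ∫ z in Q, (|dx u z| + |dy u z|) := by
    rw [← integral_const_mul]
    refine (abs_integral_le_integral_abs).trans ?_
    exact setIntegral_mono_on hdi.abs (hX.const_mul _) hQm hdiff
  rw [h1, h2]
  refine (abs_add_le _ _).trans (add_le_add (hfr.trans (le_of_eq ?_)) h3)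
  field_simp; ring

/-- Splitting the weak form with a cutoff that is an average of bumps. -/
lemma integral_weak_split {D U V : Set (ℝ × ℝ)} (hU : MeasurableSet U)
    {Y₁ Y₂ φ η : ℝ × ℝ → ℝ} {θ : ℝ → ℝ × ℝ → ℝ} {S : Set ℝ} (hSf : volume S < ⊤)
    (hY₁ : IntegrableOn Y₁ (U ∩ D)) (hY₂ : IntegrableOn Y₂ (U ∩ D)) (hV : WeakZero D Y₁ Y₂ V)
    (hφ : ContDiff ℝ (⊤ : ℕ∞) φ) (hφc : HasCompactSupport φ) (hφU : tsupport φ ⊆ U)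
    (hη : ContDiff ℝ (⊤ : ℕ∞) η) (hη1 : ∀ z, |η z| ≤ 1)
    (hηx : ∀ z, dx η z = ∫ s in S, dx (θ s) z) (hηy : ∀ z, dy η z = ∫ s in S, dy (θ s) z)
    {k : ℝ} (hθ : ∀ s z, |dx (θ s) z| ≤ k ∧ |dy (θ s) z| ≤ k)
    (hθx : Continuous (fun q : (ℝ × ℝ) × ℝ => dx (θ q.2) q.1))
    (hθy : Continuous (fun q : (ℝ × ℝ) × ℝ => dy (θ q.2) q.1))
    (hsupp : tsupport (fun z => φ z * (1 - η z)) ⊆ V) :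
    IntegrableOn (fun s => ∫ z in D, φ z * (Y₁ z * dx (θ s) z + Y₂ z * dy (θ s) z)) S ∧
    ∫ z in D, (Y₁ z * dx φ z + Y₂ z * dy φ z) =
      (∫ z in D, η z * (Y₁ z * dx φ z + Y₂ z * dy φ z)) +
      ∫ s in S, ∫ z in D, φ z * (Y₁ z * dx (θ s) z + Y₂ z * dy (θ s) z) := by
  obtain ⟨C, hC⟩ := hφc.exists_bound_of_continuous hφ.continuous
  have hφ0 : ∀ z ∉ U, φ z = 0 := fun z hz =>
    image_eq_zero_of_notMem_tsupport fun h => hz (hφU h)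
  have hφY₁ := integrableOn_mul_of_vanish hU hY₁ hφ.continuous hC hφ0
  have hφY₂ := integrableOn_mul_of_vanish hU hY₂ hφ.continuous hC hφ0
  have hd : ∀ {h : ℝ × ℝ → ℝ}, ContDiff ℝ (⊤ : ℕ∞) h → ∀ z, HasFDerivAt h (fderiv ℝ h z) z :=
    fun hh z => ((hh.differentiable (by simp)) z).hasFDerivAt
  have hfin : IsFiniteMeasure (volume.restrict S) := ⟨by simpa using hSf⟩
  have hI1 : IntegrableOn (fun z => Y₁ z * dx φ z + Y₂ z * dy φ z) D :=
    integrableOn_weak hU hY₁ hY₂ hφ hφc hφU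
  have hI2 : IntegrableOn (fun z => η z * (Y₁ z * dx φ z + Y₂ z * dy φ z)) D :=
    hI1.bdd_mul (c := 1) hη.continuous.aestronglyMeasurable (Eventually.of_forall hη1)
  have hprod : ∀ (Z : ℝ × ℝ → ℝ) (t : ℝ → ℝ × ℝ → ℝ), IntegrableOn Z D →
      Continuous (fun q : (ℝ × ℝ) × ℝ => t q.2 q.1) → (∀ s z, |t s z| ≤ k) →
      Integrable (fun q : (ℝ × ℝ) × ℝ => Z q.1 * t q.2 q.1)
        ((volume.restrict D).prod (volume.restrict S)) := by
    intro Z t hZ ht htb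
    exact (hZ.comp_fst (volume.restrict S)).mul_bdd (c := k) ht.aestronglyMeasurable
      (Eventually.of_forall fun q => htb _ _)
  have hP : Integrable (fun q : (ℝ × ℝ) × ℝ =>
      φ q.1 * (Y₁ q.1 * dx (θ q.2) q.1 + Y₂ q.1 * dy (θ q.2) q.1))
        ((volume.restrict D).prod (volume.restrict S)) := by
    refine ((hprod _ _ hφY₁ hθx fun s z => (hθ s z).1).add
      (hprod _ _ hφY₂ hθy fun s z => (hθ s z).2)).congr (Eventually.of_forall fun q => ?_)
    simp only [Pi.add_apply]; ring
  have hin : ∀ z, φ z * (Y₁ z * dx η z + Y₂ z * dy η z) =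
      ∫ s in S, φ z * (Y₁ z * dx (θ s) z + Y₂ z * dy (θ s) z) := by
    intro z
    have c1 : Continuous fun s => dx (θ s) z := hθx.comp (Continuous.prodMk_right z)
    have c2 : Continuous fun s => dy (θ s) z := hθy.comp (Continuous.prodMk_right z)
    have i1 : IntegrableOn (fun s => dx (θ s) z) S :=
      (integrable_const k).mono' c1.aestronglyMeasurable
        (Eventually.of_forall fun s => (hθ s z).1)
    have i2 : IntegrableOn (fun s => dy (θ s) z) S :=
      (integrable_const k).mono' c2.aestronglyMeasurable
        (Eventually.of_forall fun s => (hθ s z).2)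
    rw [integral_const_mul, integral_add (i1.const_mul _) (i2.const_mul _), integral_const_mul,
      integral_const_mul, hηx, hηy]
  refine ⟨hP.integral_prod_right, ?_⟩
  have hI3 : IntegrableOn (fun z => φ z * (Y₁ z * dx η z + Y₂ z * dy η z)) D := by
    simp only [hin]
    exact hP.integral_prod_left
  have hz := hV _ (hφ.mul (contDiff_const.sub hη)) hφc.mul_right hsupp
  have e1 : ∀ z v, fderiv ℝ (fun z => φ z * (1 - η z)) z v =
      fderiv ℝ φ z v - η z * fderiv ℝ φ z v - φ z * fderiv ℝ η z v := by
    intro z v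
    have := ((hd hφ z).mul ((hd hη z).const_sub 1)).fderiv
    have h2 : fderiv ℝ (fun z => φ z * (1 - η z)) z = _ := this
    rw [h2]
    simp; ring
  have e2 : ∀ z, Y₁ z * dx (fun z => φ z * (1 - η z)) z + Y₂ z * dy (fun z => φ z * (1 - η z)) z =
      (Y₁ z * dx φ z + Y₂ z * dy φ z) - η z * (Y₁ z * dx φ z + Y₂ z * dy φ z) -
        φ z * (Y₁ z * dx η z + Y₂ z * dy η z) := by
    intro z
    simp only [dx, dy, e1]; ring
  simp only [e2] at hz
  have hI12 : IntegrableOn (fun z => (Y₁ z * dx φ z + Y₂ z * dy φ z) -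
      η z * (Y₁ z * dx φ z + Y₂ z * dy φ z)) D := hI1.sub hI2
  rw [integral_sub hI12 hI3, integral_sub hI1 hI2] at hz
  have hsw : ∫ z in D, φ z * (Y₁ z * dx η z + Y₂ z * dy η z) =
      ∫ s in S, ∫ z in D, φ z * (Y₁ z * dx (θ s) z + Y₂ z * dy (θ s) z) := by
    simp only [hin]
    exact integral_integral_swap hP
  rw [← hsw]; linarith

/-- The total mass of a density averaged over balls centred on the line `{y = b}`. -/
lemma integral_average_on_line {D : Set (ℝ × ℝ)} {X : ℝ × ℝ → ℝ}
    (hX : IntegrableOn X D) (b : ℝ) {r : ℝ} (hr : 0 ≤ r) {S : Set ℝ}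
    (hSf : volume S < ⊤) (hX0 : ∀ z, 0 ≤ X z) :
    IntegrableOn (fun s => ∫ z in D, (closedBall (s, b) r).indicator X z) S ∧
    ∫ s in S, ∫ z in D, (closedBall (s, b) r).indicator X z ≤
      2 * r * ∫ z in D, {z : ℝ × ℝ | |z.2 - b| ≤ r}.indicator X z := by
  have hfin : IsFiniteMeasure (volume.restrict S) := ⟨by simpa using hSf⟩
  have hA : MeasurableSet {q : (ℝ × ℝ) × ℝ | q.1 ∈ closedBall (q.2, b) r} := by
    have : IsClosed {q : (ℝ × ℝ) × ℝ | dist q.1 (q.2, b) ≤ r} :=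
      isClosed_le (by fun_prop) (by fun_prop)
    exact this.measurableSet
  have hP : Integrable (fun q : (ℝ × ℝ) × ℝ => (closedBall (q.2, b) r).indicator X q.1)
      ((volume.restrict D).prod (volume.restrict S)) := by
    have := (hX.comp_fst (volume.restrict S)).indicator hA
    refine this.congr (Eventually.of_forall fun q => ?_)
    simp only [indicator]
    rfl
  refine ⟨hP.integral_prod_right, ?_⟩
  have hm : MeasurableSet {z : ℝ × ℝ | |z.2 - b| ≤ r} :=
    (isClosed_le (by fun_prop) (by fun_prop)).measurableSet
  rw [← integral_integral_swap hP, ← integral_const_mul]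
  refine integral_mono hP.integral_prod_left ((hX.indicator hm).const_mul _) fun z => ?_
  have e : ∀ s, (closedBall (s, b) r).indicator X z =
      (Icc (z.1 - r) (z.1 + r)).indicator
        (fun _ => {z : ℝ × ℝ | |z.2 - b| ≤ r}.indicator X z) s := by
    intro s
    by_cases h1 : |z.2 - b| ≤ r
    · rw [indicator_of_mem (show z ∈ {z : ℝ × ℝ | |z.2 - b| ≤ r} from h1)]
      by_cases h2 : |z.1 - s| ≤ r
      · rw [indicator_of_mem (mem_closedBall_prod.2 ⟨h2, h1⟩), indicator_of_mem]
        rw [abs_le] at h2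
        exact ⟨by linarith, by linarith⟩
      · rw [indicator_of_notMem fun h => h2 (mem_closedBall_prod.1 h).1, indicator_of_notMem]
        intro h
        exact h2 (abs_le.2 ⟨by linarith [h.2], by linarith [h.1]⟩)
    · rw [indicator_of_notMem fun h => h1 (mem_closedBall_prod.1 h).2,
        indicator_of_notMem (show z ∉ {z : ℝ × ℝ | |z.2 - b| ≤ r} from h1)]
      simp
  simp only [e]
  have h0 : 0 ≤ {z : ℝ × ℝ | |z.2 - b| ≤ r}.indicator X z := indicator_nonneg (fun z _ => hX0 z) z
  set y := {z : ℝ × ℝ | |z.2 - b| ≤ r}.indicator X z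
  calc ∫ s in S, (Icc (z.1 - r) (z.1 + r)).indicator (fun _ => y) s
      ≤ ∫ s, (Icc (z.1 - r) (z.1 + r)).indicator (fun _ => y) s := by
        refine setIntegral_le_integral ?_
          (Eventually.of_forall fun s => indicator_nonneg (fun _ _ => h0) s)
        exact (integrable_indicator_iff measurableSet_Icc).2
          (integrableOn_const measure_Icc_lt_top.ne)
    _ = 2 * r * y := by
        rw [integral_indicator measurableSet_Icc, setIntegral_const, Real.volume_real_Icc_of_le
          (by linarith), smul_eq_mul]
        ring

/-- The weak form with a smooth test function `φ`, up to a boundary layer of width `r` around the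
bad boundary points `(s, b)`, `s ∈ B`. -/
lemma exists_boundary_layer_bound {σ b : ℝ} (hσ : σ = 1 ∨ σ = -1) {a : ℝ × ℝ → Fin 2 → Fin 2 → ℝ}
    (ham : ∀ i j, Measurable fun z => a z i j) {Λ : ℝ} (hΛ : ∀ z i j, |a z i j| ≤ Λ)
    {u Y₁ Y₂ : ℝ × ℝ → ℝ} (hF : IsFlux u Y₁ Y₂)
    (hY₁ : ∀ z, Y₁ z = a z 0 0 * dx u z + a z 0 1 * dy u z)
    (hY₂ : ∀ z, Y₂ z = a z 1 0 * dx u z + a z 1 1 * dy u z)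
    {U : Set (ℝ × ℝ)} (hU : IsOpen U) (hUf : volume U < ⊤)
    (hE : IntegrableOn (energy u) (U ∩ halfPlane σ b))
    (hu : ∀ z ∈ U, 0 ≤ σ * (z.2 - b) → DifferentiableAt ℝ u z)
    (hgood : ∀ z ∈ U, ¬ GoodAt (halfPlane σ b) u Y₁ Y₂ z → z.2 = b)
    {L : ℝ} (hL : 0 ≤ L) (haL : ∀ z ∈ U, ∀ w ∈ U, 0 ≤ σ * (z.2 - b) → 0 ≤ σ * (w.2 - b) → ∀ i j,
      |a z i j - a w i j| ≤ L * dist z w)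
    {φ : ℝ × ℝ → ℝ} (hφ : ContDiff ℝ (⊤ : ℕ∞) φ) (hφc : HasCompactSupport φ)
    {δ : ℝ} (hφU : cthickening δ (tsupport φ) ⊆ U)
    {B : Set ℝ} (hB : B = {s | (s, b) ∈ tsupport φ ∧ ¬ GoodAt (halfPlane σ b) u Y₁ Y₂ (s, b)})
    (hBb : Bornology.IsBounded B) :
    ∃ κ, 0 ≤ κ ∧ ∀ r, 0 < r → 4 * r ≤ δ → ∃ (η : ℝ × ℝ → ℝ) (D : ℝ → ℝ),
      Continuous η ∧ (∀ z, |η z| ≤ 1) ∧ (∀ z, r < |z.2 - b| → η z = 0) ∧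
      Integrable D ∧ (∀ s, 0 ≤ D s) ∧ (∀ s ∉ thickening (2 * r) B, D s = 0) ∧
      (∀ s ∈ thickening (2 * r) B, ∀ u₀ l₁ l₂ m, a (s, b) 1 0 * l₁ + a (s, b) 1 1 * l₂ = 0 →
        (∀ z ∈ halfBox σ (s, b) r, |u z - u₀ - l₁ * (z.1 - s) - l₂ * (z.2 - b)| ≤ m) →
        D s ≤ κ * (m / r)) ∧
      |∫ z in halfPlane σ b, (Y₁ z * dx φ z + Y₂ z * dy φ z)| ≤
        |∫ z in halfPlane σ b, η z * (Y₁ z * dx φ z + Y₂ z * dy φ z)| +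
        κ * (∫ z in U ∩ halfPlane σ b,
          {z : ℝ × ℝ | |z.2 - b| ≤ r}.indicator (fun z => |dx u z| + |dy u z|) z) +
        ∫ s, D s := by
  obtain ⟨k, hk, hcut⟩ := exists_boundary_cutoff
  obtain ⟨Cφ, hCφ⟩ := hφc.exists_bound_of_continuous hφ.continuous
  obtain ⟨Lφ, hLφ⟩ := ContDiff.lipschitzWith_of_hasCompactSupport hφc hφ (by simp)
  have hCφ0 : 0 ≤ Cφ := (norm_nonneg _).trans (hCφ 0)
  have hΛ0 : 0 ≤ Λ := (abs_nonneg _).trans (hΛ 0 0 0)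
  set M : ℝ := Cφ * L + Λ * Lφ with hM
  have hM0 : 0 ≤ M := by positivity
  set H := halfPlane σ b with hH
  have hHm : MeasurableSet H := measurableSet_halfPlane σ b
  set X : ℝ × ℝ → ℝ := fun z => |dx u z| + |dy u z| with hX
  have hX0 : ∀ z, 0 ≤ X z := fun z => by positivity
  have hfinU : IsFiniteMeasure (volume.restrict (U ∩ H)) :=
    ⟨by simpa using (measure_mono inter_subset_left).trans_lt hUf⟩
  have huxU : IntegrableOn (dx u) (U ∩ H) := (memLp_dx hE).integrable (by norm_num)
  have huyU : IntegrableOn (dy u) (U ∩ H) := (memLp_dy hE).integrable (by norm_num)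
  have hXi : IntegrableOn X (U ∩ H) := huxU.abs.add huyU.abs
  have hYi := hF.integrableOn hUf hE
  have hφU' : tsupport φ ⊆ U := (self_subset_cthickening _).trans hφU
  set κ : ℝ := 20 * (Cφ * Λ) * k + 4 * M * k with hκ
  refine ⟨κ, by positivity, fun r hr hrδ => ?_⟩
  set S := thickening (2 * r) B with hS
  have hSf : volume S < ⊤ := hBb.thickening.measure_lt_top
  have hSm : MeasurableSet S := isOpen_thickening.measurableSet
  obtain ⟨η, θ, hη, hη1, hη0, hηe, hηx, hηy, hθ, hθ0, hk₁, hk₂, hcx, hcy⟩ := hcut b r hr S hSm hSf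
  have hsupp : tsupport (fun z => φ z * (1 - η z)) ⊆ {z | GoodAt H u Y₁ Y₂ z} := by
    intro z hz
    by_contra hbad
    have hzφ : z ∈ tsupport φ := tsupport_mul_subset_left hz
    have hzb : z.2 = b := hgood z (hφU' hzφ) hbad
    have hzB : z.1 ∈ B := by
      rw [hB]
      have : (z.1, b) = z := by ext <;> simp [hzb]
      exact ⟨by rw [this]; exact hzφ, by rw [this]; exact hbad⟩
    refine (notMem_tsupport_iff_eventuallyEq.2 ?_) hz
    filter_upwards [ball_mem_nhds z (show 0 < r / 4 by positivity)] with w hw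
    have hw' := mem_closedBall_prod.1 (ball_subset_closedBall hw)
    have : η w = 1 := by
      refine hηe w (by rw [← hzb]; exact hw'.2) fun t ht => ?_
      rw [hS, mem_thickening_iff]
      refine ⟨z.1, hzB, ?_⟩
      rw [Real.dist_eq, abs_lt]
      have := abs_le.1 hw'.1
      exact ⟨by linarith [ht.1], by linarith [ht.2]⟩
    simp [this]
  have hk₁' : ∀ s z, |dx (θ s) z| ≤ k / r ^ 2 ∧ |dy (θ s) z| ≤ k / r ^ 2 := hk₁
  obtain ⟨hGi, hT⟩ := integral_weak_split hU.measurableSet hSf hYi.1 hYi.2 (weakZero_goodAt hF) hφ hφc hφU'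
    hη hη1 hηx hηy hk₁' hcx hcy hsupp
  set G : ℝ → ℝ := fun s => ∫ z in H, φ z * (Y₁ z * dx (θ s) z + Y₂ z * dy (θ s) z) with hG
  obtain ⟨hEi, hEle⟩ := integral_average_on_line hXi b hr.le hSf hX0
  set E : ℝ → ℝ := fun s => 2 * M * k / r * ∫ z in U ∩ H, (closedBall (s, b) r).indicator X z
    with hEdef
  have hEi' : IntegrableOn E S := hEi.const_mul _
  set D : ℝ → ℝ := S.indicator fun s => max (|G s| - E s) 0 with hD
  have hDi' : IntegrableOn (fun s => max (|G s| - E s) 0) S := (hGi.abs.sub hEi').pos_part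
  have hDi : Integrable D := (integrable_indicator_iff hSm).2 hDi'
  have hEeq : ∀ s, closedBall (s, b) r ⊆ U → E s = 2 * M * k / r *
      ∫ z in closedBall (s, b) r ∩ H, X z := by
    intro s hs
    simp only [hEdef]
    rw [setIntegral_indicator measurableSet_closedBall]
    congr 3
    ext z; constructor
    · rintro ⟨⟨-, h2⟩, h3⟩; exact ⟨h3, h2⟩
    · rintro ⟨h1, h2⟩; exact ⟨⟨hs h1, h2⟩, h1⟩
  refine ⟨η, D, hη.continuous, hη1, hη0, hDi, fun s => indicator_nonneg (fun _ _ => le_max_right _ _) s,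
    fun s hs => indicator_of_notMem hs _, ?_, ?_⟩
  · intro s hs u₀ l₁ l₂ m hl hm
    have hsU : closedBall (s, b) r ⊆ U := by
      obtain ⟨s', hs', hss⟩ := mem_thickening_iff.1 hs
      rw [hB] at hs'
      refine Subset.trans ?_ hφU
      intro z hz
      refine mem_cthickening_of_dist_le z (s', b) δ _ hs'.1 ?_
      refine (dist_triangle z (s, b) _).trans ?_
      have e : dist ((s, b) : ℝ × ℝ) (s', b) = dist s s' := by simp [Prod.dist_eq]
      rw [e]; rw [mem_closedBall] at hz; linarith
    have hsub : halfBox σ (s, b) r ⊆ closedBall (s, b) r := fun z hz =>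
      mem_closedBall_prod.2 ⟨hz.1, hz.2.1⟩
    have hpm : ((s, b) : ℝ × ℝ) ∈ halfBox σ (s, b) r := by simp [halfBox, hr.le]
    have hsubH : closedBall (s, b) r ∩ H ⊆ U ∩ H := inter_subset_inter_left _ hsU
    have hm0 : 0 ≤ m := (abs_nonneg _).trans (hm _ hpm)
    have hmain := abs_integral_bump_le hσ hr (fun z hz => hu z (hsU (hsub hz)) hz.2.2)
      (huxU.mono_set hsubH) (huyU.mono_set hsubH) (hθ s) (hθ0 s) (hk₁ s) (hk₂ s)
      (e := fun z i j => φ z * a z i j) (c := Cφ * Λ) (M := M)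
      (fun i j => hφ.continuous.measurable.mul (ham i j))
      (fun i j => by
        rw [abs_mul]
        exact mul_le_mul (hCφ _) (hΛ _ _ _) (abs_nonneg _) hCφ0)
      (fun z hz i j => by
        have hd : dist z (s, b) ≤ r := hsub hz
        have h1 := haL z (hsU (hsub hz)) (s, b) (hsU (hsub hpm)) hz.2.2 (by simp) i j
        have h2 := hLφ.dist_le_mul z (s, b)
        rw [Real.dist_eq] at h2
        have h3 : φ z * a z i j - φ (s, b) * a (s, b) i j =
          φ z * (a z i j - a (s, b) i j) + a (s, b) i j * (φ z - φ (s, b)) := by ring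
        rw [h3]
        refine (abs_add_le _ _).trans ?_
        rw [abs_mul, abs_mul]
        have h4 : |φ z| * |a z i j - a (s, b) i j| ≤ Cφ * (L * r) :=
          mul_le_mul (hCφ z) (h1.trans (mul_le_mul_of_nonneg_left hd hL)) (abs_nonneg _) hCφ0
        have h5 : |a (s, b) i j| * |φ z - φ (s, b)| ≤ Λ * (Lφ * r) :=
          mul_le_mul (hΛ _ _ _) (h2.trans (mul_le_mul_of_nonneg_left hd Lφ.2)) (abs_nonneg _) hΛ0
        rw [hM]; linarith)
      (u₀ := u₀) (l₁ := l₁) (l₂ := l₂) (m := m)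
      (by
        have : φ (s, b) * a (s, b) 1 0 * l₁ + φ (s, b) * a (s, b) 1 1 * l₂ =
          φ (s, b) * (a (s, b) 1 0 * l₁ + a (s, b) 1 1 * l₂) := by ring
        rw [this, hl, mul_zero]) hm
    have hGe : G s = ∫ z in halfPlane σ b, ((φ z * a z 0 0 * dx u z + φ z * a z 0 1 * dy u z) *
        dx (θ s) z + (φ z * a z 1 0 * dx u z + φ z * a z 1 1 * dy u z) * dy (θ s) z) := by
      simp only [hG, hY₁, hY₂]
      congr 1; ext z; ring
    rw [← hGe, ← hEeq s hsU] at hmain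
    rw [hD, indicator_of_mem hs]
    have hmr : 0 ≤ m / r := by positivity
    refine max_le ?_ (by positivity)
    have : 0 ≤ 4 * M * k * (m / r) := by positivity
    rw [hκ, add_mul]; linarith
  · have hGle : |∫ s in S, G s| ≤ (∫ s in S, E s) + ∫ s, D s := by
      rw [hD, integral_indicator hSm, ← integral_add hEi' hDi']
      refine abs_integral_le_integral_abs.trans ?_
      refine setIntegral_mono_on hGi.abs (hEi'.add hDi') hSm fun s _ => ?_
      have := le_max_left (|G s| - E s) 0
      linarith
    have hI0 : 0 ≤ ∫ z in U ∩ H, {z : ℝ × ℝ | |z.2 - b| ≤ r}.indicator X z :=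
      integral_nonneg fun z => indicator_nonneg (fun z _ => hX0 z) z
    have hEs : ∫ s in S, E s ≤ κ * ∫ z in U ∩ H, {z : ℝ × ℝ | |z.2 - b| ≤ r}.indicator X z := by
      simp only [hEdef]
      rw [integral_const_mul]
      have h1 : 0 ≤ 2 * M * k / r := by positivity
      refine (mul_le_mul_of_nonneg_left hEle h1).trans ?_
      have h2 : 2 * M * k / r * (2 * r * ∫ z in U ∩ H, {z : ℝ × ℝ | |z.2 - b| ≤ r}.indicator X z)
        = 4 * M * k * ∫ z in U ∩ H, {z : ℝ × ℝ | |z.2 - b| ≤ r}.indicator X z := by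
        field_simp; ring
      rw [h2]
      refine mul_le_mul_of_nonneg_right ?_ hI0
      have : 0 ≤ 20 * (Cφ * Λ) * k := by positivity
      rw [hκ]; linarith
    rw [hT]
    refine (abs_add_le _ _).trans ?_
    linarith

/-- The weak equation holds up to the boundary if the pointwise conormal derivative vanishes at the
bad boundary points. -/
theorem weakZero_of_boundary {σ b : ℝ} (hσ : σ = 1 ∨ σ = -1) {a : ℝ × ℝ → Fin 2 → Fin 2 → ℝ}
    (ham : ∀ i j, Measurable fun z => a z i j) {Λ : ℝ} (hΛ : ∀ z i j, |a z i j| ≤ Λ)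
    {u Y₁ Y₂ : ℝ × ℝ → ℝ} (hF : IsFlux u Y₁ Y₂)
    (hY₁ : ∀ z, Y₁ z = a z 0 0 * dx u z + a z 0 1 * dy u z)
    (hY₂ : ∀ z, Y₂ z = a z 1 0 * dx u z + a z 1 1 * dy u z)
    {U : Set (ℝ × ℝ)} (hU : IsOpen U) (hUf : volume U < ⊤)
    (hE : IntegrableOn (energy u) (U ∩ halfPlane σ b))
    (hu : ∀ z ∈ U, 0 ≤ σ * (z.2 - b) → DifferentiableAt ℝ u z)
    (hgood : ∀ z ∈ U, ¬ GoodAt (halfPlane σ b) u Y₁ Y₂ z → z.2 = b)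
    {N : ℝ} (hlip : ∀ z ∈ U, ¬ GoodAt (halfPlane σ b) u Y₁ Y₂ z → ∀ w ∈ U,
      |u w - u z| ≤ N * dist w z)
    {L : ℝ} (hL : 0 ≤ L) (haL : ∀ z ∈ U, ∀ w ∈ U, 0 ≤ σ * (z.2 - b) → 0 ≤ σ * (w.2 - b) → ∀ i j,
      |a z i j - a w i j| ≤ L * dist z w)
    (hNeu : ∀ s, (s, b) ∈ U → a (s, b) 1 0 * dx u (s, b) + a (s, b) 1 1 * dy u (s, b) = 0) :
    WeakZero (halfPlane σ b) Y₁ Y₂ U := by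
  intro φ hφ hφc hφU
  obtain ⟨δ, hδ, hδU⟩ := hφc.isCompact.exists_cthickening_subset_open hU hφU
  set H := halfPlane σ b with hH
  set B : Set ℝ := {s | (s, b) ∈ tsupport φ ∧ ¬ GoodAt H u Y₁ Y₂ (s, b)} with hB
  have hBb : Bornology.IsBounded B := by
    refine (hφc.isCompact.isBounded.image_fst).subset fun s hs => ⟨(s, b), hs.1, rfl⟩
  have hBc : IsClosed B := by
    have hc : Continuous fun s : ℝ => ((s, b) : ℝ × ℝ) := by fun_prop
    exact ((isClosed_tsupport φ).preimage hc).inter ((isClosed_not_goodAt H u Y₁ Y₂).preimage hc)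
  obtain ⟨κ, hκ, hstep⟩ := exists_boundary_layer_bound hσ ham hΛ hF hY₁ hY₂ hU hUf hE hu hgood hL haL
    hφ hφc hδU hB hBb
  set r : ℕ → ℝ := fun n => δ / (4 * ((n : ℝ) + 1)) with hr
  have hr0 : ∀ n, 0 < r n := fun n => by simp only [hr]; positivity
  have hrδ : ∀ n, 4 * r n ≤ δ := fun n => by
    have h1 : (0 : ℝ) < n + 1 := by positivity
    have : 4 * r n = δ / (n + 1) := by simp only [hr]; field_simp
    rw [this]
    exact div_le_self hδ.le (by linarith)
  have hrt : Tendsto r atTop (𝓝 0) := by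
    have := (tendsto_one_div_add_atTop_nhds_zero_nat (𝕜 := ℝ)).const_mul (δ / 4)
    rw [mul_zero] at this
    refine this.congr fun n => ?_
    simp only [hr]; field_simp
  choose η D hη hη1 hη0 hDi hD0 hDS hDle hT using fun n => hstep (r n) (hr0 n) (hrδ n)
  set X : ℝ × ℝ → ℝ := fun z => |dx u z| + |dy u z| with hX
  have hHm : MeasurableSet H := measurableSet_halfPlane σ b
  have hfinU : IsFiniteMeasure (volume.restrict (U ∩ H)) :=
    ⟨by simpa using (measure_mono inter_subset_left).trans_lt hUf⟩
  have hXi : IntegrableOn X (U ∩ H) :=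
    ((memLp_dx hE).integrable (by norm_num)).abs.add ((memLp_dy hE).integrable (by norm_num)).abs
  have hYi := hF.integrableOn hUf hE
  have hFi := integrableOn_weak hU.measurableSet hYi.1 hYi.2 hφ hφc hφU
  have hlt : ∀ z ∈ H, ∀ᶠ n in atTop, r n < |z.2 - b| := by
    intro z hz
    refine hrt.eventually_lt_const (abs_pos.2 fun h => ?_)
    have : 0 < σ * (z.2 - b) := hz
    rw [h] at this; simp at this
  have t1 : Tendsto (fun n => ∫ z in H, η n z * (Y₁ z * dx φ z + Y₂ z * dy φ z)) atTop (𝓝 0) := by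
    have h0 : (0 : ℝ) = ∫ z in H, (0 : ℝ) := by simp
    rw [h0]
    refine tendsto_integral_of_dominated_convergence
      (fun z => |Y₁ z * dx φ z + Y₂ z * dy φ z|)
      (fun n => (hη n).aestronglyMeasurable.mul hFi.aestronglyMeasurable) hFi.abs ?_ ?_
    · refine fun n => Eventually.of_forall fun z => ?_
      rw [Real.norm_eq_abs, abs_mul]
      exact mul_le_of_le_one_left (abs_nonneg _) (hη1 n z)
    · filter_upwards [ae_restrict_mem hHm] with z hz
      refine tendsto_const_nhds.congr' ?_
      filter_upwards [hlt z hz] with n hn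
      rw [hη0 n z hn, zero_mul]
  have t2 : Tendsto (fun n => ∫ z in U ∩ H, {z : ℝ × ℝ | |z.2 - b| ≤ r n}.indicator X z) atTop
      (𝓝 0) := by
    have h0 : (0 : ℝ) = ∫ z in U ∩ H, (0 : ℝ) := by simp
    rw [h0]
    refine tendsto_integral_of_dominated_convergence X (fun n => ?_) hXi ?_ ?_
    · refine hXi.aestronglyMeasurable.indicator ?_
      exact (isClosed_le (by fun_prop) (by fun_prop)).measurableSet
    · refine fun n => Eventually.of_forall fun z => ?_
      have hXz : 0 ≤ X z := by positivity
      rw [Real.norm_eq_abs, abs_of_nonneg (indicator_nonneg (fun z _ => by positivity) z)]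
      exact indicator_le_self' (fun _ _ => hXz) z
    · filter_upwards [ae_restrict_mem (hU.measurableSet.inter hHm)] with z hz
      refine tendsto_const_nhds.congr' ?_
      filter_upwards [hlt z hz.2] with n hn
      rw [indicator_of_notMem]
      exact not_le.2 hn
  have hnear : ∀ n, ∀ s ∈ thickening (2 * r n) B, ∃ s' ∈ B, ∀ z ∈ halfBox σ (s, b) (r n),
      z ∈ U ∧ (s', b) ∈ U ∧ dist z (s', b) ≤ 3 * r n := by
    intro n s hs
    obtain ⟨s', hs', hss⟩ := mem_thickening_iff.1 hs
    refine ⟨s', hs', fun z hz => ?_⟩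
    have h1 : dist z (s, b) ≤ r n := mem_closedBall_prod.2 ⟨hz.1, hz.2.1⟩
    have e : dist ((s, b) : ℝ × ℝ) (s', b) = dist s s' := by simp [Prod.dist_eq]
    have h2 : dist z (s', b) ≤ 3 * r n := by
      refine (dist_triangle z (s, b) _).trans ?_
      rw [e]; linarith
    refine ⟨hδU (mem_cthickening_of_dist_le z (s', b) δ _ hs'.1 ?_), hφU hs'.1, h2⟩
    have := hrδ n; have := hr0 n
    linarith
  have hN0 : ∀ s' ∈ B, 0 ≤ N := by
    intro s' hs'
    have h2 : (s', b) ∈ U := hφU hs'.1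
    by_contra hN
    obtain ⟨w, hw, hwne⟩ : ∃ w ∈ U, 0 < dist w (s', b) := by
      obtain ⟨ε, hε, hεU⟩ := Metric.isOpen_iff.1 hU _ h2
      refine ⟨(s' + ε / 2, b), hεU ?_, ?_⟩
      · simp [Prod.dist_eq, abs_of_pos hε]
        linarith
      · simp [Prod.dist_eq, hε.ne']
    have := (abs_nonneg _).trans (hlip _ h2 hs'.2 w hw)
    exact absurd this (not_le.2 (mul_neg_of_neg_of_pos (not_le.1 hN) hwne))
  have t3 : Tendsto (fun n => ∫ s, D n s) atTop (𝓝 0) := by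
    have h0 : (0 : ℝ) = ∫ _ : ℝ, (0 : ℝ) := by simp
    rw [h0]
    refine tendsto_integral_of_dominated_convergence
      ((thickening δ B).indicator fun _ => κ * (3 * N))
      (fun n => (hDi n).aestronglyMeasurable) ?_ ?_ ?_
    · rw [integrable_indicator_iff isOpen_thickening.measurableSet]
      exact integrableOn_const (hBb.thickening.measure_lt_top).ne
    · refine fun n => Eventually.of_forall fun s => ?_
      rw [Real.norm_of_nonneg (hD0 n s)]
      by_cases hs : s ∈ thickening (2 * r n) B
      · rw [indicator_of_mem (thickening_mono (by linarith [hrδ n, hr0 n]) B hs)]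
        obtain ⟨s', hs', hz⟩ := hnear n s hs
        have := hDle n s hs (u (s', b)) 0 0 (N * (3 * r n)) (by simp) fun z hzm => ?_
        · refine this.trans (le_of_eq ?_)
          have := (hr0 n).ne'
          field_simp
        · obtain ⟨h1, h2, h3⟩ := hz z hzm
          have h4 := hlip _ h2 hs'.2 z h1
          simp only [zero_mul, sub_zero]
          exact h4.trans (mul_le_mul_of_nonneg_left h3 (hN0 s' hs'))
      · rw [hDS n s hs]
        refine indicator_nonneg (fun s hs => ?_) s
        obtain ⟨s', hs', -⟩ := mem_thickening_iff.1 hs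
        have h5 := hN0 s' hs'
        positivity
    · refine Eventually.of_forall fun s => ?_
      by_cases hs : s ∈ B
      · have hsU : ((s, b) : ℝ × ℝ) ∈ U := hφU hs.1
        have hd := (hu _ hsU (by simp)).hasFDerivAt.isLittleO
        rw [Metric.tendsto_nhds]
        intro ε hε
        have hε' : 0 < ε / (2 * (κ + 1)) := by positivity
        obtain ⟨ρ, hρ, hρb⟩ := Metric.eventually_nhds_iff_ball.1 (hd.bound hε')
        filter_upwards [hrt.eventually_lt_const hρ] with n hn
        rw [Real.dist_eq, sub_zero, abs_of_nonneg (hD0 n s)]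
        have hst : s ∈ thickening (2 * r n) B :=
          self_subset_thickening (by linarith [hr0 n]) B hs
        have := hDle n s hst (u (s, b)) (dx u (s, b)) (dy u (s, b)) (ε / (2 * (κ + 1)) * r n)
          (hNeu s hsU) fun z hz => ?_
        · rw [mul_div_assoc, div_self (hr0 n).ne', mul_one] at this
          refine this.trans_lt ?_
          rw [mul_div_assoc', div_lt_iff₀ (by positivity)]
          nlinarith
        · have h1 : dist z (s, b) ≤ r n := mem_closedBall_prod.2 ⟨hz.1, hz.2.1⟩
          have h2 := hρb z (mem_ball.2 (h1.trans_lt hn))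
          have h3 : fderiv ℝ u (s, b) (z - (s, b)) =
              dx u (s, b) * (z.1 - s) + dy u (s, b) * (z.2 - b) := by
            have : z - (s, b) = (z.1 - s) • ((1, 0) : ℝ × ℝ) + (z.2 - b) • ((0, 1) : ℝ × ℝ) := by
              ext <;> simp
            rw [this, map_add, map_smul, map_smul]
            simp only [dx, dy, smul_eq_mul]; ring
          rw [h3, ← dist_eq_norm z] at h2
          rw [Real.norm_eq_abs] at h2
          rw [sub_sub]
          refine h2.trans (mul_le_mul_of_nonneg_left h1 hε'.le)
      · obtain ⟨ε, hε, hεB⟩ := Metric.isOpen_iff.1 hBc.isOpen_compl s hs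
        refine tendsto_const_nhds.congr' ?_
        filter_upwards [hrt.eventually_lt_const (show 0 < ε / 2 by positivity)] with n hn
        rw [hDS n s]
        intro hst
        obtain ⟨s', hs', hss⟩ := mem_thickening_iff.1 hst
        refine hεB (mem_ball.2 ?_) hs'
        rw [dist_comm]; linarith
  have tt := (t1.abs.add (t2.const_mul κ)).add t3
  simp only [abs_zero, mul_zero, add_zero] at tt
  exact abs_nonpos_iff.1 (ge_of_tendsto' tt hT)

lemma goodAt_of_notMem_closedHalfPlane {σ b : ℝ} {u Y₁ Y₂ : ℝ × ℝ → ℝ} {z : ℝ × ℝ}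
    (hz : σ * (z.2 - b) < 0) : GoodAt (halfPlane σ b) u Y₁ Y₂ z := by
  have hO : IsOpen {z : ℝ × ℝ | σ * (z.2 - b) < 0} := isOpen_lt (by fun_prop) (by fun_prop)
  obtain ⟨r, hr, hrO⟩ := Metric.isOpen_iff.1 hO z hz
  refine ⟨r, hr, ?_, fun φ hφ hφc hφs => ?_⟩
  · have : ball z r ∩ halfPlane σ b = ∅ :=
      eq_empty_of_forall_notMem fun w hw => lt_asymm (show _ < (0 : ℝ) from hrO hw.1) hw.2
    rw [this]; exact integrableOn_empty
  · refine setIntegral_eq_zero_of_forall_eq_zero fun w hw => ?_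
    have h0 := fderiv_eq_zero_of_notMem_tsupport fun h : w ∈ tsupport φ =>
      lt_asymm (show _ < (0 : ℝ) from hrO (hφs h)) hw
    simp [dx, dy, h0]

lemma exists_lip_bound {u : ℝ × ℝ → ℝ} {z : ℝ × ℝ} (hu : DifferentiableAt ℝ u z) :
    ∃ n : ℕ, ∀ w, dist w z < 1 / ((n : ℝ) + 1) → |u w - u z| ≤ n * dist w z := by
  obtain ⟨C, hC⟩ := hu.hasFDerivAt.isBigO_sub.bound
  obtain ⟨ε, hε, hb⟩ := Metric.eventually_nhds_iff.1 hC
  obtain ⟨n, hn⟩ := exists_nat_gt (max C (1 / ε))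
  refine ⟨n, fun w hw => ?_⟩
  have h1 : 1 / ((n : ℝ) + 1) < ε := by
    rw [div_lt_iff₀ (by positivity)]
    have := (le_max_right C (1 / ε)).trans_lt hn
    rw [div_lt_iff₀ hε] at this
    nlinarith
  have h2 := hb (hw.trans h1)
  rw [Real.norm_eq_abs, ← dist_eq_norm] at h2
  exact h2.trans (mul_le_mul_of_nonneg_right ((le_max_left _ _).trans hn.le) dist_nonneg)

/-- Near some point of a relatively open part of a closed set of differentiability points, the
function is uniformly Lipschitz at all points of that closed set. -/
lemma exists_uniform_lip {u : ℝ × ℝ → ℝ} {Bad W : Set (ℝ × ℝ)} (hBad : IsClosed Bad)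
    (hW : IsOpen W) (hu : ∀ z ∈ Bad ∩ W, DifferentiableAt ℝ u z) (hne : (Bad ∩ W).Nonempty) :
    ∃ z₁ ∈ Bad ∩ W, ∃ R > 0, ∃ N, 0 ≤ N ∧ ball z₁ R ⊆ W ∧
      ∀ z ∈ ball z₁ R, z ∈ Bad → ∀ w ∈ ball z₁ R, |u w - u z| ≤ N * dist w z := by
  obtain ⟨z₀, hz₀B, hz₀W⟩ := hne
  obtain ⟨ρ, hρ, hρW⟩ := Metric.nhds_basis_closedBall.mem_iff.1 (hW.mem_nhds hz₀W)
  set C : Set (ℝ × ℝ) := Bad ∩ closedBall z₀ ρ with hC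
  have hCu : ∀ z ∈ C, DifferentiableAt ℝ u z := fun z hz => hu z ⟨hz.1, hρW hz.2⟩
  have hCc : IsClosed C := hBad.inter isClosed_closedBall
  have : CompleteSpace C := hCc.completeSpace_coe
  set F : ℕ → Set C := fun n => {z | ∀ w, dist w z.1 < 1 / ((n : ℝ) + 1) →
    |u w - u z.1| ≤ n * dist w z.1} with hF
  have hFc : ∀ n, IsClosed (F n) := by
    intro n
    refine IsSeqClosed.isClosed fun x z hx hxz w hw => ?_
    have hxz' : Tendsto (fun k => (x k).1) atTop (𝓝 z.1) :=
      (continuous_subtype_val.tendsto z).comp hxz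
    have h1 : Tendsto (fun k => |u w - u (x k).1|) atTop (𝓝 |u w - u z.1|) :=
      (tendsto_const_nhds.sub ((hCu z z.2).continuousAt.tendsto.comp hxz')).abs
    have h2 : Tendsto (fun k => dist w (x k).1) atTop (𝓝 (dist w z.1)) :=
      tendsto_const_nhds.dist hxz'
    refine le_of_tendsto_of_tendsto h1 (h2.const_mul _) ?_
    filter_upwards [h2.eventually_lt_const hw] with k hk using hx k w hk
  have hFU : ⋃ n, F n = univ := by
    refine eq_univ_of_forall fun z => ?_
    obtain ⟨n, hn⟩ := exists_lip_bound (hCu z z.2)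
    exact mem_iUnion.2 ⟨n, hn⟩
  have hdense := dense_iUnion_interior_of_closed hFc hFU
  have hO : IsOpen {z : C | dist z.1 z₀ < ρ} := isOpen_lt (by fun_prop) (by fun_prop)
  obtain ⟨z₁, hz₁O, hz₁⟩ := hdense.exists_mem_open hO
    ⟨⟨z₀, hz₀B, mem_closedBall_self hρ.le⟩, by simpa using hρ⟩
  obtain ⟨n, hn⟩ := mem_iUnion.1 hz₁O
  obtain ⟨ε, hε, hεF⟩ := Metric.mem_nhds_iff.1 (mem_interior_iff_mem_nhds.1 hn)
  have hz₁' : dist z₁.1 z₀ < ρ := hz₁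
  set R : ℝ := min (min ε (ρ - dist z₁.1 z₀)) (1 / (2 * ((n : ℝ) + 1))) with hR
  have hR0 : 0 < R := lt_min (lt_min hε (sub_pos.2 hz₁')) (by positivity)
  have hRρ : ball z₁.1 R ⊆ closedBall z₀ ρ := fun z hz => by
    have h1 : dist z z₁.1 < ρ - dist z₁.1 z₀ :=
      (mem_ball.1 hz).trans_le ((min_le_left _ _).trans (min_le_right _ _))
    rw [mem_closedBall]
    linarith [dist_triangle z z₁.1 z₀]
  refine ⟨z₁.1, ⟨z₁.2.1, hρW z₁.2.2⟩, R, hR0, n, by positivity, hRρ.trans hρW, ?_⟩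
  intro z hz hzB w hw
  have hzC : z ∈ C := ⟨hzB, hRρ hz⟩
  have h1 : (⟨z, hzC⟩ : C) ∈ ball z₁ ε := by
    rw [mem_ball, Subtype.dist_eq]
    exact (mem_ball.1 hz).trans_le ((min_le_left _ _).trans (min_le_left _ _))
  refine hεF h1 w ?_
  have h2 : R ≤ 1 / (2 * ((n : ℝ) + 1)) := min_le_right _ _
  have h3 : 1 / (2 * ((n : ℝ) + 1)) = (1 / ((n : ℝ) + 1)) / 2 := by field_simp
  have h4 := dist_triangle_right w z z₁.1
  rw [mem_ball] at hz hw
  change dist w z < _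
  linarith

/-- Interior and boundary regularity: every point is good. -/
theorem goodAt_of_weakZero {σ b : ℝ} (hσ : σ = 1 ∨ σ = -1) {a : ℝ × ℝ → Fin 2 → Fin 2 → ℝ}
    (ham : ∀ i j, Measurable fun z => a z i j) {Λ : ℝ} (hΛ : ∀ z i j, |a z i j| ≤ Λ)
    {u Y₁ Y₂ : ℝ × ℝ → ℝ} (hF : IsFlux u Y₁ Y₂)
    (hY₁ : ∀ z, Y₁ z = a z 0 0 * dx u z + a z 0 1 * dy u z)
    (hY₂ : ∀ z, Y₂ z = a z 1 0 * dx u z + a z 1 1 * dy u z)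
    {W : Set (ℝ × ℝ)} (hW : IsOpen W) {lam : ℝ} (hlam : 0 < lam)
    (hell : ∀ z ∈ W ∩ halfPlane σ b, lam * energy u z ≤ Y₁ z * dx u z + Y₂ z * dy u z)
    (hu : ∀ z ∈ W, 0 ≤ σ * (z.2 - b) → DifferentiableAt ℝ u z)
    (hweak : WeakZero (halfPlane σ b) Y₁ Y₂ (W ∩ halfPlane σ b))
    (haL : ∀ s, (s, b) ∈ W → ∃ r > 0, ∃ L, 0 ≤ L ∧ ∀ z ∈ ball (s, b) r, ∀ w ∈ ball (s, b) r,
      0 ≤ σ * (z.2 - b) → 0 ≤ σ * (w.2 - b) → ∀ i j, |a z i j - a w i j| ≤ L * dist z w)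
    (hNeu : ∀ s, (s, b) ∈ W → a (s, b) 1 0 * dx u (s, b) + a (s, b) 1 1 * dy u (s, b) = 0) :
    ∀ z ∈ W, GoodAt (halfPlane σ b) u Y₁ Y₂ z := by
  set H := halfPlane σ b with hH
  by_contra! hcon
  obtain ⟨z₀, hz₀W, hz₀⟩ := hcon
  have hbad0 : ∀ z, ¬ GoodAt H u Y₁ Y₂ z → 0 ≤ σ * (z.2 - b) := fun z hz => by
    by_contra h
    exact hz (goodAt_of_notMem_closedHalfPlane (not_le.1 h))
  obtain ⟨z₁, ⟨hz₁, hz₁W⟩, R, hR, N, hN, hRW, hlip⟩ := exists_uniform_lip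
    (isClosed_not_goodAt H u Y₁ Y₂) hW (fun z hz => hu z hz.2 (hbad0 z hz.1)) ⟨z₀, hz₀, hz₀W⟩
  have hR4 : 4 * (R / 4) = R := by ring
  have hE := integrableOn_energy_of_lip hσ hF hlam (z₁ := z₁) (R := R / 4) (N := N) (by positivity)
    hN hz₁ (by
      rw [hR4]
      exact fun z hz => ⟨hu z (hRW hz.1) (le_of_lt hz.2), hell z ⟨hRW hz.1, hz.2⟩⟩)
    (by rw [hR4]; exact hlip)
  have hRs : ball z₁ (R / 4) ⊆ ball z₁ R := ball_subset_ball (by linarith)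
  have hline : ∀ z ∈ ball z₁ (R / 4), ¬ GoodAt H u Y₁ Y₂ z → z.2 = b := by
    intro z hz hzb
    by_contra hne
    have hzH : z ∈ H := lt_of_le_of_ne (hbad0 z hzb)
      (mul_ne_zero (by rcases hσ with rfl | rfl <;> norm_num) (sub_ne_zero.2 hne)).symm
    obtain ⟨ε, hε, hεs⟩ := Metric.isOpen_iff.1 (isOpen_ball.inter (isOpen_halfPlane σ b)) z
      ⟨hz, hzH⟩
    exact hzb ⟨ε, hε, hE.mono_set fun w hw => ⟨(hεs hw.1).1, hw.2⟩,
      hweak.mono fun w hw => ⟨hRW (hRs (hεs hw).1), (hεs hw).2⟩⟩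
  have hz₁b : z₁.2 = b := hline z₁ (mem_ball_self (by positivity)) hz₁
  have hz₁e : (z₁.1, b) = z₁ := by ext <;> simp [hz₁b]
  obtain ⟨r, hr, L, hL, haL'⟩ := haL z₁.1 (by rw [hz₁e]; exact hz₁W)
  rw [hz₁e] at haL'
  set t := min r (R / 4) with ht
  have ht0 : 0 < t := lt_min hr (by positivity)
  have htr : ball z₁ t ⊆ ball z₁ r := ball_subset_ball (min_le_left _ _)
  have htR : ball z₁ t ⊆ ball z₁ (R / 4) := ball_subset_ball (min_le_right _ _)
  have htW : ball z₁ t ⊆ W := htR.trans (hRs.trans hRW)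
  have hEt : IntegrableOn (energy u) (ball z₁ t ∩ H) := hE.mono_set (inter_subset_inter_left _ htR)
  refine hz₁ ⟨t, ht0, hEt, weakZero_of_boundary hσ ham hΛ hF hY₁ hY₂ isOpen_ball
    measure_ball_lt_top hEt (fun z hz => hu z (htW hz)) (fun z hz => hline z (htR hz))
    (fun z hz hzb w hw => hlip z (hRs (htR hz)) hzb w (hRs (htR hw))) hL
    (fun z hz w hw => haL' z (htr hz) w (htr hw)) fun s hs => hNeu s (htW hs)⟩

lemma hasDerivAt_max_zero_sq (t : ℝ) :
    HasDerivAt (fun t : ℝ => max t 0 ^ 2) (2 * max t 0) t := by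
  rcases lt_trichotomy t 0 with h | rfl | h
  · rw [max_eq_right h.le, mul_zero]
    refine (hasDerivAt_const t (0 : ℝ)).congr_of_eventuallyEq ?_
    filter_upwards [eventually_lt_nhds h] with s hs
    simp [max_eq_right hs.le]
  · rw [max_self, mul_zero, hasDerivAt_iff_isLittleO_nhds_zero]
    have h1 : (fun h : ℝ => h ^ 2) =o[𝓝 0] fun h => h := Asymptotics.isLittleO_pow_id one_lt_two
    refine (Asymptotics.IsBigO.of_bound 1 (Eventually.of_forall fun h => ?_)).trans_isLittleO h1
    simp only [zero_add, max_self, ne_eq, OfNat.ofNat_ne_zero, not_false_eq_true, zero_pow,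
      sub_zero, smul_zero, norm_pow, one_mul]
    refine pow_le_pow_left₀ (norm_nonneg _) ?_ 2
    rw [Real.norm_eq_abs, Real.norm_eq_abs, abs_of_nonneg (le_max_right _ _)]
    exact max_le (le_abs_self _) (abs_nonneg _)
  · rw [max_eq_left h.le]
    have : HasDerivAt (fun t : ℝ => t ^ 2) (2 * t) t := by simpa using hasDerivAt_pow 2 t
    refine this.congr_of_eventuallyEq ?_
    filter_upwards [eventually_gt_nhds h] with s hs
    rw [max_eq_left hs.le]

lemma exists_step : ∃ (g : ℝ → ℝ) (C : ℝ), ContDiff ℝ (⊤ : ℕ∞) g ∧ (∀ t, 0 ≤ g t ∧ g t ≤ 1) ∧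
    (∀ t ≤ 1, g t = 1) ∧ (∀ t, 2 ≤ t → g t = 0) ∧ ∀ t, |deriv g t| ≤ C := by
  set g : ℝ → ℝ := fun t => Real.smoothTransition (2 - t) with hg
  have hgs : ContDiff ℝ (⊤ : ℕ∞) g :=
    Real.smoothTransition.contDiff.comp (contDiff_const.sub contDiff_id)
  have h1 : ∀ t ≤ 1, g t = 1 := fun t ht =>
    Real.smoothTransition.one_of_one_le (by linarith)
  have h2 : ∀ t, 2 ≤ t → g t = 0 := fun t ht =>
    Real.smoothTransition.zero_of_nonpos (by linarith)
  have hc : Continuous (deriv g) := hgs.continuous_deriv (by simp)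
  obtain ⟨C, hC⟩ := isCompact_Icc.exists_bound_of_continuousOn (s := Icc (1 : ℝ) 2) hc.continuousOn
  refine ⟨g, C, hgs, fun t => ⟨Real.smoothTransition.nonneg _, Real.smoothTransition.le_one _⟩,
    h1, h2, fun t => ?_⟩
  have hC0 : 0 ≤ C := (norm_nonneg _).trans (hC 1 (by norm_num))
  by_cases ht : t ∈ Icc (1 : ℝ) 2
  · exact hC t ht
  · have : deriv g t = 0 := by
      rw [mem_Icc, not_and_or, not_le, not_le] at ht
      rcases ht with ht | ht
      · have : g =ᶠ[𝓝 t] fun _ => 1 := by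
          filter_upwards [eventually_lt_nhds ht] with s hs using h1 s hs.le
        rw [this.deriv_eq, deriv_const]
      · have : g =ᶠ[𝓝 t] fun _ => 0 := by
          filter_upwards [eventually_gt_nhds ht] with s hs using h2 s hs.le
        rw [this.deriv_eq, deriv_const]
    simpa [this] using hC0

/-- Testing the equation with a function whose gradient is controlled by that of `u`. -/
lemma integral_eq_zero_of_gradient_le {σ b : ℝ} (hσ : σ = 1 ∨ σ = -1) {u Y₁ Y₂ : ℝ × ℝ → ℝ}
    (hF : IsFlux u Y₁ Y₂) {Ω K : Set (ℝ × ℝ)} (hΩm : MeasurableSet Ω) (hΩ : Ω ⊆ halfPlane σ b)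
    (hK : IsCompact K)
    (hg : ∀ z ∈ K, GoodAt (halfPlane σ b) u Y₁ Y₂ z) {f : ℝ × ℝ → ℝ} (hfK : ∀ z ∉ K, f z = 0)
    (hfd : ∀ z ∈ Ω, DifferentiableAt ℝ f z)
    (hf0 : ∀ z ∈ halfPlane σ b, z ∉ Ω → f =ᶠ[𝓝 z] fun _ => 0)
    {C : ℝ} (hfb : ∀ z ∈ Ω, |f z| ≤ C)
    (hfx : ∀ z ∈ Ω, |dx f z| ≤ C * |dx u z| + C) (hfy : ∀ z ∈ Ω, |dy f z| ≤ C * |dy u z| + C) :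
    IntegrableOn (fun z => Y₁ z * dx f z + Y₂ z * dy f z) Ω ∧
      ∫ z in Ω, (Y₁ z * dx f z + Y₂ z * dy f z) = 0 := by
  set H := halfPlane σ b with hH
  have hHm : MeasurableSet H := measurableSet_halfPlane σ b
  rcases Ω.eq_empty_or_nonempty with rfl | ⟨z₀, hz₀⟩
  · simp
  have hC0 : 0 ≤ C := (abs_nonneg _).trans (hfb z₀ hz₀)
  have hder0 : ∀ z ∈ H, z ∉ Ω → fderiv ℝ f z = 0 := fun z hz hzΩ => by
    rw [(hf0 z hz hzΩ).fderiv_eq]; simp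
  have hderK : ∀ z ∉ K, fderiv ℝ f z = 0 := fun z hz =>
    fderiv_eq_zero_of_vanish_off hK.isClosed hfK hz
  have hE := integrableOn_energy_of_good hK hg
  have hfin : IsFiniteMeasure (volume.restrict (K ∩ H)) :=
    ⟨by simpa using (measure_mono inter_subset_left).trans_lt hK.measure_lt_top⟩
  have hmem : ∀ (p q : ℝ × ℝ → ℝ), Measurable p → MemLp q 2 (volume.restrict (K ∩ H)) →
      (∀ z ∈ Ω, |p z| ≤ C * |q z| + C) → (∀ z ∈ H, z ∉ Ω → p z = 0) → (∀ z ∉ K, p z = 0) →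
      MemLp p 2 (volume.restrict H) := by
    intro p q hp hq hpq hpΩ hpK
    have h1 : MemLp (fun z => C * |q z| + C) 2 (volume.restrict (K ∩ H)) :=
      (hq.abs.const_mul C).add (memLp_const C)
    have h2 : MemLp (K.indicator fun z => C * |q z| + C) 2 (volume.restrict H) := by
      rw [memLp_indicator_iff_restrict hK.isClosed.measurableSet,
        Measure.restrict_restrict hK.isClosed.measurableSet]
      exact h1
    refine h2.mono' hp.aestronglyMeasurable ?_
    filter_upwards [ae_restrict_mem hHm] with z hz
    have h0 : 0 ≤ C * |q z| + C := by positivity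
    by_cases hzK : z ∈ K
    · rw [indicator_of_mem hzK]
      by_cases hzΩ : z ∈ Ω
      · exact hpq z hzΩ
      · rw [hpΩ z hz hzΩ, norm_zero]; exact h0
    · rw [indicator_of_notMem hzK, hpK z hzK, norm_zero]
  have hmx : MemLp (dx f) 2 (volume.restrict H) :=
    hmem _ _ (measurable_dx f) (memLp_dx hE) hfx (fun z hz hzΩ => by simp [dx, hder0 z hz hzΩ])
      fun z hz => by simp [dx, hderK z hz]
  have hmy : MemLp (dy f) 2 (volume.restrict H) :=
    hmem _ _ (measurable_dy f) (memLp_dy hE) hfy (fun z hz hzΩ => by simp [dy, hder0 z hz hzΩ])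
      fun z hz => by simp [dy, hderK z hz]
  have hvan := integral_eq_zero_of_good hσ hF hK hg hfK
    (fun z hz => by
      by_cases hzΩ : z ∈ Ω
      · exact hfd z hzΩ
      · exact (differentiableAt_const (0 : ℝ)).congr_of_eventuallyEq (hf0 z hz hzΩ))
    ⟨C, fun z hz => by
      by_cases hzΩ : z ∈ Ω
      · exact hfb z hzΩ
      · rw [(hf0 z hz hzΩ).self_of_nhds, abs_zero]; exact hC0⟩ hmx hmy
  have hYm := hF.memLp hE
  have hiK : IntegrableOn (fun z => Y₁ z * dx f z + Y₂ z * dy f z) (K ∩ H) :=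
    (hYm.1.integrable_mul (hmx.mono_measure (Measure.restrict_mono inter_subset_right le_rfl))).add
      (hYm.2.integrable_mul (hmy.mono_measure (Measure.restrict_mono inter_subset_right le_rfl)))
  constructor
  · have h1 : IntegrableOn (fun z => Y₁ z * dx f z + Y₂ z * dy f z) K (volume.restrict Ω) := by
      rw [IntegrableOn, Measure.restrict_restrict hK.isClosed.measurableSet]
      exact hiK.mono_set (inter_subset_inter_right _ hΩ)
    refine (integrableOn_iff_integrable_of_support_subset ?_).1 h1
    intro z hz
    by_contra h
    exact hz (by simp [dx, dy, hderK z h])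
  · rw [← hvan]
    refine (setIntegral_eq_of_subset_of_forall_sdiff_eq_zero hHm hΩ ?_).symm
    intro z hz
    simp [dx, dy, hder0 z hz.1 hz.2]

lemma closure_strip {ψ : ℝ → ℝ} (hψ : Continuous ψ) {η₀ : ℝ} (hη₀ : 0 < η₀) :
    closure {z : ℝ × ℝ | ψ z.2 < z.1 ∧ 0 < z.2 ∧ z.2 < η₀} =
      {z | ψ z.2 ≤ z.1 ∧ 0 ≤ z.2 ∧ z.2 ≤ η₀} := by
  refine Subset.antisymm (closure_minimal (fun z hz => ⟨hz.1.le, hz.2.1.le, hz.2.2.le⟩) ?_) ?_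
  · have e : {z : ℝ × ℝ | ψ z.2 ≤ z.1 ∧ 0 ≤ z.2 ∧ z.2 ≤ η₀} =
        {z : ℝ × ℝ | ψ z.2 ≤ z.1} ∩ ({z | 0 ≤ z.2} ∩ {z | z.2 ≤ η₀}) := rfl
    rw [e]
    exact (isClosed_le (by fun_prop) (by fun_prop)).inter
      ((isClosed_le (by fun_prop) (by fun_prop)).inter (isClosed_le (by fun_prop) (by fun_prop)))
  · rintro ⟨x, y⟩ ⟨h1, h2, h3⟩
    simp only at h1 h2 h3
    set p : ℝ → ℝ × ℝ := fun t =>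
      (x + t + (ψ (y + t * (η₀ / 2 - y)) - ψ y), y + t * (η₀ / 2 - y)) with hp
    have hc : Continuous p := by fun_prop
    have ht : Tendsto p (𝓝[>] 0) (𝓝 (x, y)) := by
      have := hc.tendsto 0
      simp only [hp, zero_mul, add_zero, sub_self] at this
      exact this.mono_left nhdsWithin_le_nhds
    refine mem_closure_of_tendsto ht ?_
    filter_upwards [Ioo_mem_nhdsGT (show (0 : ℝ) < 1 by norm_num)] with t ht
    obtain ⟨ht0, ht1⟩ := ht
    refine ⟨?_, ?_, ?_⟩
    · simp only [hp]; linarith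
    · simp only [hp]; nlinarith
    · simp only [hp]; nlinarith

lemma exists_lipschitz_near {a : ℝ × ℝ → Fin 2 → Fin 2 → ℝ} {Q : Set (ℝ × ℝ)}
    (hacont : ∀ i j, ∀ K : Set (ℝ × ℝ), IsCompact K → K ⊆ Q → ContDiffOn ℝ 1 (fun z => a z i j) K)
    {σ b : ℝ} {W : Set (ℝ × ℝ)} (hW : IsOpen W) (hWQ : ∀ z ∈ W, 0 ≤ σ * (z.2 - b) → z ∈ Q)
    {p : ℝ × ℝ} (hp : p ∈ W) (hpb : 0 ≤ σ * (p.2 - b)) :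
    ∃ r > 0, ∃ L, 0 ≤ L ∧ ∀ z ∈ ball p r, ∀ w ∈ ball p r,
      0 ≤ σ * (z.2 - b) → 0 ≤ σ * (w.2 - b) → ∀ i j, |a z i j - a w i j| ≤ L * dist z w := by
  obtain ⟨ρ, hρ, hρW⟩ := Metric.nhds_basis_closedBall.mem_iff.1 (hW.mem_nhds hp)
  set T : Set (ℝ × ℝ) := {z | 0 ≤ σ * (z.2 - b)} with hT
  have hTc : IsClosed T := isClosed_le (by fun_prop) (by fun_prop)
  have hTconv : Convex ℝ T := by
    intro z hz w hw s t hs ht hst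
    simp only [hT, mem_ofPred_eq, Prod.snd_add, Prod.smul_snd, smul_eq_mul] at hz hw ⊢
    have : σ * (s * z.2 + t * w.2 - b) = s * (σ * (z.2 - b)) + t * (σ * (w.2 - b)) := by
      have : t = 1 - s := by linarith
      rw [this]; ring
    rw [this]; positivity
  set C := closedBall p ρ ∩ T with hC
  have hCcomp : IsCompact C := (isCompact_closedBall p ρ).inter_right hTc
  have hCconv : Convex ℝ C := (convex_closedBall p ρ).inter hTconv
  have hpC : p ∈ C := ⟨mem_closedBall_self hρ.le, hpb⟩
  have hlip := fun i j => (hacont i j C hCcomp fun z hz => hWQ z (hρW hz.1) hz.2).contDiffWithinAt hpC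
    |>.exists_lipschitzOnWith hCconv
  choose k t ht hk using hlip
  have htt : (⋂ i, ⋂ j, t i j) ∈ 𝓝[C] p := by simpa [iInter_mem] using ht
  obtain ⟨ε, hε, hεt⟩ := Metric.mem_nhdsWithin_iff.1 htt
  refine ⟨min ε ρ, lt_min hε hρ, ∑ i, ∑ j, (k i j : ℝ), by positivity, ?_⟩
  have hmem : ∀ z ∈ ball p (min ε ρ), 0 ≤ σ * (z.2 - b) → ∀ i j, z ∈ t i j := by
    intro z hz hzT i j
    have h1 := hεt ⟨ball_subset_ball (min_le_left _ _) hz,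
      ball_subset_closedBall (ball_subset_ball (min_le_right _ _) hz), hzT⟩
    exact mem_iInter.1 (mem_iInter.1 h1 i) j
  intro z hz w hw hzT hwT i j
  have h1 := (hk i j).dist_le_mul z (hmem z hz hzT i j) w (hmem w hw hwT i j)
  rw [Real.dist_eq] at h1
  refine h1.trans (mul_le_mul_of_nonneg_right ?_ dist_nonneg)
  exact (Finset.single_le_sum (f := fun j => (k i j : ℝ)) (fun _ _ => NNReal.coe_nonneg _)
    (Finset.mem_univ j)).trans (Finset.single_le_sum (f := fun i => ∑ j, (k i j : ℝ))
      (fun _ _ => by positivity) (Finset.mem_univ i))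

/-- All points of a domain that coincides with a half-plane inside `W` are good. -/
lemma goodAt_of_domain {σ b : ℝ} (hσ : σ = 1 ∨ σ = -1) {a : ℝ × ℝ → Fin 2 → Fin 2 → ℝ}
    (ham : ∀ i j, Measurable fun z => a z i j) {Λ : ℝ} (hΛ : ∀ z i j, |a z i j| ≤ Λ)
    {u Y₁ Y₂ : ℝ × ℝ → ℝ} (hF : IsFlux u Y₁ Y₂)
    (hY₁ : ∀ z, Y₁ z = a z 0 0 * dx u z + a z 0 1 * dy u z)
    (hY₂ : ∀ z, Y₂ z = a z 1 0 * dx u z + a z 1 1 * dy u z)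
    {Ω W : Set (ℝ × ℝ)} (hW : IsOpen W) (hWΩ : W ∩ halfPlane σ b = Ω) (hΩ : Ω ⊆ halfPlane σ b)
    (hWQ : ∀ z ∈ W, 0 ≤ σ * (z.2 - b) → z ∈ closure Ω)
    (hacont : ∀ i j, ∀ K : Set (ℝ × ℝ), IsCompact K → K ⊆ closure Ω →
      ContDiffOn ℝ 1 (fun z => a z i j) K)
    {lam : ℝ} (hlam : 0 < lam)
    (hell : ∀ z ∈ Ω, lam * energy u z ≤ Y₁ z * dx u z + Y₂ z * dy u z)
    (hu : ∀ z ∈ closure Ω, DifferentiableAt ℝ u z) (hweak : WeakZero Ω Y₁ Y₂ Ω)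
    (hNeu : ∀ s, (s, b) ∈ W → a (s, b) 1 0 * dx u (s, b) + a (s, b) 1 1 * dy u (s, b) = 0) :
    ∀ z ∈ W, GoodAt (halfPlane σ b) u Y₁ Y₂ z := by
  refine goodAt_of_weakZero hσ ham hΛ hF hY₁ hY₂ hW hlam (by rw [hWΩ]; exact hell)
    (fun z hz hzb => hu z (hWQ z hz hzb)) ?_
    (fun s hs => exists_lipschitz_near hacont hW hWQ hs (by simp)) hNeu
  rw [hWΩ]
  intro φ h1 h2 h3
  rw [← hweak φ h1 h2 h3]
  refine setIntegral_eq_of_subset_of_forall_sdiff_eq_zero (measurableSet_halfPlane σ b) hΩ ?_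
  intro z hz
  simp [dx, dy, fderiv_eq_zero_of_notMem_tsupport fun h => hz.2 (h3 h)]

lemma measurable_indicator_of_contDiffOn {f : ℝ × ℝ → ℝ} {Q : Set (ℝ × ℝ)} (hQ : IsClosed Q)
    (hf : ∀ K : Set (ℝ × ℝ), IsCompact K → K ⊆ Q → ContDiffOn ℝ 1 f K) :
    Measurable (Q.indicator f) := by
  classical
  have hc : ContinuousOn f Q := by
    intro z hz
    have hK := hf (closedBall z 1 ∩ Q) ((isCompact_closedBall z 1).inter_right hQ) inter_subset_right
    have h1 := hK.continuousOn z ⟨mem_closedBall_self zero_le_one, hz⟩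
    exact (continuousWithinAt_inter' (mem_nhdsWithin_of_mem_nhds
      (closedBall_mem_nhds z one_pos))).1 (by rwa [inter_comm] at h1)
  have := hc.measurable_piecewise (continuousOn_const (c := (0 : ℝ))) hQ.measurableSet
  rw [← piecewise_eq_indicator]
  exact this

lemma hasFDerivAt_max_zero_sq_mul {u c : ℝ × ℝ → ℝ} {k : ℝ} {z : ℝ × ℝ}
    (hu : DifferentiableAt ℝ u z) (hc : DifferentiableAt ℝ c z) :
    HasFDerivAt (fun z => max (u z - k) 0 ^ 2 * c z)
      (max (u z - k) 0 ^ 2 • fderiv ℝ c z + c z • ((2 * max (u z - k) 0) • fderiv ℝ u z)) z := by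
  have h := HasDerivAt.comp_hasFDerivAt (f := fun z => u z - k) z
    (hasDerivAt_max_zero_sq (u z - k)) (hu.hasFDerivAt.sub_const k)
  exact h.mul hc.hasFDerivAt

/-- Testing the equation on a domain with `max (u - k) 0 ^ 2 * c`. -/
lemma integral_max_sq_mul_eq_zero {σ b : ℝ} (hσ : σ = 1 ∨ σ = -1) {u Y₁ Y₂ : ℝ × ℝ → ℝ}
    (hF : IsFlux u Y₁ Y₂) {Ω K : Set (ℝ × ℝ)} (hΩo : IsOpen Ω) (hΩ : Ω ⊆ halfPlane σ b)
    (hK : IsCompact K) (hg : ∀ z ∈ K, GoodAt (halfPlane σ b) u Y₁ Y₂ z)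
    (hu : ∀ z ∈ Ω, DifferentiableAt ℝ u z) {k W : ℝ} (hW : ∀ z ∈ Ω, max (u z - k) 0 ≤ W)
    {c : ℝ × ℝ → ℝ} (hc : Differentiable ℝ c) {A : ℝ}
    (hcA : ∀ z, |c z| ≤ A ∧ |dx c z| ≤ A ∧ |dy c z| ≤ A)
    (hcK : ∀ z ∈ Ω, z ∉ K → u z ≤ k ∨ c z = 0)
    (hc0 : ∀ z ∈ halfPlane σ b, z ∉ Ω → ∀ᶠ x in 𝓝 z, x ∈ Ω → u x ≤ k ∨ c x = 0) :
    IntegrableOn (fun z =>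
      Y₁ z * (max (u z - k) 0 ^ 2 * dx c z + c z * (2 * max (u z - k) 0 * dx u z)) +
      Y₂ z * (max (u z - k) 0 ^ 2 * dy c z + c z * (2 * max (u z - k) 0 * dy u z))) Ω ∧
    ∫ z in Ω, (
      Y₁ z * (max (u z - k) 0 ^ 2 * dx c z + c z * (2 * max (u z - k) 0 * dx u z)) +
      Y₂ z * (max (u z - k) 0 ^ 2 * dy c z + c z * (2 * max (u z - k) 0 * dy u z))) = 0 := by
  set f : ℝ × ℝ → ℝ := Ω.indicator fun z => max (u z - k) 0 ^ 2 * c z with hf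
  have hzero : ∀ z, (u z ≤ k ∨ c z = 0) → max (u z - k) 0 ^ 2 * c z = 0 := by
    rintro z (h | h)
    · rw [max_eq_right (by linarith)]; ring
    · rw [h, mul_zero]
  have hfe : ∀ z ∈ Ω, f =ᶠ[𝓝 z] fun z => max (u z - k) 0 ^ 2 * c z := fun z hz => by
    filter_upwards [hΩo.mem_nhds hz] with x hx using indicator_of_mem hx _
  have hder : ∀ z ∈ Ω, HasFDerivAt f _ z := fun z hz =>
    (hasFDerivAt_max_zero_sq_mul (k := k) (hu z hz) (hc z)).congr_of_eventuallyEq (hfe z hz)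
  have hdx : ∀ z ∈ Ω, dx f z =
      max (u z - k) 0 ^ 2 * dx c z + c z * (2 * max (u z - k) 0 * dx u z) := fun z hz => by
    simp only [dx, (hder z hz).fderiv]
    simp
  have hdy : ∀ z ∈ Ω, dy f z =
      max (u z - k) 0 ^ 2 * dy c z + c z * (2 * max (u z - k) 0 * dy u z) := fun z hz => by
    simp only [dy, (hder z hz).fderiv]
    simp
  rcases Ω.eq_empty_or_nonempty with hE | ⟨z₀, hz₀⟩
  · simp [hE]
  have hA0 : 0 ≤ A := (abs_nonneg _).trans (hcA z₀).1
  have hW0 : 0 ≤ W := (le_max_right _ _).trans (hW z₀ hz₀)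
  have hbd : ∀ z ∈ Ω, ∀ p q : ℝ, |p| ≤ A →
      |max (u z - k) 0 ^ 2 * p + c z * (2 * max (u z - k) 0 * q)| ≤
        (W ^ 2 * A + A * (2 * W)) * |q| + (W ^ 2 * A + A * (2 * W)) := by
    intro z hz p q hp
    have hw0 : 0 ≤ max (u z - k) 0 := le_max_right _ _
    have hw := hW z hz
    refine (abs_add_le _ _).trans ?_
    rw [abs_mul, abs_mul (c z), abs_mul, abs_of_nonneg (pow_nonneg hw0 2),
      abs_of_nonneg (show 0 ≤ 2 * max (u z - k) 0 by positivity)]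
    have h1 : max (u z - k) 0 ^ 2 * |p| ≤ W ^ 2 * A := by gcongr
    have h2 : |c z| * (2 * max (u z - k) 0 * |q|) ≤ A * (2 * W * |q|) := by
      gcongr
      exact (hcA z).1
    have h3 : 0 ≤ W ^ 2 * A * |q| := by positivity
    have h4 : 0 ≤ A * (2 * W) := by positivity
    nlinarith
  have key := integral_eq_zero_of_gradient_le (f := f) (C := W ^ 2 * A + A * (2 * W)) hσ hF
    hΩo.measurableSet hΩ hK hg
    (fun z hz => by
      by_cases hzΩ : z ∈ Ω
      · rw [hf, indicator_of_mem hzΩ, hzero z (hcK z hzΩ hz)]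
      · rw [hf, indicator_of_notMem hzΩ])
    (fun z hz => (hder z hz).differentiableAt)
    (fun z hz hzΩ => by
      filter_upwards [hc0 z hz hzΩ] with x hx
      by_cases hxΩ : x ∈ Ω
      · rw [hf, indicator_of_mem hxΩ, hzero x (hx hxΩ)]
      · rw [hf, indicator_of_notMem hxΩ])
    (fun z hz => by
      have hw0 : 0 ≤ max (u z - k) 0 := le_max_right _ _
      rw [hf, indicator_of_mem hz, abs_mul, abs_of_nonneg (pow_nonneg hw0 2)]
      have h1 : max (u z - k) 0 ^ 2 * |c z| ≤ W ^ 2 * A := by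
        gcongr
        · exact hW z hz
        · exact (hcA z).1
      have h4 : 0 ≤ A * (2 * W) := by positivity
      linarith)
    (fun z hz => by rw [hdx z hz]; exact hbd z hz _ _ (hcA z).2.1)
    (fun z hz => by rw [hdy z hz]; exact hbd z hz _ _ (hcA z).2.2)
  have hcong : EqOn (fun z => Y₁ z * dx f z + Y₂ z * dy f z) (fun z =>
      Y₁ z * (max (u z - k) 0 ^ 2 * dx c z + c z * (2 * max (u z - k) 0 * dx u z)) +
      Y₂ z * (max (u z - k) 0 ^ 2 * dy c z + c z * (2 * max (u z - k) 0 * dy u z))) Ω :=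
    fun z hz => by simp only [hdx z hz, hdy z hz]
  exact ⟨(integrableOn_congr_fun hcong hΩo.measurableSet).1 key.1,
    (setIntegral_congr_fun hΩo.measurableSet hcong).symm.trans key.2⟩

/-- Caccioppoli inequality in a domain covered by two half-planes. -/
lemma caccioppoli_of_cover {u Y₁ Y₂ : ℝ × ℝ → ℝ}
    {CF : ℝ} (hCF : ∀ z, |Y₁ z| ≤ CF * (|dx u z| + |dy u z|)) {Ω : Set (ℝ × ℝ)}
    (hΩo : IsOpen Ω)
    {lam : ℝ} (hlam : 0 < lam)
    (hell : ∀ z ∈ Ω, lam * energy u z ≤ Y₁ z * dx u z + Y₂ z * dy u z)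
    (hu : ∀ z ∈ Ω, DifferentiableAt ℝ u z) {k W : ℝ} (hW : ∀ z ∈ Ω, max (u z - k) 0 ≤ W)
    {χ κ : ℝ → ℝ} (hχ : ContDiff ℝ (⊤ : ℕ∞) χ) (hκ : ContDiff ℝ (⊤ : ℕ∞) κ)
    {c : Fin 2 → ℝ × ℝ → ℝ} (hc0 : ∀ z, c 0 z = χ z.1 ^ 2 * κ z.2)
    (hc1 : ∀ z, c 1 z = χ z.1 ^ 2 * (1 - κ z.2))
    (hI : ∀ i, IntegrableOn (fun z =>
      Y₁ z * (max (u z - k) 0 ^ 2 * dx (c i) z + c i z * (2 * max (u z - k) 0 * dx u z)) +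
      Y₂ z * (max (u z - k) 0 ^ 2 * dy (c i) z + c i z * (2 * max (u z - k) 0 * dy u z))) Ω ∧
    ∫ z in Ω, (
      Y₁ z * (max (u z - k) 0 ^ 2 * dx (c i) z + c i z * (2 * max (u z - k) 0 * dx u z)) +
      Y₂ z * (max (u z - k) 0 ^ 2 * dy (c i) z + c i z * (2 * max (u z - k) 0 * dy u z))) = 0)
    {G : ℝ → ℝ} (hG : IntegrableOn (fun z : ℝ × ℝ => G z.1) Ω)
    (hχG : ∀ x, deriv χ x ^ 2 ≤ G x) :
    IntegrableOn (fun z => max (u z - k) 0 * χ z.1 ^ 2 * energy u z) Ω ∧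
      lam * ∫ z in Ω, max (u z - k) 0 * χ z.1 ^ 2 * energy u z ≤
        2 * CF ^ 2 / lam * W ^ 3 * ∫ z in Ω, G z.1 := by
  have hder : ∀ z : ℝ × ℝ, dx (c 0) z = 2 * χ z.1 * deriv χ z.1 * κ z.2 ∧
      dy (c 0) z = χ z.1 ^ 2 * deriv κ z.2 ∧
      dx (c 1) z = 2 * χ z.1 * deriv χ z.1 * (1 - κ z.2) ∧
      dy (c 1) z = χ z.1 ^ 2 * -deriv κ z.2 := by
    intro z
    have h1 : HasDerivAt (fun x => χ x ^ 2) (2 * χ z.1 * deriv χ z.1) z.1 := by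
      have := ((hχ.differentiable (by simp)) z.1).hasDerivAt.pow 2
      simp only [Nat.cast_ofNat, Nat.add_one_sub_one, pow_one] at this
      exact this
    have h2 := ((hκ.differentiable (by simp)) z.2).hasDerivAt
    have h3 := hasFDerivAt_mul_prod h1 h2
    have h4 := hasFDerivAt_mul_prod h1 (h2.const_sub 1)
    rw [show c 0 = fun z => χ z.1 ^ 2 * κ z.2 from funext hc0,
      show c 1 = fun z => χ z.1 ^ 2 * (1 - κ z.2) from funext hc1]
    exact ⟨h3.1, h3.2, h4.1, h4.2⟩
  have huc : ContinuousOn u Ω := fun z hz => (hu z hz).continuousAt.continuousWithinAt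
  have hwm : AEStronglyMeasurable (fun z => max (u z - k) 0) (volume.restrict Ω) :=
    ContinuousOn.aestronglyMeasurable
      ((huc.sub continuousOn_const).sup continuousOn_const) hΩo.measurableSet
  have hχc : Continuous χ := hχ.continuous
  have hpt : ∀ z ∈ Ω, lam * (max (u z - k) 0 * χ z.1 ^ 2 * energy u z) ≤
      ((Y₁ z * (max (u z - k) 0 ^ 2 * dx (c 0) z + c 0 z * (2 * max (u z - k) 0 * dx u z)) +
      Y₂ z * (max (u z - k) 0 ^ 2 * dy (c 0) z + c 0 z * (2 * max (u z - k) 0 * dy u z))) +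
      (Y₁ z * (max (u z - k) 0 ^ 2 * dx (c 1) z + c 1 z * (2 * max (u z - k) 0 * dx u z)) +
      Y₂ z * (max (u z - k) 0 ^ 2 * dy (c 1) z + c 1 z * (2 * max (u z - k) 0 * dy u z)))) +
      2 * CF ^ 2 / lam * W ^ 3 * G z.1 := by
    intro z hz
    obtain ⟨d1, d2, d3, d4⟩ := hder z
    rw [d1, d2, d3, d4, hc0, hc1]
    have hw0 : 0 ≤ max (u z - k) 0 := le_max_right _ _
    have hwW := hW z hz
    have hE := hell z hz
    have hY := hCF z
    have hGz := hχG z.1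
    simp only [energy] at hE ⊢
    generalize max (u z - k) 0 = w at *
    generalize χ z.1 = X at *
    generalize deriv χ z.1 = X' at *
    generalize κ z.2 = q at *
    generalize deriv κ z.2 = q' at *
    generalize dx u z = p₁ at *
    generalize dy u z = p₂ at *
    generalize Y₁ z = y₁ at *
    generalize Y₂ z = y₂ at *
    have e : (y₁ * (w ^ 2 * (2 * X * X' * q) + X ^ 2 * q * (2 * w * p₁)) +
        y₂ * (w ^ 2 * (X ^ 2 * q') + X ^ 2 * q * (2 * w * p₂))) +
        (y₁ * (w ^ 2 * (2 * X * X' * (1 - q)) + X ^ 2 * (1 - q) * (2 * w * p₁)) +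
        y₂ * (w ^ 2 * (X ^ 2 * -q') + X ^ 2 * (1 - q) * (2 * w * p₂))) =
        2 * w * X ^ 2 * (y₁ * p₁ + y₂ * p₂) + 2 * w ^ 2 * X * X' * y₁ := by ring
    rw [e]
    have hs : (|p₁| + |p₂|) ^ 2 ≤ 2 * (p₁ ^ 2 + p₂ ^ 2) := by
      have h1 := sq_abs p₁
      have h2 := sq_abs p₂
      nlinarith [sq_nonneg (|p₁| - |p₂|)]
    have hy2 : y₁ ^ 2 ≤ CF ^ 2 * (2 * (p₁ ^ 2 + p₂ ^ 2)) := by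
      calc y₁ ^ 2 = |y₁| ^ 2 := (sq_abs _).symm
        _ ≤ (CF * (|p₁| + |p₂|)) ^ 2 := pow_le_pow_left₀ (abs_nonneg _) hY 2
        _ = CF ^ 2 * (|p₁| + |p₂|) ^ 2 := by ring
        _ ≤ _ := by gcongr
    have hE2 : 2 * w * X ^ 2 * (lam * (p₁ ^ 2 + p₂ ^ 2)) ≤
        2 * w * X ^ 2 * (y₁ * p₁ + y₂ * p₂) := by gcongr
    have hcross : 0 ≤ 2 * w ^ 2 * X * X' * y₁ + lam * (w * X ^ 2 * (p₁ ^ 2 + p₂ ^ 2)) +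
        2 * CF ^ 2 / lam * w ^ 3 * X' ^ 2 := by
      rcases eq_or_ne CF 0 with hCF0 | hCF0
      · have : y₁ = 0 := by
          have : y₁ ^ 2 ≤ 0 := by simpa [hCF0] using hy2
          exact pow_eq_zero_iff two_ne_zero |>.1 (le_antisymm this (sq_nonneg _))
        rw [this]
        have : 0 ≤ lam * (w * X ^ 2 * (p₁ ^ 2 + p₂ ^ 2)) := by positivity
        have : 0 ≤ 2 * CF ^ 2 / lam * w ^ 3 * X' ^ 2 := by positivity
        linarith
      · have hC2 : 0 < CF ^ 2 := by positivity
        have h1 : lam * (w * X ^ 2) * (y₁ ^ 2 / (2 * CF ^ 2)) ≤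
            lam * (w * X ^ 2) * (p₁ ^ 2 + p₂ ^ 2) := by
          gcongr
          rw [div_le_iff₀ (by positivity)]
          linarith
        have h2 : 2 * w ^ 2 * X * X' * y₁ + lam * (w * X ^ 2) * (y₁ ^ 2 / (2 * CF ^ 2)) +
            2 * CF ^ 2 / lam * w ^ 3 * X' ^ 2 =
            w * lam / (2 * CF ^ 2) * (X * y₁ + 2 * CF ^ 2 / lam * w * X') ^ 2 := by
          field_simp
          ring
        have h3 : 0 ≤ w * lam / (2 * CF ^ 2) * (X * y₁ + 2 * CF ^ 2 / lam * w * X') ^ 2 := by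
          positivity
        nlinarith
    have hlast : 2 * CF ^ 2 / lam * w ^ 3 * X' ^ 2 ≤ 2 * CF ^ 2 / lam * W ^ 3 * G z.1 := by
      have hW0 : 0 ≤ W := hw0.trans hwW
      gcongr
    nlinarith
  have hIntR := ((hI 0).1.add (hI 1).1).add (hG.const_mul (2 * CF ^ 2 / lam * W ^ 3))
  have hL : IntegrableOn (fun z => lam * (max (u z - k) 0 * χ z.1 ^ 2 * energy u z)) Ω := by
    refine Integrable.mono' hIntR ?_ ?_
    · refine (AEStronglyMeasurable.mul (hwm.mul ?_) ?_).const_mul lam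
      · exact ((hχc.comp continuous_fst).pow 2).aestronglyMeasurable
      · exact (measurable_energy u).aestronglyMeasurable
    · filter_upwards [ae_restrict_mem hΩo.measurableSet] with z hz
      rw [Real.norm_eq_abs, abs_of_nonneg]
      · exact hpt z hz
      · have := energy_nonneg u z
        have hw0 : 0 ≤ max (u z - k) 0 := le_max_right _ _
        positivity
  refine ⟨?_, ?_⟩
  · have := hL.const_mul lam⁻¹
    refine this.congr (Eventually.of_forall fun z => ?_)
    simp only
    rw [inv_mul_cancel_left₀ hlam.ne']
  · rw [← integral_const_mul, ← integral_const_mul]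
    refine (setIntegral_mono_on hL hIntR hΩo.measurableSet hpt).trans_eq ?_
    have e1 := integral_add ((hI 0).1.add (hI 1).1) (hG.const_mul (2 * CF ^ 2 / lam * W ^ 3))
    have e2 := integral_add (hI 0).1 (hI 1).1
    simp only [Pi.add_apply] at e1 e2 ⊢
    rw [e1, e2, (hI 0).2, (hI 1).2]
    ring

lemma isCompact_superlevel {ψ : ℝ → ℝ} (hψ : Continuous ψ) {u : ℝ × ℝ → ℝ} {R α β k : ℝ}
    (hu : ∀ z : ℝ × ℝ, ψ z.2 ≤ z.1 → α ≤ z.2 → z.2 ≤ β → ContinuousAt u z) :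
    IsCompact {z : ℝ × ℝ | (ψ z.2 ≤ z.1 ∧ z.1 ≤ R ∧ α ≤ z.2 ∧ z.2 ≤ β) ∧ k ≤ u z} := by
  obtain ⟨m, hm⟩ := (isCompact_Icc.image hψ : IsCompact (image ψ (Icc α β))).bddBelow
  set P : Set (ℝ × ℝ) := {z : ℝ × ℝ | ψ z.2 ≤ z.1 ∧ z.1 ≤ R ∧ α ≤ z.2 ∧ z.2 ≤ β} with hP
  have hPc : IsCompact P := by
    have hcl : IsClosed P := by
      have e : P = {z : ℝ × ℝ | ψ z.2 ≤ z.1} ∩ (Iic R ×ˢ Icc α β) := by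
        ext z; simp [hP]
      rw [e]
      exact (isClosed_le (by fun_prop) (by fun_prop)).inter (isClosed_Iic.prod isClosed_Icc)
    refine IsCompact.of_isClosed_subset (isCompact_Icc.prod isCompact_Icc :
      IsCompact (Icc m R ×ˢ Icc α β)) hcl ?_
    intro z hz
    exact ⟨⟨(hm ⟨z.2, hz.2.2, rfl⟩).trans hz.1, hz.2.1⟩, hz.2.2⟩
  have huP : ContinuousOn u P := fun z hz => (hu z hz.1 hz.2.2.1 hz.2.2.2).continuousWithinAt
  exact hPc.of_isClosed_subset (huP.preimage_isClosed_of_isClosed hPc.isClosed isClosed_Ici)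
    fun z hz => hz.1

lemma isOpen_strip {ψ : ℝ → ℝ} (hψ : Continuous ψ) (η₀ : ℝ) :
    IsOpen {z : ℝ × ℝ | ψ z.2 < z.1 ∧ 0 < z.2 ∧ z.2 < η₀} := by
  have e : {z : ℝ × ℝ | ψ z.2 < z.1 ∧ 0 < z.2 ∧ z.2 < η₀} =
      {z : ℝ × ℝ | ψ z.2 < z.1} ∩ ({z | 0 < z.2} ∩ {z | z.2 < η₀}) := rfl
  rw [e]
  exact (isOpen_lt (by fun_prop) (by fun_prop)).inter
    ((isOpen_lt (by fun_prop) (by fun_prop)).inter (isOpen_lt (by fun_prop) (by fun_prop)))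

lemma abs_cutoff_le {f g : ℝ → ℝ} {f' g' B D : ℝ} {z : ℝ × ℝ} (hf : HasDerivAt f f' z.1)
    (hg : HasDerivAt g g' z.2) (hf1 : |f z.1| ≤ 1) (hg1 : |g z.2| ≤ 1) (hf' : |f'| ≤ B)
    (hg' : |g'| ≤ D) :
    |f z.1 ^ 2 * g z.2| ≤ 1 + 2 * B + D ∧ |dx (fun z => f z.1 ^ 2 * g z.2) z| ≤ 1 + 2 * B + D ∧
      |dy (fun z => f z.1 ^ 2 * g z.2) z| ≤ 1 + 2 * B + D := by
  have hB : 0 ≤ B := (abs_nonneg _).trans hf'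
  have hD : 0 ≤ D := (abs_nonneg _).trans hg'
  have h1 : HasDerivAt (fun x => f x ^ 2) (2 * f z.1 * f') z.1 := by
    have := hf.pow 2
    simp only [Nat.cast_ofNat, Nat.add_one_sub_one, pow_one] at this
    exact this
  have h2 := hasFDerivAt_mul_prod h1 hg
  rw [h2.1, h2.2, abs_mul, abs_mul, abs_mul, abs_mul, abs_mul, abs_pow, abs_two]
  have h3 : |f z.1| ^ 2 ≤ 1 := pow_le_one₀ (abs_nonneg _) hf1
  refine ⟨?_, ?_, ?_⟩
  · have : |f z.1| ^ 2 * |g z.2| ≤ 1 * 1 := by gcongr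
    linarith
  · have : 2 * |f z.1| * |f'| * |g z.2| ≤ 2 * 1 * B * 1 := by gcongr
    linarith
  · have : |f z.1| ^ 2 * |g'| ≤ 1 * D := by gcongr
    linarith

/-- The weighted energy in the strip, cut off at distance `R`, decays. -/
lemma strip_energy_le {ψ : ℝ → ℝ} (hψ : Continuous ψ) {η₀ : ℝ} (hη₀ : 0 < η₀) {Ω : Set (ℝ × ℝ)}
    (hΩ : Ω = {z : ℝ × ℝ | ψ z.2 < z.1 ∧ 0 < z.2 ∧ z.2 < η₀})
    {u Y₁ Y₂ : ℝ × ℝ → ℝ} (hF : IsFlux u Y₁ Y₂)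
    {CF : ℝ} (hCF : ∀ z, |Y₁ z| ≤ CF * (|dx u z| + |dy u z|))
    {lam : ℝ} (hlam : 0 < lam)
    (hell : ∀ z ∈ Ω, lam * energy u z ≤ Y₁ z * dx u z + Y₂ z * dy u z)
    (hu : ∀ z : ℝ × ℝ, ψ z.2 ≤ z.1 → 0 ≤ z.2 → z.2 ≤ η₀ → DifferentiableAt ℝ u z)
    (hbot : ∀ z : ℝ × ℝ, ψ z.2 < z.1 → z.2 < η₀ → GoodAt (halfPlane 1 0) u Y₁ Y₂ z)
    (htop : ∀ z : ℝ × ℝ, ψ z.2 < z.1 → 0 < z.2 → GoodAt (halfPlane (-1) η₀) u Y₁ Y₂ z)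
    {k W : ℝ} (hk : ∀ y ∈ Icc 0 η₀, u (ψ y, y) < k) (hW : ∀ z ∈ Ω, max (u z - k) 0 ≤ W)
    {g : ℝ → ℝ} {Cg : ℝ} (hg : ContDiff ℝ (⊤ : ℕ∞) g) (hg01 : ∀ t, 0 ≤ g t ∧ g t ≤ 1)
    (hg1 : ∀ t ≤ 1, g t = 1) (hg2 : ∀ t, 2 ≤ t → g t = 0) (hgC : ∀ t, |deriv g t| ≤ Cg)
    {R : ℝ} (hR : 0 < R) :
    IntegrableOn (fun z => max (u z - k) 0 * g (z.1 / R) ^ 2 * energy u z) Ω ∧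
      ∫ z in Ω, max (u z - k) 0 * g (z.1 / R) ^ 2 * energy u z ≤
        (2 * CF ^ 2 / lam * W ^ 3 * (Cg ^ 2 * η₀) / lam) / R := by
  have hΩo : IsOpen Ω := hΩ ▸ isOpen_strip hψ η₀
  have hgd : ∀ t, HasDerivAt g (deriv g t) t := fun t =>
    (hg.differentiable (by simp) t).hasDerivAt
  have hCg : 0 ≤ Cg := (abs_nonneg _).trans (hgC 0)
  set χ : ℝ → ℝ := fun x => g (x / R) with hχ
  set κ : ℝ → ℝ := fun y => g (3 * y / η₀) with hκ
  have hχs : ContDiff ℝ (⊤ : ℕ∞) χ := hg.comp (contDiff_id.div_const R)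
  have hκs : ContDiff ℝ (⊤ : ℕ∞) κ :=
    hg.comp ((contDiff_const.mul contDiff_id).div_const η₀)
  have hχd : ∀ x, HasDerivAt χ (deriv g (x / R) * (1 / R)) x := fun x =>
    (hgd (x / R)).comp x ((hasDerivAt_id x).div_const R)
  have hκd : ∀ y, HasDerivAt κ (deriv g (3 * y / η₀) * (3 * 1 / η₀)) y := fun y =>
    (hgd (3 * y / η₀)).comp y (((hasDerivAt_id y).const_mul 3).div_const η₀)
  have hχb : ∀ x, |deriv g (x / R) * (1 / R)| ≤ Cg / R := fun x => by
    rw [abs_mul, abs_of_pos (show 0 < 1 / R by positivity), div_eq_mul_one_div Cg]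
    gcongr
    exact hgC _
  have hκb : ∀ y, |deriv g (3 * y / η₀) * (3 * 1 / η₀)| ≤ Cg * (3 * 1 / η₀) := fun y => by
    rw [abs_mul, abs_of_pos (show 0 < 3 * 1 / η₀ by positivity)]
    gcongr
    exact hgC _
  have hab : ∀ t, |g t| ≤ 1 := fun t => abs_le.2 ⟨by linarith [(hg01 t).1], (hg01 t).2⟩
  have hab' : ∀ t, |1 - g t| ≤ 1 := fun t =>
    abs_le.2 ⟨by linarith [(hg01 t).2], by linarith [(hg01 t).1]⟩
  have huΩ : ∀ z ∈ Ω, DifferentiableAt ℝ u z := fun z hz => by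
    rw [hΩ] at hz; exact hu z hz.1.le hz.2.1.le hz.2.2.le
  set c : Fin 2 → ℝ × ℝ → ℝ :=
    ![fun z => χ z.1 ^ 2 * κ z.2, fun z => χ z.1 ^ 2 * (1 - κ z.2)] with hc
  have hc0 : ∀ z, c 0 z = χ z.1 ^ 2 * κ z.2 := fun z => rfl
  have hc1 : ∀ z, c 1 z = χ z.1 ^ 2 * (1 - κ z.2) := fun z => rfl
  have hχdf : Differentiable ℝ χ := fun x => (hχd x).differentiableAt
  have hκdf : Differentiable ℝ κ := fun x => (hκd x).differentiableAt
  have hκ0 : ∀ y, 2 * η₀ / 3 < y → κ y = 0 := fun y hy => hg2 _ (by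
    rw [le_div_iff₀ hη₀]; linarith)
  have hκ1 : ∀ y, y < η₀ / 3 → κ y = 1 := fun y hy => hg1 _ (by
    rw [div_le_iff₀ hη₀]; linarith)
  have hχ0 : ∀ x, 2 * R < x → χ x = 0 := fun x hx => hg2 _ (by
    rw [le_div_iff₀ hR]; linarith)
  have hK := fun α β (hα : 0 ≤ α) (hβ : β ≤ η₀) =>
    isCompact_superlevel (R := 2 * R) (α := α) (β := β) (k := k) hψ fun z h1 h2 h3 =>
      (hu z h1 (hα.trans h2) (h3.trans hβ)).continuousAt
  have hside : ∀ z : ℝ × ℝ, 0 ≤ z.2 → z.2 ≤ η₀ → z.1 ≤ ψ z.2 → ∀ᶠ x in 𝓝 z, x ∈ Ω → u x ≤ k := by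
    intro z h1 h2 h3
    rcases h3.lt_or_eq with h3 | h3
    · have : ∀ᶠ x : ℝ × ℝ in 𝓝 z, x.1 < ψ x.2 :=
        (isOpen_lt continuous_fst (hψ.comp continuous_snd)).mem_nhds h3
      filter_upwards [this] with x hx hxΩ
      rw [hΩ] at hxΩ
      exact absurd hxΩ.1 (not_lt.2 hx.le)
    · have h4 : u z < k := by
        have := hk z.2 ⟨h1, h2⟩
        rwa [← h3] at this
      filter_upwards [(hu z h3.ge h1 h2).continuousAt.eventually_lt_const h4] with x hx _
      exact hx.le
  have hgood : ∀ z : ℝ × ℝ, ψ z.2 ≤ z.1 → 0 ≤ z.2 → z.2 ≤ η₀ → k ≤ u z → ψ z.2 < z.1 := by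
    intro z h1 h2 h3 h4
    refine lt_of_le_of_ne h1 fun h => ?_
    have := hk z.2 ⟨h2, h3⟩
    rw [h] at this
    exact absurd h4 (not_le.2 this)
  have J0 := integral_max_sq_mul_eq_zero (c := c 0) (A := 1 + 2 * (Cg / R) + Cg * (3 * 1 / η₀))
    (Or.inl rfl) hF hΩo (fun z hz => by
      rw [hΩ] at hz; simp only [halfPlane, mem_ofPred_eq]; linarith [hz.2.1])
    (hK 0 (2 * η₀ / 3) le_rfl (by linarith))
    (fun z hz => hbot z (hgood z hz.1.1 hz.1.2.2.1 (by linarith [hz.1.2.2.2]) hz.2)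
      (by linarith [hz.1.2.2.2])) huΩ hW
    (((hχdf.comp differentiable_fst).pow 2).mul (hκdf.comp differentiable_snd))
    (fun z => abs_cutoff_le (hχd z.1) (hκd z.2) (hab _) (hab _) (hχb _) (hκb _))
    (fun z hz hzK => by
      rw [hΩ] at hz
      by_contra! h
      rw [hc0] at h
      refine hzK ⟨⟨hz.1.le, ?_, hz.2.1.le, ?_⟩, h.1.le⟩
      · by_contra! h1
        exact h.2 (by rw [hχ0 _ h1]; ring)
      · by_contra! h1
        exact h.2 (by rw [hκ0 _ h1]; ring))
    (fun z hz hzΩ => by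
      have hz0 : 0 < z.2 := by simpa [halfPlane] using hz
      by_cases h1 : 2 * η₀ / 3 < z.2
      · filter_upwards [continuous_snd.continuousAt.eventually_const_lt h1] with x hx _
        exact Or.inr (by rw [hc0, hκ0 _ hx, mul_zero])
      · have h2 : z.1 ≤ ψ z.2 := by
          by_contra! h2
          exact hzΩ (by rw [hΩ]; exact ⟨h2, hz0, by linarith⟩)
        filter_upwards [hside z hz0.le (by linarith) h2] with x hx hxΩ using Or.inl (hx hxΩ))
  have J1 := integral_max_sq_mul_eq_zero (c := c 1) (A := 1 + 2 * (Cg / R) + Cg * (3 * 1 / η₀))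
    (Or.inr rfl) hF hΩo (fun z hz => by
      rw [hΩ] at hz; simp only [halfPlane, mem_ofPred_eq]; linarith [hz.2.2])
    (hK (η₀ / 3) η₀ (by linarith) le_rfl)
    (fun z hz => htop z (hgood z hz.1.1 (by linarith [hz.1.2.2.1]) hz.1.2.2.2 hz.2)
      (by linarith [hz.1.2.2.1])) huΩ hW
    (((hχdf.comp differentiable_fst).pow 2).mul ((hκdf.comp differentiable_snd).const_sub 1))
    (fun z => abs_cutoff_le (hχd z.1) ((hκd z.2).const_sub 1) (hab _) (hab' _) (hχb _)
      (by rw [abs_neg]; exact hκb _))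
    (fun z hz hzK => by
      rw [hΩ] at hz
      by_contra! h
      rw [hc1] at h
      refine hzK ⟨⟨hz.1.le, ?_, ?_, hz.2.2.le⟩, h.1.le⟩
      · by_contra! h1
        exact h.2 (by rw [hχ0 _ h1]; ring)
      · by_contra! h1
        exact h.2 (by rw [hκ1 _ h1]; ring))
    (fun z hz hzΩ => by
      have hz0 : z.2 < η₀ := by
        simp only [halfPlane, mem_ofPred_eq] at hz; linarith
      by_cases h1 : z.2 < η₀ / 3
      · filter_upwards [continuous_snd.continuousAt.eventually_lt_const h1] with x hx _
        exact Or.inr (by rw [hc1, hκ1 _ hx, sub_self, mul_zero])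
      · have h2 : z.1 ≤ ψ z.2 := by
          by_contra! h2
          exact hzΩ (by rw [hΩ]; exact ⟨h2, by linarith, hz0⟩)
        filter_upwards [hside z (by linarith) hz0.le h2] with x hx hxΩ using Or.inl (hx hxΩ))
  set B : Set (ℝ × ℝ) := Icc R (2 * R) ×ˢ Icc 0 η₀ with hB
  have hBm : MeasurableSet B := measurableSet_Icc.prod measurableSet_Icc
  have hBc : IsCompact B := isCompact_Icc.prod isCompact_Icc
  have hBi : Integrable (B.indicator fun _ => (Cg / R) ^ 2) := by
    rw [integrable_indicator_iff hBm]
    exact integrableOn_const hBc.measure_lt_top.ne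
  have hGe : EqOn (B.indicator fun _ => (Cg / R) ^ 2) (fun z : ℝ × ℝ =>
      (Icc R (2 * R)).indicator (fun _ => (Cg / R) ^ 2) z.1) Ω := by
    intro z hz
    rw [hΩ] at hz
    have hz2 : z.2 ∈ Icc 0 η₀ := ⟨hz.2.1.le, hz.2.2.le⟩
    by_cases h : z.1 ∈ Icc R (2 * R)
    · simp only [indicator_of_mem h]
      exact indicator_of_mem (show z ∈ B from ⟨h, hz2⟩) _
    · simp only [indicator_of_notMem h]
      exact indicator_of_notMem (fun h' : z ∈ B => h h'.1) _
  have hGi := (integrableOn_congr_fun hGe hΩo.measurableSet).1 hBi.integrableOn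
  have hGle : ∫ z in Ω, (Icc R (2 * R)).indicator (fun _ => (Cg / R) ^ 2) z.1 ≤
      Cg ^ 2 * η₀ / R := by
    rw [← setIntegral_congr_fun hΩo.measurableSet hGe]
    refine (setIntegral_le_integral hBi (Eventually.of_forall fun z =>
      indicator_nonneg (fun _ _ => by positivity) z)).trans_eq ?_
    rw [integral_indicator hBm, setIntegral_const, hB, Measure.volume_eq_prod, Measure.real,
      Measure.prod_prod, Real.volume_Icc, Real.volume_Icc, ENNReal.toReal_mul,
      ENNReal.toReal_ofReal (by linarith), ENNReal.toReal_ofReal (by linarith), smul_eq_mul]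
    field_simp
    ring
  have key := caccioppoli_of_cover hCF hΩo hlam hell huΩ hW hχs hκs hc0 hc1
    (fun i => by
      fin_cases i
      · exact J0
      · exact J1) hGi (fun x => by
      rw [(hχd x).deriv]
      by_cases h : x ∈ Icc R (2 * R)
      · rw [indicator_of_mem h, ← sq_abs]
        exact pow_le_pow_left₀ (abs_nonneg _) (hχb x) 2
      · rw [indicator_of_notMem h]
        have : deriv χ x = 0 := by
          rw [mem_Icc, not_and_or, not_le, not_le] at h
          rcases h with h | h
          · have : χ =ᶠ[𝓝 x] fun _ => 1 := by
              filter_upwards [eventually_lt_nhds h] with s hs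
              exact hg1 _ (by rw [div_le_iff₀ hR]; linarith)
            rw [this.deriv_eq, deriv_const]
          · have : χ =ᶠ[𝓝 x] fun _ => 0 := by
              filter_upwards [eventually_gt_nhds h] with s hs using hχ0 s hs
            rw [this.deriv_eq, deriv_const]
        rw [(hχd x).deriv] at this
        rw [this]; norm_num)
  refine ⟨key.1, ?_⟩
  rcases Ω.eq_empty_or_nonempty with hE | ⟨z₀, hz₀⟩
  · exfalso
    have : (ψ (η₀ / 2) + 1, η₀ / 2) ∈ Ω := by
      rw [hΩ]; exact ⟨by simp, by simp only; linarith, by simp only; linarith⟩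
    simp [hE] at this
  have hW0 : 0 ≤ W := (le_max_right _ _).trans (hW z₀ hz₀)
  have h2 := key.2.trans (mul_le_mul_of_nonneg_left hGle (by positivity))
  rw [← le_div_iff₀' hlam] at h2
  refine h2.trans_eq ?_
  field_simp

/-- A nonnegative weight whose cut-off integrals decay vanishes almost everywhere. -/
lemma ae_eq_zero_of_cutoff_decay {Ω : Set (ℝ × ℝ)} (hΩ : MeasurableSet Ω) {h : ℝ × ℝ → ℝ}
    (hh : ∀ z, 0 ≤ h z) {g : ℝ → ℝ} (hg1 : ∀ t ≤ 1, g t = 1)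
    {C : ℝ} (hI : ∀ R > 0, IntegrableOn (fun z => g (z.1 / R) ^ 2 * h z) Ω ∧
      ∫ z in Ω, g (z.1 / R) ^ 2 * h z ≤ C / R) :
    ∀ᵐ z, z ∈ Ω → h z = 0 := by
  have key : ∀ n : ℕ, ∀ᵐ z, z ∈ Ω → z.1 ≤ n → h z = 0 := by
    intro n
    have hn0 : (0 : ℝ) < n + 1 := by positivity
    set f : ℝ × ℝ → ℝ := {z : ℝ × ℝ | z.1 ≤ n}.indicator h with hf
    have hSm : MeasurableSet {z : ℝ × ℝ | z.1 ≤ n} := measurableSet_le measurable_fst measurable_const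
    have hle : ∀ R, (n : ℝ) + 1 ≤ R → ∀ z, f z ≤ g (z.1 / R) ^ 2 * h z := by
      intro R hR z
      by_cases hz : z.1 ≤ n
      · rw [hf, indicator_of_mem (show z ∈ {z : ℝ × ℝ | z.1 ≤ n} from hz), hg1 (z.1 / R)]
        · simp
        · rw [div_le_one (hn0.trans_le hR)]; linarith
      · rw [hf, indicator_of_notMem (show z ∉ {z : ℝ × ℝ | z.1 ≤ n} from hz)]
        exact mul_nonneg (sq_nonneg _) (hh z)
    have hf0 : ∀ z, 0 ≤ f z := fun z => indicator_nonneg (fun z _ => hh z) z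
    have hfi : IntegrableOn f Ω := by
      have h1 := (hI (n + 1) hn0).1
      have h2 : f = {z : ℝ × ℝ | z.1 ≤ n}.indicator fun z => g (z.1 / (n + 1)) ^ 2 * h z := by
        ext z
        by_cases hz : z.1 ≤ n
        · rw [hf, indicator_of_mem (show z ∈ {z : ℝ × ℝ | z.1 ≤ n} from hz),
            indicator_of_mem (show z ∈ {z : ℝ × ℝ | z.1 ≤ n} from hz), hg1 _ (by
              rw [div_le_one hn0]; linarith)]
          simp
        · rw [hf, indicator_of_notMem (show z ∉ {z : ℝ × ℝ | z.1 ≤ n} from hz),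
            indicator_of_notMem (show z ∉ {z : ℝ × ℝ | z.1 ≤ n} from hz)]
      rw [h2]
      exact h1.indicator hSm
    have hzero : ∫ z in Ω, f z = 0 := by
      refine le_antisymm ?_ (integral_nonneg hf0)
      have hlim : Tendsto (fun R : ℝ => C / R) atTop (𝓝 0) := tendsto_const_nhds.div_atTop tendsto_id
      refine ge_of_tendsto hlim ?_
      filter_upwards [eventually_ge_atTop ((n : ℝ) + 1)] with R hR
      have hR0 := hn0.trans_le hR
      exact (setIntegral_mono hfi (hI R hR0).1 (hle R hR)).trans (hI R hR0).2
    have h3 := (setIntegral_eq_zero_iff_of_nonneg_ae (Eventually.of_forall hf0) hfi).1 hzero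
    rw [EventuallyEq, ae_restrict_iff' hΩ] at h3
    filter_upwards [h3] with z hz hzΩ hzn
    have := hz hzΩ
    rwa [hf, indicator_of_mem (show z ∈ {z : ℝ × ℝ | z.1 ≤ n} from hzn)] at this
  filter_upwards [ae_all_iff.2 key] with z hz hzΩ
  obtain ⟨n, hn⟩ := exists_nat_ge z.1
  exact hz n hzΩ hn

/-- If `max (u - k) 0` has vanishing derivative and `u ≤ k` near the left end, then `u ≤ k`. -/
lemma le_of_max_mul_deriv_eq_zero {f : ℝ → ℝ} {k c : ℝ} (hf : ∀ x, c ≤ x → DifferentiableAt ℝ f x)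
    (hk : f c < k) (h0 : ∀ᵐ x, c < x → max (f x - k) 0 * deriv f x = 0) {x : ℝ} (hx : c ≤ x) :
    f x ≤ k := by
  have hd : ∀ t ∈ uIcc c x, HasDerivAt (fun t => max (f t - k) 0 ^ 2)
      (2 * max (f t - k) 0 * deriv f t) t := by
    intro t ht
    rw [uIcc_of_le hx] at ht
    have := HasDerivAt.comp (h₂ := fun t => max t 0 ^ 2) t (hasDerivAt_max_zero_sq (f t - k))
      ((hf t ht.1).hasDerivAt.sub_const k)
    exact this
  have hz : ∀ᵐ t ∂(volume.restrict (uIoc c x)), 2 * max (f t - k) 0 * deriv f t = 0 := by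
    rw [ae_restrict_iff' measurableSet_uIoc]
    filter_upwards [h0] with t ht htx
    rw [uIoc_of_le hx] at htx
    rw [mul_assoc, ht htx.1, mul_zero]
  have hi : IntervalIntegrable (fun t => 2 * max (f t - k) 0 * deriv f t) volume c x := by
    rw [intervalIntegrable_iff]
    exact (integrable_zero ℝ ℝ _).congr (hz.mono fun t ht => ht.symm)
  have h1 := intervalIntegral.integral_eq_sub_of_hasDerivAt hd hi
  rw [intervalIntegral.integral_zero_ae ((ae_restrict_iff' measurableSet_uIoc).1 hz),
    max_eq_right (by linarith : f c - k ≤ 0)] at h1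
  have h2 : max (f x - k) 0 ^ 2 = 0 := by linarith
  have h3 := pow_eq_zero_iff two_ne_zero |>.1 h2
  linarith [le_max_left (f x - k) 0]

lemma strip_le_of_lt {ψ : ℝ → ℝ} (hψ : Continuous ψ) {η₀ : ℝ} (hη₀ : 0 < η₀) {Ω : Set (ℝ × ℝ)}
    (hΩ : Ω = {z : ℝ × ℝ | ψ z.2 < z.1 ∧ 0 < z.2 ∧ z.2 < η₀})
    {u Y₁ Y₂ : ℝ × ℝ → ℝ} (hF : IsFlux u Y₁ Y₂) {lam : ℝ} (hlam : 0 < lam)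
    (hell : ∀ z ∈ Ω, lam * energy u z ≤ Y₁ z * dx u z + Y₂ z * dy u z)
    (hu : ∀ z : ℝ × ℝ, ψ z.2 ≤ z.1 → 0 ≤ z.2 → z.2 ≤ η₀ → DifferentiableAt ℝ u z)
    (hbot : ∀ z : ℝ × ℝ, ψ z.2 < z.1 → z.2 < η₀ → GoodAt (halfPlane 1 0) u Y₁ Y₂ z)
    (htop : ∀ z : ℝ × ℝ, ψ z.2 < z.1 → 0 < z.2 → GoodAt (halfPlane (-1) η₀) u Y₁ Y₂ z)
    {k Cu : ℝ} (hk : ∀ y ∈ Icc 0 η₀, u (ψ y, y) < k) (hCu : ∀ z ∈ Ω, |u z| ≤ Cu) :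
    ∀ z ∈ Ω, u z ≤ k := by
  have hΩo : IsOpen Ω := hΩ ▸ isOpen_strip hψ η₀
  obtain ⟨g, Cg, hg, hg01, hg1, hg2, hgC⟩ := exists_step
  obtain ⟨-, -, CF, -, hCF⟩ := id hF
  have hW : ∀ z ∈ Ω, max (u z - k) 0 ≤ Cu + |k| := fun z hz => by
    have h1 := abs_le.1 (hCu z hz)
    refine max_le ?_ ?_
    · linarith [neg_abs_le k]
    · linarith [abs_nonneg k, (abs_nonneg _).trans (hCu z hz)]
  have hae := ae_eq_zero_of_cutoff_decay hΩo.measurableSet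
    (h := fun z => max (u z - k) 0 * energy u z)
    (fun z => mul_nonneg (le_max_right _ _) (energy_nonneg u z)) hg1 fun R hR => by
      have := strip_energy_le hψ hη₀ hΩ hF (fun z => (hCF z).1) hlam hell hu hbot htop hk hW hg
        hg01 hg1 hg2 hgC hR
      have e : (fun z : ℝ × ℝ => g (z.1 / R) ^ 2 * (max (u z - k) 0 * energy u z)) =
          fun z => max (u z - k) 0 * g (z.1 / R) ^ 2 * energy u z := by
        ext z; ring
      rw [e]
      exact this
  have hswap : ∀ᵐ y : ℝ, ∀ᵐ x : ℝ, (x, y) ∈ Ω → max (u (x, y) - k) 0 * energy u (x, y) = 0 := by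
    rw [Measure.volume_eq_prod, ← Measure.prod_swap] at hae
    have h1 := ae_of_ae_map measurable_swap.aemeasurable hae
    exact Measure.ae_ae_of_ae_prod h1
  have hline : ∀ᵐ y : ℝ, y ∈ Ioo 0 η₀ → ∀ x, (x, y) ∈ Ω → u (x, y) ≤ k := by
    filter_upwards [hswap] with y hy hyI x hx
    have hdl : ∀ x, ψ y ≤ x → HasDerivAt (fun x => u (x, y)) (dx u (x, y)) x := by
      intro x hx
      have h1 := (hu (x, y) hx hyI.1.le hyI.2.le).hasFDerivAt
      have h2 : HasDerivAt (fun x : ℝ => (x, y)) ((1 : ℝ), (0 : ℝ)) x :=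
        (hasDerivAt_id x).prodMk (hasDerivAt_const x y)
      exact h1.comp_hasDerivAt x h2
    rw [hΩ] at hx
    refine le_of_max_mul_deriv_eq_zero (f := fun x => u (x, y)) (c := ψ y)
      (fun x hx => (hdl x hx).differentiableAt) (hk y ⟨hyI.1.le, hyI.2.le⟩) ?_ hx.1.le
    filter_upwards [hy] with t ht hct
    rw [(hdl t hct.le).deriv]
    have h3 := ht (by rw [hΩ]; exact ⟨hct, hyI⟩)
    rcases mul_eq_zero.1 h3 with h4 | h4
    · rw [h4, zero_mul]
    · have h5 : dx u (t, y) = 0 := by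
        have : dx u (t, y) ^ 2 ≤ 0 := by
          simp only [energy] at h4
          linarith [sq_nonneg (dy u (t, y))]
        exact pow_eq_zero_iff two_ne_zero |>.1 (le_antisymm this (sq_nonneg _))
      rw [h5, mul_zero]
  intro z hz
  by_contra! hzk
  have huz : ContinuousAt u z := by
    rw [hΩ] at hz; exact (hu z hz.1.le hz.2.1.le hz.2.2.le).continuousAt
  have hev : ∀ᶠ x in 𝓝 z, x ∈ Ω ∧ k < u x :=
    (hΩo.eventually_mem hz).and (huz.eventually_const_lt hzk)
  have hcurve : Tendsto (fun y : ℝ => (z.1, y)) (𝓝 z.2) (𝓝 z) := by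
    have : Continuous fun y : ℝ => (z.1, y) := by fun_prop
    exact this.tendsto z.2
  obtain ⟨ε, hε, hball⟩ := Metric.eventually_nhds_iff_ball.1 (hcurve.eventually hev)
  obtain ⟨y, hy1, hy2⟩ := (Measure.dense_of_ae hline).inter_open_nonempty _ isOpen_ball
    ⟨z.2, mem_ball_self hε⟩
  have h1 := hball y hy1
  have h2 : y ∈ Ioo 0 η₀ := by
    have := h1.1
    rw [hΩ] at this
    exact this.2
  exact absurd (hy2 h2 z.1 h1.1) (not_le.2 h1.2)

end StripExtreme

open Set StripExtreme

/-- Extreme principle in a semi-infinite strip `Ω' = {ξ > ψ(η), 0 < η < η₀}` behind a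
curve `S = {ξ = ψ(η)}`: a bounded continuous weak solution of a uniformly elliptic
divergence-form equation with bounded `C¹_loc` coefficients, satisfying homogeneous
Neumann conditions on the lateral boundaries, attains at least one of its infimum and
supremum on `S`. -/
theorem extreme_principle_infinite_strip
    (ψ : ℝ → ℝ) (hψ : ContDiff ℝ 2 ψ) (η₀ : ℝ) (hη₀ : 0 < η₀)
    (Ω' : Set (ℝ × ℝ))
    (hΩ' : Ω' = {z : ℝ × ℝ | ψ z.2 < z.1 ∧ 0 < z.2 ∧ z.2 < η₀})
    (a : ℝ × ℝ → Fin 2 → Fin 2 → ℝ)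
    -- uniform ellipticity and boundedness of the coefficients
    (lam Λ : ℝ) (hlam : 0 < lam)
    (hell : ∀ z ∈ closure Ω', ∀ ξ₁ ξ₂ : ℝ,
      lam * (ξ₁ ^ 2 + ξ₂ ^ 2) ≤
        a z 0 0 * ξ₁ ^ 2 + (a z 0 1 + a z 1 0) * ξ₁ * ξ₂ + a z 1 1 * ξ₂ ^ 2)
    (hbound : ∀ z ∈ closure Ω', ∀ i j, |a z i j| ≤ Λ)
    (hacont : ∀ i j, ∀ K : Set (ℝ × ℝ), IsCompact K → K ⊆ closure Ω' →
      ContDiffOn ℝ 1 (fun z => a z i j) K)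
    (u : ℝ × ℝ → ℝ)
    -- u is bounded, continuous on the closure, and C¹ on compact subsets of the closure
    (hub : ∃ C : ℝ, ∀ z ∈ closure Ω', |u z| ≤ C)
    (hucont : ContinuousOn u (closure Ω'))
    (huC1 : ∀ z ∈ closure Ω', DifferentiableAt ℝ u z)
    -- weak formulation of ∂ξ(a¹¹∂ξu + a¹²∂ηu) + ∂η(a²¹∂ξu + a²²∂ηu) = 0 in Ω'
    (hweak : ∀ φ : ℝ × ℝ → ℝ, ContDiff ℝ (⊤ : ℕ∞) φ → HasCompactSupport φ →
      tsupport φ ⊆ Ω' →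
      ∫ z in Ω',
        ((a z 0 0 * fderiv ℝ u z (1, 0) + a z 0 1 * fderiv ℝ u z (0, 1)) *
            fderiv ℝ φ z (1, 0) +
          (a z 1 0 * fderiv ℝ u z (1, 0) + a z 1 1 * fderiv ℝ u z (0, 1)) *
            fderiv ℝ φ z (0, 1)) = 0)
    -- homogeneous Neumann conditions on the lateral boundaries
    (hNeu0 : ∀ ξ : ℝ, ψ 0 < ξ →
      a (ξ, 0) 1 0 * fderiv ℝ u (ξ, 0) (1, 0) +
        a (ξ, 0) 1 1 * fderiv ℝ u (ξ, 0) (0, 1) = 0)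
    (hNeu1 : ∀ ξ : ℝ, ψ η₀ < ξ →
      a (ξ, η₀) 1 0 * fderiv ℝ u (ξ, η₀) (1, 0) +
        a (ξ, η₀) 1 1 * fderiv ℝ u (ξ, η₀) (0, 1) = 0) :
    (∃ η ∈ Set.Icc 0 η₀, ∀ z ∈ closure Ω', u (ψ η, η) ≤ u z) ∨
    (∃ η ∈ Set.Icc 0 η₀, ∀ z ∈ closure Ω', u z ≤ u (ψ η, η)) := by
  have hψc := hψ.continuous
  have hcl := closure_strip hψc hη₀
  rw [← hΩ'] at hcl
  have hmem : ∀ z : ℝ × ℝ, z ∈ closure Ω' ↔ ψ z.2 ≤ z.1 ∧ 0 ≤ z.2 ∧ z.2 ≤ η₀ := fun z => by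
    rw [hcl]; rfl
  have hsub : Ω' ⊆ closure Ω' := subset_closure
  have hΛ0 : 0 ≤ Λ := (abs_nonneg _).trans
    (hbound (ψ 0, 0) ((hmem _).2 ⟨le_rfl, le_rfl, hη₀.le⟩) 0 0)
  set A : ℝ × ℝ → Fin 2 → Fin 2 → ℝ :=
    fun z i j => (closure Ω').indicator (fun z => a z i j) z with hA
  have hAa : ∀ z ∈ closure Ω', ∀ i j, A z i j = a z i j := fun z hz i j => indicator_of_mem hz _
  have hAm : ∀ i j, Measurable fun z => A z i j := fun i j =>
    measurable_indicator_of_contDiffOn isClosed_closure (hacont i j)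
  have hAΛ : ∀ z i j, |A z i j| ≤ Λ := fun z i j => by
    by_cases hz : z ∈ closure Ω'
    · rw [hAa z hz]; exact hbound z hz i j
    · rw [show A z i j = 0 from indicator_of_notMem hz _, abs_zero]; exact hΛ0
  have hAcont : ∀ i j, ∀ K : Set (ℝ × ℝ), IsCompact K → K ⊆ closure Ω' →
      ContDiffOn ℝ 1 (fun z => A z i j) K := fun i j K hK hKc =>
    (hacont i j K hK hKc).congr fun z hz => hAa z (hKc hz) i j
  set Y₁ : ℝ × ℝ → ℝ := fun z => A z 0 0 * dx u z + A z 0 1 * dy u z with hY₁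
  set Y₂ : ℝ × ℝ → ℝ := fun z => A z 1 0 * dx u z + A z 1 1 * dy u z with hY₂
  have hYb : ∀ z i, |A z i 0 * dx u z + A z i 1 * dy u z| ≤ Λ * (|dx u z| + |dy u z|) := by
    intro z i
    refine (abs_add_le _ _).trans ?_
    rw [abs_mul, abs_mul, mul_add]
    gcongr
    · exact hAΛ z i 0
    · exact hAΛ z i 1
  have hF : IsFlux u Y₁ Y₂ :=
    ⟨((hAm 0 0).mul (measurable_dx u)).add ((hAm 0 1).mul (measurable_dy u)),
      ((hAm 1 0).mul (measurable_dx u)).add ((hAm 1 1).mul (measurable_dy u)),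
      Λ, hΛ0, fun z => ⟨hYb z 0, hYb z 1⟩⟩
  have hellY : ∀ z ∈ Ω', lam * energy u z ≤ Y₁ z * dx u z + Y₂ z * dy u z := fun z hz => by
    have := hell z (hsub hz) (dx u z) (dy u z)
    simp only [hY₁, hY₂, hAa z (hsub hz), energy]
    linarith
  have hΩo : IsOpen Ω' := hΩ' ▸ isOpen_strip hψc η₀
  have hweakY : WeakZero Ω' Y₁ Y₂ Ω' := fun φ h1 h2 h3 => by
    rw [← hweak φ h1 h2 h3]
    refine setIntegral_congr_fun hΩo.measurableSet fun z hz => ?_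
    simp only [hY₁, hY₂, hAa z (hsub hz), dx, dy]
  have hbot : ∀ z : ℝ × ℝ, ψ z.2 < z.1 → z.2 < η₀ → GoodAt (halfPlane 1 0) u Y₁ Y₂ z := by
    intro z h1 h2
    refine goodAt_of_domain (W := {z : ℝ × ℝ | ψ z.2 < z.1} ∩ {z | z.2 < η₀}) (Or.inl rfl) hAm hAΛ
      hF (fun _ => rfl) (fun _ => rfl)
      ((isOpen_lt (by fun_prop) (by fun_prop)).inter (isOpen_lt (by fun_prop) (by fun_prop)))
      ?_ ?_ ?_ hAcont hlam hellY huC1 hweakY ?_ z ⟨h1, h2⟩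
    · ext w
      rw [hΩ']
      simp only [halfPlane, mem_inter_iff, mem_ofPred_eq, one_mul, sub_zero]
      tauto
    · intro w hw
      rw [hΩ'] at hw
      simpa [halfPlane] using hw.2.1
    · intro w hw hw0
      exact (hmem w).2 ⟨hw.1.le, by simpa using hw0, hw.2.le⟩
    · intro s hs
      have hs' : (s, (0 : ℝ)) ∈ closure Ω' := (hmem _).2 ⟨hs.1.le, le_rfl, hη₀.le⟩
      simp only [hAa _ hs']
      exact hNeu0 s hs.1
  have htop : ∀ z : ℝ × ℝ, ψ z.2 < z.1 → 0 < z.2 → GoodAt (halfPlane (-1) η₀) u Y₁ Y₂ z := by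
    intro z h1 h2
    refine goodAt_of_domain (W := {z : ℝ × ℝ | ψ z.2 < z.1} ∩ {z | 0 < z.2}) (Or.inr rfl) hAm hAΛ
      hF (fun _ => rfl) (fun _ => rfl)
      ((isOpen_lt (by fun_prop) (by fun_prop)).inter (isOpen_lt (by fun_prop) (by fun_prop)))
      ?_ ?_ ?_ hAcont hlam hellY huC1 hweakY ?_ z ⟨h1, h2⟩
    · ext w
      rw [hΩ']
      simp only [halfPlane, mem_inter_iff, mem_ofPred_eq, neg_mul, one_mul, neg_sub, sub_pos]
      tauto
    · intro w hw
      rw [hΩ'] at hw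
      simpa [halfPlane] using hw.2.2
    · intro w hw hw0
      exact (hmem w).2 ⟨hw.1.le, hw.2.le, by linarith⟩
    · intro s hs
      have hs' : (s, η₀) ∈ closure Ω' := (hmem _).2 ⟨hs.1.le, hη₀.le, le_rfl⟩
      simp only [hAa _ hs']
      exact hNeu1 s hs.1
  have hS : ContinuousOn (fun y => u (ψ y, y)) (Icc 0 η₀) :=
    hucont.comp (t := closure Ω') (f := fun y => (ψ y, y)) (by fun_prop)
      fun y hy => (hmem _).2 ⟨le_rfl, hy.1, hy.2⟩
  obtain ⟨y₀, hy₀, hmax⟩ := isCompact_Icc.exists_isMaxOn (nonempty_Icc.2 hη₀.le) hS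
  obtain ⟨Cu, hCu⟩ := hub
  have hle : ∀ z ∈ Ω', u z ≤ u (ψ y₀, y₀) := fun z hz => by
    refine le_of_forall_pos_le_add fun δ hδ => ?_
    exact strip_le_of_lt hψc hη₀ hΩ' hF hlam hellY
      (fun z h1 h2 h3 => huC1 z ((hmem z).2 ⟨h1, h2, h3⟩)) hbot htop
      (fun y hy => lt_of_le_of_lt (hmax hy) (by linarith)) (fun z hz => hCu z (hsub hz)) z hz
  exact Or.inr ⟨y₀, hy₀, fun z hz => le_on_closure hle hucont continuousOn_const hz⟩
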